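/- Let F be an infinite field with char F ≠ 2 and let n ≥ 1. Let a = (α_1), b = (β_1), c = (γ_1, …, γ_r) be sequences of positive integers with sums at most n, with α_1 ≤ β_1, and with β_1 ≤ γ_1 in the case r = 1. Assume condition (C): if max(α_1, β_1, γ_1) < n then the group F^×/(F^×)^2 is finite. Then the set of G-orbits on M_a × M_b × M_c under the diagonal action of G = O_{2n+1}(F) is finite if and only if one of the following holds: (I) α_1 = β_1 = n; (II) α_1 = 1; (III) r = 1 and γ_1 = n; (IV) r = 2 and β_1 = n. -/

import Mathlib

open Module

/-- The symmetric bilinear form on `F^N` given by `(e_i, e_j) = δ_{i, N+1-j}`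
(in 1-indexed notation), i.e. `(u, v) = ∑ i, u i * v (rev i)`. -/
def bform (F : Type*) [Field F] (N : ℕ) (u v : Fin N → F) : F :=
  ∑ i, u i * v i.rev

/-- `g` belongs to the split orthogonal group `O_N(F)`. -/
def IsOrthMap (F : Type*) [Field F] (N : ℕ)
    (g : (Fin N → F) ≃ₗ[F] (Fin N → F)) : Prop :=
  ∀ u v, bform F N (g u) (g v) = bform F N u v

/-- A subspace `V` is isotropic if `(V, V) = {0}`. -/
def IsIsotropic (F : Type*) [Field F] (N : ℕ) (V : Submodule F (Fin N → F)) : Prop :=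
  ∀ u ∈ V, ∀ v ∈ V, bform F N u v = 0

/-- A flag of type `a = (a 0, …, a (p-1))` in `F^{2n+1}` : an increasing chain of
subspaces `V 0 ⊆ ⋯ ⊆ V (p-1)` with `dim (V i) = a 0 + ⋯ + a i` which is isotropic
(equivalently, by monotonicity, whose top member is isotropic). -/
def IsFlag (F : Type*) [Field F] (n p : ℕ) (a : Fin p → ℕ)
    (V : Fin p → Submodule F (Fin (2*n+1) → F)) : Prop :=
  Monotone V ∧ (∀ i : Fin p, finrank F (V i) = ∑ j ∈ Finset.Iic i, a j) ∧
    ∀ i : Fin p, IsIsotropic F (2*n+1) (V i)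

/-- The flag variety `M_a`. -/
def FlagVar (F : Type*) [Field F] (n p : ℕ) (a : Fin p → ℕ) :=
  { V : Fin p → Submodule F (Fin (2*n+1) → F) // IsFlag F n p a V }

/-- The orbit relation of the diagonal action of `O_{2n+1}(F)` on the triple flag
variety `M_a × M_b × M_c`. -/
def TripleRel (F : Type*) [Field F] (n p q r : ℕ)
    (a : Fin p → ℕ) (b : Fin q → ℕ) (c : Fin r → ℕ)
    (x y : FlagVar F n p a × FlagVar F n q b × FlagVar F n r c) : Prop :=
  ∃ g : (Fin (2*n+1) → F) ≃ₗ[F] (Fin (2*n+1) → F), IsOrthMap F (2*n+1) g ∧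
    (∀ i, Submodule.map g.toLinearMap (x.1.1 i) = y.1.1 i) ∧
    (∀ i, Submodule.map g.toLinearMap (x.2.1.1 i) = y.2.1.1 i) ∧
    (∀ i, Submodule.map g.toLinearMap (x.2.2.1 i) = y.2.2.1 i)

universe u

section LinearAlgebra

variable {F : Type u} [Field F] {V : Type u} [AddCommGroup V] [Module F V]

/-- A functional `φ` is represented on `E` by an element of `L` as soon as it vanishes on the
part of `E` orthogonal to `L`. -/
theorem exists_rep {W : Type*} [AddCommGroup W] [Module F W] [FiniteDimensional F V]
    (B : W →ₗ[F] V →ₗ[F] F) (L : Submodule F W) (E : Submodule F V)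
    (φ : V →ₗ[F] F) (h : ∀ e ∈ E, (∀ l ∈ L, B l e = 0) → φ e = 0) :
    ∃ l ∈ L, ∀ e ∈ E, B l e = φ e := by
  classical
  let T : L →ₗ[F] Dual F E :=
    ((LinearMap.lcomp F F E.subtype).comp B).comp L.subtype
  have hT : ∀ (l : L) (e : E), T l e = B l e := fun l e => rfl
  have key : φ.comp E.subtype ∈ LinearMap.range T := by
    rw [← Subspace.dualCoannihilator_dualAnnihilator_eq (W := LinearMap.range T)]
    rw [Submodule.mem_dualAnnihilator]
    intro e he
    rw [Submodule.mem_dualCoannihilator] at he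
    refine h e e.2 fun l hl => ?_
    exact he (T ⟨l, hl⟩) ⟨_, rfl⟩
  obtain ⟨l, hl⟩ := key
  refine ⟨l, l.2, fun e he => ?_⟩
  exact LinearMap.congr_fun hl ⟨e, he⟩

/-- Nondegeneracy on the left. -/
def Nondeg (B : V →ₗ[F] V →ₗ[F] F) : Prop := ∀ x, (∀ y, B x y = 0) → x = 0

theorem exists_dual [FiniteDimensional F V] {B : V →ₗ[F] V →ₗ[F] F} (hs : ∀ x y, B x y = B y x)
    (hB : Nondeg B) (φ : V →ₗ[F] F) : ∃ l, ∀ e, B l e = φ e := by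
  obtain ⟨l, -, hl⟩ := exists_rep B ⊤ ⊤ φ (fun e _ h => by
    have : e = 0 := hB e fun y => by rw [hs]; exact h y trivial
    simp [this])
  exact ⟨l, fun e => hl e trivial⟩

theorem exists_functional (S : Submodule F V) {x : V} (hx : x ∉ S) :
    ∃ φ : V →ₗ[F] F, φ x = 1 ∧ ∀ s ∈ S, φ s = 0 := by
  obtain ⟨φ, h1, h2⟩ := Submodule.exists_le_ker_of_notMem hx
  refine ⟨(φ x)⁻¹ • φ, by simp [h1], fun s hs => ?_⟩
  have : φ s = 0 := h2 hs
  simp [this]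

theorem exists_orth [FiniteDimensional F V] {B : V →ₗ[F] V →ₗ[F] F} (hs : ∀ x y, B x y = B y x)
    (hB : Nondeg B) (S : Submodule F V) {x : V} (hx : x ∉ S) :
    ∃ y, B x y = 1 ∧ ∀ s ∈ S, B s y = 0 := by
  obtain ⟨φ, h1, h2⟩ := exists_functional S hx
  obtain ⟨l, hl⟩ := exists_dual hs hB φ
  exact ⟨l, by rw [hs, hl, h1], fun s hs' => by rw [hs, hl, h2 s hs']⟩

theorem mem_of_dperp [FiniteDimensional F V] {B : V →ₗ[F] V →ₗ[F] F}
    (hs : ∀ x y, B x y = B y x) (hB : Nondeg B) (S : Submodule F V) {x : V}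
    (h : ∀ y, (∀ s ∈ S, B s y = 0) → B x y = 0) : x ∈ S := by
  by_contra hx
  obtain ⟨y, h1, h2⟩ := exists_orth hs hB S hx
  exact one_ne_zero (h1.symm.trans (h y h2))

/-- The orthogonal of a subspace. -/
def orth (B : V →ₗ[F] V →ₗ[F] F) (S : Submodule F V) : Submodule F V where
  carrier := {x | ∀ s ∈ S, B x s = 0}
  add_mem' hx hy s hs := by simp [hx s hs, hy s hs]
  zero_mem' s _ := by simp
  smul_mem' a x hx s hs := by simp [hx s hs]

theorem mem_orth {B : V →ₗ[F] V →ₗ[F] F} {S : Submodule F V} {x : V} :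
    x ∈ orth B S ↔ ∀ s ∈ S, B x s = 0 := Iff.rfl

/-- Two functionals agreeing on `S ⊓ T` glue. -/
theorem exists_glue [FiniteDimensional F V] (S T : Submodule F V) (φ ψ : V →ₗ[F] F)
    (h : ∀ x ∈ S, x ∈ T → φ x = ψ x) :
    ∃ χ : V →ₗ[F] F, (∀ x ∈ S, χ x = φ x) ∧ ∀ x ∈ T, χ x = ψ x := by
  obtain ⟨χ, h1, h2⟩ := exists_rep (LinearMap.id : Dual F V →ₗ[F] V →ₗ[F] F)
    S.dualAnnihilator T (ψ - φ) (fun e he h' => by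
      have : e ∈ S := by
        by_contra hS
        obtain ⟨χ, hχ, hχ'⟩ := exists_functional S hS
        have := h' χ ((Submodule.mem_dualAnnihilator _).2 hχ')
        simp [hχ] at this
      simp [h e this he])
  refine ⟨φ + χ, fun x hx => ?_, fun x hx => ?_⟩
  · simp [(Submodule.mem_dualAnnihilator _).1 h1 x hx]
  · have := h2 x hx
    simp only [LinearMap.id_apply, LinearMap.sub_apply] at this
    simp [this]

end LinearAlgebra

/-- A configuration: a finite-dimensional space with a symmetric bilinear form and a family of
subspaces. -/
structure Cfg (F : Type u) [Field F] (ι : Type) where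
  V : Type u
  [acg : AddCommGroup V]
  [mod : Module F V]
  [fin : FiniteDimensional F V]
  B : V →ₗ[F] V →ₗ[F] F
  symm : ∀ x y, B x y = B y x
  sub : ι → Submodule F V

attribute [instance] Cfg.acg Cfg.mod Cfg.fin

namespace Cfg

variable {F : Type u} [Field F] {ι ι' : Type}

/-- Isometry of configurations. -/
def Iso (c d : Cfg F ι) : Prop :=
  ∃ g : c.V ≃ₗ[F] d.V, (∀ x y, d.B (g x) (g y) = c.B x y) ∧ ∀ i x, x ∈ c.sub i ↔ g x ∈ d.sub i

theorem Iso.refl (c : Cfg F ι) : Iso c c := ⟨LinearEquiv.refl F c.V, by simp, by simp⟩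

theorem Iso.symm {c d : Cfg F ι} (h : Iso c d) : Iso d c := by
  obtain ⟨g, h1, h2⟩ := h
  exact ⟨g.symm, fun x y => by rw [← h1]; simp, fun i x => by rw [h2]; simp⟩

theorem Iso.trans {c d e : Cfg F ι} (h : Iso c d) (h' : Iso d e) : Iso c e := by
  obtain ⟨g, h1, h2⟩ := h
  obtain ⟨k, h3, h4⟩ := h'
  exact ⟨g.trans k, fun x y => by simp [h1, h3], fun i x => by rw [h2, h4]; rfl⟩

/-- The configurations with property `P` fall into finitely many isometry classes. -/
def FinIso (P : Cfg F ι → Prop) : Prop :=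
  ∃ s : Set (Cfg F ι), s.Finite ∧ ∀ c, P c → ∃ d ∈ s, Iso c d

theorem FinIso.mono {P Q : Cfg F ι → Prop} (hQ : FinIso Q) (h : ∀ c, P c → Q c) : FinIso P := by
  obtain ⟨s, hs, hs'⟩ := hQ
  exact ⟨s, hs, fun c hc => hs' c (h c hc)⟩

theorem FinIso.or {P Q : Cfg F ι → Prop} (hP : FinIso P) (hQ : FinIso Q) :
    FinIso fun c => P c ∨ Q c := by
  obtain ⟨s, hs, hs'⟩ := hP
  obtain ⟨t, ht, ht'⟩ := hQ
  refine ⟨s ∪ t, hs.union ht, ?_⟩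
  rintro c (hc | hc)
  · obtain ⟨d, hd, h⟩ := hs' c hc
    exact ⟨d, Or.inl hd, h⟩
  · obtain ⟨d, hd, h⟩ := ht' c hc
    exact ⟨d, Or.inr hd, h⟩

/-- `c` is recovered up to isometry, and up to a parameter in a finite set, from the isometry
class of a configuration with property `Q`. -/
def Reduces (Q : Cfg F ι' → Prop) {P : Type*} (G : Cfg F ι' → P → Cfg F ι) (c : Cfg F ι) : Prop :=
  ∃ c', Q c' ∧ ∀ d, Iso c' d → ∃ p, Iso c (G d p)

theorem FinIso.reduces {Q : Cfg F ι' → Prop} (hQ : FinIso Q) {P : Type*} [Finite P]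
    (G : Cfg F ι' → P → Cfg F ι) : FinIso (Reduces Q G) := by
  obtain ⟨s, hs, hs'⟩ := hQ
  refine ⟨Set.image2 G s Set.univ, hs.image2 _ Set.finite_univ, ?_⟩
  rintro c ⟨c', hc', h⟩
  obtain ⟨d, hd, hd'⟩ := hs' c' hc'
  obtain ⟨p, hp⟩ := h d hd'
  exact ⟨_, ⟨d, hd, p, trivial, rfl⟩, hp⟩

/-- Reindexing a configuration. -/
abbrev reindex (f : ι' → ι) (c : Cfg F ι) : Cfg F ι' where
  V := c.V
  B := c.B
  symm := c.symm
  sub i := c.sub (f i)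

theorem Iso.reindex {c d : Cfg F ι} (h : Iso c d) (f : ι' → ι) :
    Iso (c.reindex f) (d.reindex f) := by
  obtain ⟨g, h1, h2⟩ := h
  exact ⟨g, h1, fun i => h2 (f i)⟩

theorem FinIso.reindex {Q : Cfg F ι → Prop} (hQ : FinIso Q) (f : ι' → ι) {P : Cfg F ι' → Prop}
    (h : ∀ c, P c → ∃ c', Q c' ∧ Iso c (c'.reindex f)) : FinIso P := by
  refine (hQ.reduces (P := Unit) (fun d _ => d.reindex f)).mono fun c hc => ?_
  obtain ⟨c', h1, h2⟩ := h c hc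
  exact ⟨c', h1, fun d hd => ⟨(), h2.trans (hd.reindex f)⟩⟩

/-- The possible positions of a subspace relative to a hyperbolic pair. -/
inductive Ty
  | inn
  | perp
  | non

instance : Finite Ty :=
  Finite.of_surjective (fun x : Option Bool => match x with
    | none => Ty.inn
    | some true => Ty.perp
    | some false => Ty.non) (by
      rintro (_ | _ | _)
      exacts [⟨none, rfl⟩, ⟨some true, rfl⟩, ⟨some false, rfl⟩])

section Model

variable (d : Cfg F ι)

/-- The form on a hyperbolic plane plus `d`. -/
def hypForm : (F × F × d.V) →ₗ[F] (F × F × d.V) →ₗ[F] F :=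
  LinearMap.mk₂ F (fun p q => p.1 * q.2.1 + p.2.1 * q.1 + d.B p.2.2 q.2.2)
    (by intros; simp; ring) (by intros; simp; ring) (by intros; simp; ring)
    (by intros; simp; ring)

@[simp] theorem hypForm_apply (p q : F × F × d.V) :
    d.hypForm p q = p.1 * q.2.1 + p.2.1 * q.1 + d.B p.2.2 q.2.2 := rfl

/-- The inverse Eichler transformation. -/
def eich (w : d.V) : (F × F × d.V) →ₗ[F] (F × F × d.V) where
  toFun p := (p.1 - p.2.1 * (d.B w w / 2) + d.B w p.2.2, p.2.1, p.2.2 - p.2.1 • w)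
  map_add' p q := by
    ext
    · simp; ring
    · simp
    · simp [add_smul]; abel
  map_smul' a p := by
    ext
    · simp; ring
    · simp
    · simp [smul_sub, mul_smul]

@[simp] theorem eich_apply (w : d.V) (p : F × F × d.V) : d.eich w p =
    (p.1 - p.2.1 * (d.B w w / 2) + d.B w p.2.2, p.2.1, p.2.2 - p.2.1 • w) := rfl

/-- Standard position. -/
def std (τ : Ty) (S : Submodule F d.V) : Submodule F (F × F × d.V) :=
  match τ with
  | .inn => Submodule.prod ⊤ (Submodule.prod ⊥ S)
  | .perp => Submodule.prod ⊥ (Submodule.prod ⊥ S)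
  | .non => Submodule.prod ⊥ (Submodule.prod ⊤ S)

/-- The configuration on a hyperbolic plane plus `d` with given positions and twists. -/
abbrev tw (τ : ι → Ty) (w : ι → d.V) : Cfg F ι where
  V := F × F × d.V
  B := d.hypForm
  symm x y := by simp [d.symm x.2.2]; ring
  sub i := (d.std (τ i) (d.sub i)).comap (d.eich (w i))

theorem eich_add (h2 : (2 : F) ≠ 0) (w w' : d.V) (p : F × F × d.V) :
    d.eich w (d.eich w' p) = d.eich (w + w') p := by
  ext
  · simp [d.symm w' w]; field_simp; ring
  · simp
  · simp [smul_add]; abel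

/-- The twists that preserve the standard position. -/
def tws (τ : Ty) (S : Submodule F d.V) : Submodule F d.V :=
  match τ with
  | .inn => ⊤
  | .perp => orth d.B S
  | .non => S

theorem eich_std {τ : Ty} {S : Submodule F d.V} (hS : τ = .non → ∀ x ∈ S, ∀ y ∈ S, d.B x y = 0)
    {k : d.V} (hk : k ∈ d.tws τ S) (p : F × F × d.V) (hp : p ∈ d.std τ S) :
    d.eich k p ∈ d.std τ S := by
  obtain ⟨a, b, x⟩ := p
  cases τ
  · simp [std] at hp ⊢
    obtain ⟨rfl, hx⟩ := hp
    simp [hx]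
  · simp [std] at hp ⊢
    obtain ⟨rfl, rfl, hx⟩ := hp
    simp [hx, hk x hx]
  · simp [std] at hp ⊢
    obtain ⟨rfl, hx⟩ := hp
    have hk' : k ∈ S := hk
    simp [hS rfl k hk' k hk', hS rfl k hk' x hx, S.sub_mem hx (S.smul_mem b hk')]

/-- Twists matter only up to scaling, a common translation and admissible changes. -/
theorem tw_iso (h2 : (2 : F) ≠ 0) (τ : ι → Ty) (w w' : ι → d.V)
    (hS : ∀ i, τ i = .non → ∀ x ∈ d.sub i, ∀ y ∈ d.sub i, d.B x y = 0)
    (s : F) (hs : s ≠ 0) (a : d.V) (h : ∀ i, w' i - s • w i - a ∈ d.tws (τ i) (d.sub i)) :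
    Iso (d.tw τ w) (d.tw τ w') := by
  have hinv : ∀ p, d.eich (-a) (d.eich a p) = p := fun p => by
    rw [eich_add _ h2]; ext <;> simp
  have hinv' : ∀ p, d.eich a (d.eich (-a) p) = p := fun p => by
    rw [eich_add _ h2]; ext <;> simp
  let g : (F × F × d.V) ≃ₗ[F] (F × F × d.V) :=
    { toFun := fun p => d.eich (-a) (s * p.1, s⁻¹ * p.2.1, p.2.2)
      invFun := fun p => (s⁻¹ * (d.eich a p).1, s * (d.eich a p).2.1, (d.eich a p).2.2)
      map_add' := fun p q => by rw [← map_add]; congr 1; ext <;> simp [mul_add]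
      map_smul' := fun r p => by
        rw [← map_smul]; ext <;> simp [mul_left_comm]
      left_inv := fun p => by
        simp only [hinv']
        ext <;> simp [hs]
      right_inv := fun p => by
        conv_rhs => rw [← hinv p]
        ext <;> simp [hs] }
  have hg : ∀ p, g p = d.eich (-a) (s * p.1, s⁻¹ * p.2.1, p.2.2) := fun p => rfl
  refine ⟨g, ?_, ?_⟩
  · intro x y
    rw [hg, hg]
    simp [d.symm _ a]
    field_simp
    ring
  · intro i p
    rw [hg]
    simp only [Submodule.mem_comap]
    rw [eich_add _ h2]
    have e1 : d.eich (w' i + -a) (s * p.1, s⁻¹ * p.2.1, p.2.2) =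
        d.eich (w' i - s • w i - a) (d.eich (s • w i) (s * p.1, s⁻¹ * p.2.1, p.2.2)) := by
      rw [eich_add _ h2]; congr 2; abel
    have e2 : d.eich (s • w i) (s * p.1, s⁻¹ * p.2.1, p.2.2) =
        (s * (d.eich (w i) p).1, s⁻¹ * (d.eich (w i) p).2.1, (d.eich (w i) p).2.2) := by
      ext
      · simp; field_simp
      · simp
      · simp [smul_smul, hs, mul_assoc, mul_comm]
    have e3 : ∀ q : F × F × d.V, q ∈ d.std (τ i) (d.sub i) ↔
        (s * q.1, s⁻¹ * q.2.1, q.2.2) ∈ d.std (τ i) (d.sub i) := by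
      rintro ⟨x, y, z⟩
      cases τ i <;> simp [std, hs]
    rw [e1, e2, e3]
    set q := (s * (d.eich (w i) p).1, s⁻¹ * (d.eich (w i) p).2.1, (d.eich (w i) p).2.2)
    constructor
    · exact eich_std d (hS i) (h i) q
    · intro hq
      have := eich_std d (hS i) (neg_mem (h i)) _ hq
      rw [eich_add _ h2] at this
      convert this using 1
      ext <;> simp

end Model

theorem Iso.tw {c d : Cfg F ι} {g : c.V ≃ₗ[F] d.V} (h1 : ∀ x y, d.B (g x) (g y) = c.B x y)
    (h2 : ∀ i x, x ∈ c.sub i ↔ g x ∈ d.sub i) (τ : ι → Ty) (w : ι → c.V) :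
    Iso (c.tw τ w) (d.tw τ fun i => g (w i)) := by
  refine ⟨(LinearEquiv.refl F F).prodCongr ((LinearEquiv.refl F F).prodCongr g), ?_, ?_⟩
  · intro x y
    simp [h1]
  · rintro i ⟨a, b, x⟩
    cases hτ : τ i <;> simp [std, hτ, h1, h2]

theorem mem_tws_iff {c d : Cfg F ι} {g : c.V ≃ₗ[F] d.V} (h1 : ∀ x y, d.B (g x) (g y) = c.B x y)
    (h2 : ∀ i x, x ∈ c.sub i ↔ g x ∈ d.sub i) (τ : Ty) (i : ι) (x : c.V) :
    x ∈ c.tws τ (c.sub i) ↔ g x ∈ d.tws τ (d.sub i) := by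
  cases τ
  · simp [tws]
  · simp only [tws, mem_orth]
    constructor
    · intro h s hs
      obtain ⟨s, rfl⟩ := g.surjective s
      rw [h1]
      exact h s ((h2 i s).2 hs)
    · intro h s hs
      rw [← h1]
      exact h _ ((h2 i s).1 hs)
  · exact h2 i x

section Red

variable (c : Cfg F ι) (t f : c.V)

/-- The reduction of a configuration along a line, computed in the complement of a hyperbolic
pair. -/
def red : Cfg F ι where
  V := (LinearMap.ker (c.B t) ⊓ LinearMap.ker (c.B f) : Submodule F c.V)
  B := (c.B.domRestrict₁₂ _ _)
  symm x y := c.symm x y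
  sub i := (c.sub i ⊔ Submodule.span F {t}).comap (Submodule.subtype _)

variable {c t f}

/-- The inclusion of a reduction. -/
def rv : (c.red t f).V →ₗ[F] c.V := Submodule.subtype _

theorem rv_inj {x y : (c.red t f).V} (h : rv x = rv y) : x = y := Subtype.ext h

@[simp] theorem red_t (x : (c.red t f).V) : c.B t (rv x) = 0 := x.2.1

@[simp] theorem red_f (x : (c.red t f).V) : c.B f (rv x) = 0 := x.2.2

@[simp] theorem red_t' (x : (c.red t f).V) : c.B (rv x) t = 0 := by rw [c.symm, red_t]

@[simp] theorem red_f' (x : (c.red t f).V) : c.B (rv x) f = 0 := by rw [c.symm, red_f]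

theorem red_B (x y : (c.red t f).V) : (c.red t f).B x y = c.B (rv x) (rv y) := rfl

theorem mem_red {i : ι} {x : (c.red t f).V} :
    x ∈ (c.red t f).sub i ↔ ∃ a : F, rv x + a • t ∈ c.sub i := by
  change rv x ∈ c.sub i ⊔ Submodule.span F {t} ↔ _
  simp only [Submodule.mem_sup, Submodule.mem_span_singleton]
  constructor
  · rintro ⟨y, hy, z, ⟨a, rfl⟩, h⟩
    exact ⟨-a, by rw [← h]; simpa using hy⟩
  · rintro ⟨a, ha⟩
    exact ⟨_, ha, _, ⟨-a, rfl⟩, by simp⟩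

variable (c t f) in
/-- A hyperbolic pair. -/
structure Hyp : Prop where
  tt : c.B t t = 0
  ff : c.B f f = 0
  tf : c.B t f = 1

theorem Hyp.ft (h : c.Hyp t f) : c.B f t = 1 := by rw [c.symm, h.tf]

/-- The projection to the complement of a hyperbolic pair. -/
def pr (h : c.Hyp t f) (x : c.V) : (c.red t f).V :=
  ⟨x - c.B f x • t - c.B t x • f, by
    simp [h.tt, h.tf, h.ff, h.ft]⟩

theorem rv_pr (h : c.Hyp t f) (x : c.V) : rv (pr h x) = x - c.B f x • t - c.B t x • f := rfl

theorem red_nondeg (h : c.Hyp t f) (hnd : Nondeg c.B) : Nondeg (c.red t f).B := by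
  intro x hx
  refine rv_inj (hnd _ fun y => ?_)
  have := hx (pr h y)
  rw [red_B, rv_pr] at this
  simpa using this

theorem red_finrank (h : c.Hyp t f) : finrank F (c.red t f).V < finrank F c.V := by
  refine Submodule.finrank_lt (s := (LinearMap.ker (c.B t) ⊓ LinearMap.ker (c.B f) :
    Submodule F c.V)) fun h' => ?_
  have : f ∈ (⊤ : Submodule F c.V) := trivial
  rw [← h'] at this
  exact one_ne_zero (h.tf.symm.trans this.1)

/-- Coordinates with respect to a hyperbolic pair. -/
def coordEquiv (h : c.Hyp t f) : c.V ≃ₗ[F] F × F × (c.red t f).V where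
  toFun x := (c.B f x, c.B t x, pr h x)
  invFun p := p.1 • t + p.2.1 • f + rv p.2.2
  map_add' x y := by
    refine Prod.ext (by simp) (Prod.ext (by simp) (rv_inj ?_))
    simp only [Prod.snd_add, map_add, rv_pr, add_smul]
    abel
  map_smul' a x := by
    refine Prod.ext (by simp) (Prod.ext (by simp) (rv_inj ?_))
    simp only [Prod.smul_snd, rv_pr, map_smul, smul_sub, smul_assoc, RingHom.id_apply]
  left_inv x := by simp [rv_pr]
  right_inv p := by
    refine Prod.ext ?_ (Prod.ext ?_ (rv_inj ?_))
    · simp [h.ft, h.ff, red_f]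
    · simp [h.tf, h.tt, red_t]
    · simp only [rv_pr, map_add, map_smul, h.ft, h.ff, red_f, h.tf, h.tt, red_t, smul_eq_mul]
      module

theorem coordEquiv_apply (h : c.Hyp t f) (x : c.V) :
    coordEquiv h x = (c.B f x, c.B t x, pr h x) := rfl

/-- The position of a subspace with respect to a hyperbolic pair. -/
def HasTy (B : c.V →ₗ[F] c.V →ₗ[F] F) (t v : c.V) (τ : Ty) (S : Submodule F c.V) : Prop :=
  match τ with
  | .inn => t ∈ S ∧ ∀ x ∈ S, B t x = 0
  | .perp => ∀ x ∈ S, B t x = 0 ∧ B v x = 0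
  | .non => v ∈ S ∧ ∀ x ∈ S, ∀ y ∈ S, B x y = 0

theorem coordEquiv_B (h : c.Hyp t f) (x y : c.V) :
    (c.red t f).hypForm (coordEquiv h x) (coordEquiv h y) = c.B x y := by
  simp only [coordEquiv_apply, hypForm_apply, red_B, rv_pr, map_sub, map_smul,
    LinearMap.sub_apply, LinearMap.smul_apply, smul_eq_mul, h.ft, h.ff, h.tf, h.tt]
  rw [c.symm x f, c.symm x t]
  ring

theorem coordEquiv_mem (h2 : (2 : F) ≠ 0) (h : c.Hyp t f) (τ : ι → Ty) (v : ι → c.V)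
    (hv : ∀ i, c.Hyp t (v i)) (hτ : ∀ i, HasTy c.B t (v i) (τ i) (c.sub i)) (i : ι) (x : c.V) :
    x ∈ c.sub i ↔ coordEquiv h x ∈ ((c.red t f).tw τ fun i => pr h (v i)).sub i := by
  have key : (c.red t f).eich (pr h (v i)) (coordEquiv h x) =
      (c.B (v i) x, c.B t x, pr h x - c.B t x • pr h (v i)) := by
    refine Prod.ext ?_ rfl
    simp only [coordEquiv_apply, eich_apply, red_B, rv_pr, map_sub, map_smul,
      LinearMap.sub_apply, LinearMap.smul_apply, smul_eq_mul, h.ft, h.ff, h.tf, h.tt,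
      (hv i).tf, (hv i).ff, (hv i).ft]
    rw [c.symm (v i) f]
    field_simp
    ring
  rw [Submodule.mem_comap, key]
  have hτi := hτ i
  cases hτ' : τ i <;> rw [hτ'] at hτi <;> simp only [std, Submodule.mem_prod, Submodule.mem_bot,
    Submodule.mem_top, true_and, mem_red] <;> simp only [HasTy] at hτi
  · constructor
    · intro hx
      refine ⟨hτi.2 x hx, c.B f x, ?_⟩
      simpa [rv_pr, hτi.2 x hx] using hx
    · rintro ⟨h0, a, ha⟩
      simp only [h0, zero_smul, sub_zero, rv_pr] at ha
      have := (c.sub i).add_mem ha ((c.sub i).smul_mem (c.B f x - a) hτi.1)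
      convert this using 1
      rw [sub_smul]; abel
  · constructor
    · intro hx
      refine ⟨(hτi x hx).2, (hτi x hx).1, c.B f x, ?_⟩
      simpa [rv_pr, (hτi x hx).1] using hx
    · rintro ⟨h0, h1, a, ha⟩
      simp only [h1, zero_smul, sub_zero, rv_pr] at ha
      have h3 := (hτi _ ha).2
      simp [h0, (hv i).ft] at h3
      have h4 : a = c.B f x := by linear_combination h3
      simpa [h4] using ha
  · constructor
    · intro hx
      refine ⟨hτi.2 _ hτi.1 x hx, c.B f x - c.B t x * c.B f (v i), ?_⟩
      have := (c.sub i).sub_mem hx ((c.sub i).smul_mem (c.B t x) hτi.1)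
      convert this using 1
      simp only [map_sub, map_smul, rv_pr, (hv i).tf, smul_sub, sub_smul,
        smul_smul, one_smul]
      abel
    · rintro ⟨h0, a, ha⟩
      have h3 := hτi.2 _ hτi.1 _ ha
      simp [rv_pr, h0, (hv i).ft, (hv i).ff, (hv i).tf] at h3
      have := (c.sub i).add_mem ha ((c.sub i).smul_mem (c.B t x) hτi.1)
      convert this using 1
      simp only [map_sub, map_smul, rv_pr, (hv i).tf, smul_sub,
        smul_smul, one_smul]
      have h4 : a = c.B f x - c.B t x * c.B f (v i) := by
        rw [c.symm (v i) f] at h3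
        linear_combination h3
      rw [h4]
      module

theorem iso_tw (h2 : (2 : F) ≠ 0) (h : c.Hyp t f) (τ : ι → Ty) (v : ι → c.V)
    (hv : ∀ i, c.Hyp t (v i)) (hτ : ∀ i, HasTy c.B t (v i) (τ i) (c.sub i)) :
    Iso c ((c.red t f).tw τ fun i => pr h (v i)) :=
  ⟨coordEquiv h, coordEquiv_B h, coordEquiv_mem h2 h τ v hv hτ⟩

end Red

section LineStep

/-- `tws` for the position `τ g` is contained in `tws` for the position `τ i`. -/
def Dom {V : Type u} [AddCommGroup V] [Module F V] (B : V →ₗ[F] V →ₗ[F] F) (τ : ι → Ty)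
    (S : ι → Submodule F V) (g i : ι) : Prop :=
  match τ i, τ g with
  | .inn, _ => True
  | .perp, .perp => S i ≤ S g
  | .perp, .non => ∀ x ∈ S i, ∀ y ∈ S g, B x y = 0
  | .non, .non => S g ≤ S i
  | _, _ => False

theorem tws_le_of_dom {c : Cfg F ι} {t f : c.V} (h : c.Hyp t f) {τ : ι → Ty} {g i : ι}
    (hD : Dom c.B τ c.sub g i) :
    (c.red t f).tws (τ g) ((c.red t f).sub g) ≤ (c.red t f).tws (τ i) ((c.red t f).sub i) := by
  intro x hx
  revert hD hx
  cases hi : τ i <;> cases hg : τ g <;> simp only [Dom, hi, hg, tws, mem_orth] <;>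
    intro hD hx
  · trivial
  · trivial
  · trivial
  · exact hD.elim
  · intro s hs
    obtain ⟨a, ha⟩ := mem_red.1 hs
    exact hx s (mem_red.2 ⟨a, hD ha⟩)
  · intro s hs
    obtain ⟨a, ha⟩ := mem_red.1 hs
    obtain ⟨b, hb⟩ := mem_red.1 hx
    have := hD _ ha _ hb
    simp [h.tt] at this
    rw [red_B, c.symm, this]
  · exact hD.elim
  · exact hD.elim
  · obtain ⟨b, hb⟩ := mem_red.1 hx
    exact mem_red.2 ⟨b, hD hb⟩

/-- The optional constraint subspace. -/
def zset (d : Cfg F ι) : Option ι → Submodule F d.V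
  | none => ⊥
  | some z => d.sub z

open Classical in
/-- The canonical twist. -/
noncomputable def stdTwist (d : Cfg F ι) (τ : ι → Ty) (i₁ i₂ : ι) (z : Option ι) : d.V :=
  if h : ∃ x ∈ orth d.B (zset d z),
      x ∉ d.tws (τ i₁) (d.sub i₁) ⊔ d.tws (τ i₂) (d.sub i₂) then h.choose else 0

/-- The finite parameters of `lineModel`. -/
abbrev LineParam (ι : Type) := (ι → Ty) × (ι → Bool) × ι × ι × Option ι × Bool

/-- The configurations which reduce to `d` along a line. -/
noncomputable def lineModel (d : Cfg F ι) (p : LineParam ι) : Cfg F ι :=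
  d.tw p.1 fun i => if p.2.1 i ∧ p.2.2.2.2.2 then
    stdTwist d p.1 p.2.2.1 p.2.2.2.1 p.2.2.2.2.1 else 0

/-- `c` is recovered from its reduction. -/
def LineOK (c : Cfg F ι) (t f : c.V) : Prop :=
  ∀ d, Iso (c.red t f) d → ∃ p, Iso c (lineModel d p)

/-- The orthogonal of `tws`, expressed before reduction. -/
def DD {V : Type u} [AddCommGroup V] [Module F V] (B : V →ₗ[F] V →ₗ[F] F) (t : V) (τ : Ty)
    (S : Submodule F V) (x : V) : Prop :=
  match τ with
  | .inn => x = 0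
  | .perp => ∃ a : F, x + a • t ∈ S
  | .non => ∀ y ∈ S, B t y = 0 → B x y = 0

theorem dd_of_perp {c : Cfg F ι} (hnd : Nondeg c.B) {t f : c.V} (h : c.Hyp t f) {τ : Ty} {i : ι}
    {x : (c.red t f).V}
    (hx : ∀ y ∈ (c.red t f).tws τ ((c.red t f).sub i), (c.red t f).B y x = 0) :
    DD c.B t τ (c.sub i) (rv x) := by
  cases τ <;> simp only [tws, DD] at *
  · have : x = 0 := red_nondeg h hnd x fun y => by rw [(c.red t f).symm]; exact hx y trivial
    simp [this]
  · refine mem_red.1 (mem_of_dperp (c.red t f).symm (red_nondeg h hnd) _ fun y hy => ?_)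
    rw [(c.red t f).symm]
    exact hx y fun s hs => by rw [(c.red t f).symm]; exact hy s hs
  · intro y hy hty
    have := hx (pr h y) (mem_red.2 ⟨c.B f y, by simpa [rv_pr, hty] using hy⟩)
    rw [(c.red t f).symm] at this
    simpa [red_B, rv_pr] using this

/-- The two-class line step: the subspaces are in position with respect to one of two hyperbolic
pairs `(t, v₁)`, `(t, v₂)`. -/
theorem line_step (h2 : (2 : F) ≠ 0) {c : Cfg F ι} (hnd : Nondeg c.B) {t v₁ v₂ : c.V}
    (h₁ : c.Hyp t v₁) (h₂ : c.Hyp t v₂) (τ : ι → Ty) (J : ι → Bool)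
    (hτ : ∀ i, HasTy c.B t (if J i then v₂ else v₁) (τ i) (c.sub i)) (i₁ i₂ : ι)
    (hd₁ : ∀ i, J i = false → Dom c.B τ c.sub i₁ i) (hd₂ : ∀ i, J i = true → Dom c.B τ c.sub i₂ i)
    (zi : Option ι) (hz : ∀ z, zi = some z → ∀ x ∈ c.sub z, c.B v₂ x = c.B v₁ x)
    (hK : ∀ x, c.B t x = 0 → c.B v₁ x = 0 → c.B v₂ x = 0 → DD c.B t (τ i₁) (c.sub i₁) x →
      DD c.B t (τ i₂) (c.sub i₂) x →
      x = 0 ∨ ∃ z, zi = some z ∧ ∃ a : F, x + a • t ∈ c.sub z) :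
    LineOK c t v₁ := by
  rintro d ⟨g, g1, g2⟩
  have hv : ∀ i, c.Hyp t (if J i then v₂ else v₁) := fun i => by
    split_ifs
    exacts [h₂, h₁]
  have e1 := (iso_tw h2 h₁ τ _ hv hτ).trans (Iso.tw g1 g2 τ _)
  set δ : (c.red t v₁).V := pr h₁ v₂ with hδ
  have e2 : (fun i => g (pr h₁ (if J i then v₂ else v₁))) = fun i => if J i then g δ else 0 := by
    funext i
    split_ifs
    · rfl
    · have : pr h₁ v₁ = 0 := rv_inj (by simp [rv_pr, h₁.tf, h₁.ff])
      simp [this]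
  rw [e2] at e1
  set X := d.tws (τ i₁) (d.sub i₁) ⊔ d.tws (τ i₂) (d.sub i₂) with hX
  -- the canonical twist lies in the span of `g δ` and `X`
  have key : ∀ y ∈ orth d.B (zset d zi), ∃ s : F, y - s • g δ ∈ X := by
    intro y hy
    set Y := ((c.red t v₁).tws (τ i₁) ((c.red t v₁).sub i₁) ⊔
      (c.red t v₁).tws (τ i₂) ((c.red t v₁).sub i₂)) ⊔ Submodule.span F {δ} with hY
    have hmem : g.symm y ∈ Y := by
      refine mem_of_dperp (c.red t v₁).symm (red_nondeg h₁ hnd) _ fun x hx => ?_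
      have hx1 := dd_of_perp hnd h₁ (x := x) (i := i₁) (τ := τ i₁) fun y hy =>
        hx y (Submodule.mem_sup_left (Submodule.mem_sup_left hy))
      have hx2 := dd_of_perp hnd h₁ (x := x) (i := i₂) (τ := τ i₂) fun y hy =>
        hx y (Submodule.mem_sup_left (Submodule.mem_sup_right hy))
      have hx3 := hx δ (Submodule.mem_sup_right (Submodule.mem_span_singleton_self _))
      rcases hK (rv x) (red_t x) (red_f x) (by
        simpa [hδ, red_B, rv_pr] using hx3) hx1 hx2 with h0 | ⟨z, rfl, hzx⟩
      · rw [rv_inj (x := x) (y := 0) (by simpa using h0)]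
        simp
      · rw [← g1, LinearEquiv.apply_symm_apply]
        exact hy _ ((g2 z x).1 (mem_red.2 hzx))
    obtain ⟨a, ha, b, hb, hab⟩ := Submodule.mem_sup.1 hmem
    obtain ⟨s, rfl⟩ := Submodule.mem_span_singleton.1 hb
    obtain ⟨a1, ha1, a2, ha2, rfl⟩ := Submodule.mem_sup.1 ha
    refine ⟨s, ?_⟩
    have : y - s • g δ = g a1 + g a2 := by
      have := congrArg g hab
      rw [LinearEquiv.apply_symm_apply] at this
      rw [← this]
      simp
    rw [this]
    exact Submodule.add_mem_sup ((mem_tws_iff g1 g2 _ _ _).1 ha1) ((mem_tws_iff g1 g2 _ _ _).1 ha2)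
  have hδz : g δ ∈ orth d.B (zset d zi) := by
    intro s hs
    cases zi with
    | none =>
      have : s = 0 := hs
      simp [this]
    | some z =>
      obtain ⟨s, rfl⟩ := g.surjective s
      obtain ⟨a, ha⟩ := mem_red.1 ((g2 z s).2 hs)
      have := hz z rfl _ ha
      simp [h₁.ft, h₂.ft] at this
      rw [g1, red_B]
      simp [hδ, rv_pr, this]
  have hS : ∀ i, τ i = .non → ∀ x ∈ d.sub i, ∀ y ∈ d.sub i, d.B x y = 0 := by
    intro i hi x hx y hy
    obtain ⟨x, rfl⟩ := g.surjective x
    obtain ⟨y, rfl⟩ := g.surjective y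
    obtain ⟨a, ha⟩ := mem_red.1 ((g2 i x).2 hx)
    obtain ⟨b, hb⟩ := mem_red.1 ((g2 i y).2 hy)
    have := hτ i
    rw [hi] at this
    have := this.2 _ ha _ hb
    rw [g1, red_B]
    simpa [h₁.tt] using this
  have hdom : ∀ {g' i}, Dom c.B τ c.sub g' i →
      d.tws (τ g') (d.sub g') ≤ d.tws (τ i) (d.sub i) := by
    intro g' i hD x hx
    obtain ⟨x, rfl⟩ := g.surjective x
    exact (mem_tws_iff g1 g2 _ _ _).1 (tws_le_of_dom h₁ hD ((mem_tws_iff g1 g2 _ _ _).2 hx))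
  -- the final comparison
  have fin : ∀ (e : Bool) (s : F), s ≠ 0 →
      (if e then stdTwist d τ i₁ i₂ zi else 0) - s • g δ ∈ X → ∃ p, Iso c (lineModel d p) := by
    intro e s hs hmem
    obtain ⟨a, ha, b, hb, hab⟩ := Submodule.mem_sup.1 hmem
    refine ⟨(τ, J, i₁, i₂, zi, e), e1.trans (tw_iso d h2 τ _ _ hS s hs a fun i => ?_)⟩
    cases hJ : J i
    · simpa [hJ] using hdom (hd₁ i hJ) ha
    · have := hdom (hd₂ i hJ) hb
      simp only [hJ, true_and, if_true]
      rw [← hab, add_sub_cancel_left]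
      exact this
  by_cases hδX : g δ ∈ X
  · exact fin false 1 one_ne_zero (by simpa using hδX)
  · have hex : ∃ x ∈ orth d.B (zset d zi), x ∉ X := ⟨_, hδz, hδX⟩
    have hw : stdTwist d τ i₁ i₂ zi = hex.choose := dif_pos hex
    obtain ⟨s, hs⟩ := key _ hex.choose_spec.1
    refine fin true s ?_ (by simpa [hw] using hs)
    rintro rfl
    rw [zero_smul, sub_zero] at hs
    exact hex.choose_spec.2 hs

/-- The line step with a single hyperbolic pair. -/
theorem line_step_one [Nonempty ι] (h2 : (2 : F) ≠ 0) {c : Cfg F ι} {t v : c.V}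
    (h : c.Hyp t v) (τ : ι → Ty) (hτ : ∀ i, HasTy c.B t v (τ i) (c.sub i)) : LineOK c t v := by
  rintro d ⟨g, g1, g2⟩
  have e1 := (iso_tw h2 h τ _ (fun _ => h) hτ).trans (Iso.tw g1 g2 τ _)
  have : pr h v = 0 := rv_inj (by simp [rv_pr, h.tf, h.ff])
  simp only [this, map_zero] at e1
  obtain ⟨i⟩ := ‹Nonempty ι›
  refine ⟨(τ, fun _ => false, i, i, none, false), ?_⟩
  unfold lineModel
  simpa using e1

end LineStep

end Cfg

namespace Cfg

variable {F : Type u} [Field F]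

section Isotropic

variable {V : Type u} [AddCommGroup V] [Module F V] {B : V →ₗ[F] V →ₗ[F] F}

/-- Isotropic subspaces. -/
def Isot (B : V →ₗ[F] V →ₗ[F] F) (L : Submodule F V) : Prop := ∀ x ∈ L, ∀ y ∈ L, B x y = 0

/-- Maximal isotropic subspaces of an odd split space. -/
structure IsMax (B : V →ₗ[F] V →ₗ[F] F) (L : Submodule F V) : Prop where
  iso : Isot B L
  ex : ∃ z, B z z = 1 ∧ (∀ x ∈ L, B z x = 0) ∧ ∀ x, (∀ y ∈ L, B x y = 0) → ∃ a : F, x - a • z ∈ L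

theorem IsMax.of_norm (hs : ∀ x y, B x y = B y x) {L : Submodule F V} (hL : IsMax B L) {z : V}
    (hz : B z z = 1) (hzL : ∀ x ∈ L, B z x = 0) {x : V} (hx : ∀ y ∈ L, B x y = 0) :
    ∃ a : F, x - a • z ∈ L := by
  obtain ⟨z0, h1, h2, h3⟩ := hL.ex
  obtain ⟨a, ha⟩ := h3 z hzL
  obtain ⟨b, hb⟩ := h3 x hx
  have haa : a * a = 1 := by
    have h4 := hzL _ ha
    have h5 := h2 _ ha
    simp [hz, h1, hs z z0] at h4 h5
    linear_combination (-1 : F) * a * h5 - h4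
  refine ⟨b * a, ?_⟩
  have := L.sub_mem hb (L.smul_mem (b * a) ha)
  convert this using 1
  have : b • z0 = (b * (a * a)) • z0 := by rw [haa, mul_one]
  rw [this]
  module

theorem IsMax.mem (hs : ∀ x y, B x y = B y x) {L : Submodule F V} (hL : IsMax B L) {x : V}
    (hx : ∀ y ∈ L, B x y = 0) (hxx : B x x = 0) : x ∈ L := by
  obtain ⟨z, h1, h2, h3⟩ := hL.ex
  obtain ⟨a, ha⟩ := h3 x hx
  have h4 := hx _ ha
  have h5 := h2 _ ha
  simp [hxx, h1] at h4 h5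
  rw [hs x z] at h4
  have : a = 0 := by
    rcases h4 with h4 | h4
    · exact h4
    · linear_combination h4 - h5
  simpa [this] using ha

theorem IsMax.exists_not_perp (hs : ∀ x y, B x y = B y x) {L : Submodule F V} (hL : IsMax B L)
    {t : V} (htt : B t t = 0) (ht : t ∉ L) : ∃ v ∈ L, B t v = 1 := by
  by_contra! h
  refine ht (hL.mem hs (fun y hy => ?_) htt)
  by_contra h0
  exact h ((B t y)⁻¹ • y) (L.smul_mem _ hy) (by simp [h0])

end Isotropic

variable {ι : Type} {c : Cfg F ι} {t f : c.V}

theorem isot_red (h : c.Hyp t f) {i : ι} (hi : Isot c.B (c.sub i)) :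
    Isot (c.red t f).B ((c.red t f).sub i) := by
  intro x hx y hy
  obtain ⟨a, ha⟩ := mem_red.1 hx
  obtain ⟨b, hb⟩ := mem_red.1 hy
  simpa [h.tt, red_B] using hi _ ha _ hb

theorem perp_red (h : c.Hyp t f) {i j : ι} (hi : ∀ x ∈ c.sub i, ∀ y ∈ c.sub j, c.B x y = 0) :
    ∀ x ∈ (c.red t f).sub i, ∀ y ∈ (c.red t f).sub j, (c.red t f).B x y = 0 := by
  intro x hx y hy
  obtain ⟨a, ha⟩ := mem_red.1 hx
  obtain ⟨b, hb⟩ := mem_red.1 hy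
  simpa [h.tt, red_B] using hi _ ha _ hb

theorem le_red {i j : ι} (hi : c.sub i ≤ c.sub j) : (c.red t f).sub i ≤ (c.red t f).sub j := by
  intro x hx
  obtain ⟨a, ha⟩ := mem_red.1 hx
  exact mem_red.2 ⟨a, hi ha⟩

theorem pr_mem_red (h : c.Hyp t f) {i : ι} {y : c.V} (hy : y ∈ c.sub i) (hty : c.B t y = 0) :
    pr h y ∈ (c.red t f).sub i :=
  mem_red.2 ⟨c.B f y, by simpa [rv_pr, hty] using hy⟩

theorem isMax_red (h : c.Hyp t f) {i : ι} (hL : IsMax c.B (c.sub i))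
    (ht : t ∈ c.sub i ∨ ∃ v ∈ c.sub i, c.B t v = 1) :
    IsMax (c.red t f).B ((c.red t f).sub i) := by
  refine ⟨isot_red h hL.iso, ?_⟩
  obtain ⟨z, hz1, hzL, hzt⟩ : ∃ z, c.B z z = 1 ∧ (∀ x ∈ c.sub i, c.B z x = 0) ∧ c.B t z = 0 := by
    obtain ⟨z, h1, h2, -⟩ := hL.ex
    rcases ht with ht | ⟨v, hv, htv⟩
    · exact ⟨z, h1, h2, by rw [c.symm, h2 t ht]⟩
    · refine ⟨z - c.B t z • v, ?_, fun x hx => ?_, ?_⟩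
      · simp [h1, h2 v hv, c.symm v z, hL.iso v hv v hv]
      · simp [h2 x hx, hL.iso v hv x hx]
      · simp [htv]
  refine ⟨pr h z, ?_, fun x hx => ?_, fun x hx => ?_⟩
  · simp [red_B, rv_pr, hzt, hz1, h.tt, c.symm z t]
  · obtain ⟨a, ha⟩ := mem_red.1 hx
    have := hzL _ ha
    simp [c.symm z t, hzt] at this
    simp [red_B, rv_pr, hzt, this]
  · have hb : ∃ b : F, ∀ y ∈ c.sub i, c.B (rv x + b • t) y = 0 := by
      rcases ht with ht | ⟨v, hv, htv⟩
      · refine ⟨0, fun y hy => ?_⟩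
        have hty := hL.iso t ht y hy
        have := hx _ (pr_mem_red h hy hty)
        simpa [red_B, rv_pr, hty] using this
      · refine ⟨-c.B (rv x) v, fun y hy => ?_⟩
        have := hx _ (pr_mem_red h (y := y - c.B t y • v)
          ((c.sub i).sub_mem hy ((c.sub i).smul_mem _ hv)) (by simp [htv]))
        simp [red_B, rv_pr, htv] at this
        simp
        linear_combination this
    obtain ⟨b, hb⟩ := hb
    obtain ⟨a, ha⟩ := hL.of_norm c.symm hz1 hzL hb
    refine ⟨a, mem_red.2 ⟨b - a * c.B f z, ?_⟩⟩
    convert ha using 1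
    simp only [map_sub, map_smul, rv_pr, hzt]
    module

theorem exists_hyp (hnd : Nondeg c.B) {t : c.V} (htt : c.B t t = 0) (S : Submodule F c.V)
    (htS : t ∉ S) (hS : ∀ s ∈ S, c.B t s = 0) (h2 : (2 : F) ≠ 0) :
    ∃ v, c.Hyp t v ∧ ∀ s ∈ S, c.B v s = 0 := by
  obtain ⟨v, h1, h3⟩ := exists_orth c.symm hnd S htS
  refine ⟨v - (c.B v v / 2) • t, ⟨htt, ?_, ?_⟩, fun s hs => ?_⟩
  · simp [htt, c.symm v t, h1]
    field_simp
    ring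
  · simp [h1, htt]
  · simp [hS s hs, c.symm v s, h3 s hs]

/-- A chain of isotropic subspaces is in position with respect to a suitable hyperbolic pair
containing a given isotropic vector. -/
theorem exists_hyp_chain {κ : Type} [LinearOrder κ] [Finite κ] [Nonempty κ] (h2 : (2 : F) ≠ 0)
    (hnd : Nondeg c.B) {t : c.V} (htt : c.B t t = 0) (ht0 : t ≠ 0)
    {C : κ → Submodule F c.V} (hC : Monotone C) (hi : ∀ k, Isot c.B (C k)) :
    ∃ v, c.Hyp t v ∧ ∃ (τ : κ → Ty) (g : κ), (∀ k, HasTy c.B t v (τ k) (C k)) ∧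
      ∀ k, Dom c.B τ C g k := by
  classical
  by_cases hex : ∃ k, ∃ x ∈ C k, c.B t x ≠ 0
  · obtain ⟨k, ⟨x, hx, hne⟩, hmin⟩ :=
      (Set.toFinite {k | ∃ x ∈ C k, c.B t x ≠ 0}).exists_minimal hex
    have hv : ∃ v ∈ C k, c.B t v = 1 :=
      ⟨(c.B t x)⁻¹ • x, (C k).smul_mem _ hx, by simp [hne]⟩
    obtain ⟨v, hv, htv⟩ := hv
    refine ⟨v, ⟨htt, hi k v hv v hv, htv⟩, fun j => if k ≤ j then .non else .perp, k,
      fun j => ?_, fun j => ?_⟩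
    · by_cases hj : k ≤ j
      · simpa [hj, HasTy] using ⟨hC hj hv, hi j⟩
      · simp only [hj, if_false, HasTy]
        intro x hx
        refine ⟨?_, hi k v hv x (hC (le_of_not_ge hj) hx)⟩
        by_contra h
        exact hj (hmin ⟨x, hx, h⟩ (le_of_not_ge hj))
    · by_cases hj : k ≤ j
      · simpa [Dom, hj] using hC hj
      · simp only [Dom, hj, if_false, le_refl, if_true]
        intro x hx y hy
        exact hi k x (hC (le_of_not_ge hj) hx) y hy
  · push Not at hex
    by_cases hex2 : ∃ k, t ∉ C k
    · obtain ⟨k, hk, hmax⟩ := (Set.toFinite {k | t ∉ C k}).exists_maximal hex2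
      obtain ⟨v, hv, hvC⟩ := exists_hyp hnd htt (C k) hk (hex k) h2
      refine ⟨v, hv, fun j => if j ≤ k then .perp else .inn, k, fun j => ?_, fun j => ?_⟩
      · by_cases hj : j ≤ k
        · simp only [hj, if_true, HasTy]
          exact fun x hx => ⟨hex j x hx, hvC x (hC hj hx)⟩
        · simp only [hj, if_false, HasTy]
          refine ⟨?_, hex j⟩
          by_contra h
          exact hj (hmax h (le_of_not_ge hj))
      · by_cases hj : j ≤ k
        · simpa [Dom, hj] using hC hj
        · simp [Dom, hj]
    · push Not at hex2
      obtain ⟨v, hv, -⟩ := exists_hyp hnd htt ⊥ (by simpa using ht0) (by simp) h2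
      obtain ⟨k⟩ := ‹Nonempty κ›
      exact ⟨v, hv, fun _ => .inn, k, fun j => ⟨hex2 j, hex j⟩, fun j => by simp [Dom]⟩

end Cfg

namespace Cfg

variable {F : Type u} [Field F]

/-- Labels: two maximal isotropic subspaces and a chain. -/
inductive LE (κ : Type)
  | L
  | E
  | C (k : κ)

instance {κ : Type} [Finite κ] : Finite (LE κ) :=
  Finite.of_surjective (fun x : Option (Option κ) => match x with
    | none => LE.L
    | some none => LE.E
    | some (some k) => LE.C k) (by
      rintro (_ | _ | k)
      exacts [⟨none, rfl⟩, ⟨some none, rfl⟩, ⟨some (some k), rfl⟩])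

/-- Functions on `LE`. -/
def LE.fn {κ : Type} {α : Type*} (l e : α) (f : κ → α) : LE κ → α
  | .L => l
  | .E => e
  | .C k => f k

/-- Functions on `Option LE`. -/
def LE.fnZ {κ : Type} {α : Type*} (z l e : α) (f : κ → α) : Option (LE κ) → α
  | none => z
  | some i => LE.fn l e f i

instance {κ : Type} : Nonempty (LE κ) := ⟨.L⟩

/-- Two maximal isotropic subspaces and an isotropic chain. -/
structure PI {κ : Type} [LinearOrder κ] (c : Cfg F (LE κ)) : Prop where
  nd : Nondeg c.B
  L : IsMax c.B (c.sub .L)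
  E : IsMax c.B (c.sub .E)
  mono : Monotone fun k => c.sub (.C k)
  iso : ∀ k, Isot c.B (c.sub (.C k))

/-- The same with a line orthogonal to both maximal isotropic subspaces. -/
structure PZ {κ : Type} [LinearOrder κ] (c : Cfg F (Option (LE κ))) : Prop where
  nd : Nondeg c.B
  L : IsMax c.B (c.sub (some .L))
  E : IsMax c.B (c.sub (some .E))
  mono : Monotone fun k => c.sub (some (.C k))
  iso : ∀ k, Isot c.B (c.sub (some (.C k)))
  Z : ∃ z, c.B z z = 1 ∧ (∀ x ∈ c.sub (some .L), c.B z x = 0) ∧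
    (∀ x ∈ c.sub (some .E), c.B z x = 0) ∧ c.sub none = Submodule.span F {z}

theorem exists_common_norm {V : Type u} [AddCommGroup V] [Module F V] [FiniteDimensional F V]
    {B : V →ₗ[F] V →ₗ[F] F} (hs : ∀ x y, B x y = B y x) {L E : Submodule F V}
    (hL : IsMax B L) (hE : IsMax B E) :
    ∃ z, B z z = 1 ∧ (∀ x ∈ L, B z x = 0) ∧ ∀ x ∈ E, B z x = 0 := by
  obtain ⟨z, h1, h2, -⟩ := hL.ex
  obtain ⟨l, hl, hlE⟩ := exists_rep B L E (-B z) fun e he h => by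
    have : e ∈ L := hL.mem hs (fun y hy => by rw [hs]; exact h y hy) (hE.iso e he e he)
    simp [h2 e this]
  refine ⟨z + l, ?_, fun x hx => ?_, fun x hx => ?_⟩
  · simp [h1, hs l z, h2 l hl, hL.iso l hl l hl]
  · simp [h2 x hx, hL.iso l hl x hx]
  · simp [hlE x hx]

/-- Two maximal isotropic subspaces meeting trivially have a unique common normal line. -/
theorem perp_both {V : Type u} [AddCommGroup V] [Module F V]
    {B : V →ₗ[F] V →ₗ[F] F} (hs : ∀ x y, B x y = B y x) {L E : Submodule F V}
    (hL : IsMax B L) (hE : IsMax B E) (hLE : ∀ x ∈ L, x ∈ E → x = 0) {z : V} (hz : B z z = 1)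
    (hzL : ∀ x ∈ L, B z x = 0) (hzE : ∀ x ∈ E, B z x = 0) {x : V} (hxL : ∀ y ∈ L, B x y = 0)
    (hxE : ∀ y ∈ E, B x y = 0) : ∃ a : F, x = a • z := by
  obtain ⟨a, ha⟩ := hL.of_norm hs hz hzL hxL
  obtain ⟨b, hb⟩ := hE.of_norm hs hz hzE hxE
  have h1 := hzL _ ha
  have h2 := hzE _ hb
  simp [hz] at h1 h2
  have hab : a = b := by linear_combination h2 - h1
  subst hab
  exact ⟨a, sub_eq_zero.1 (hLE _ ha hb)⟩

variable {κ : Type} [LinearOrder κ]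

theorem PI.red {c : Cfg F (LE κ)} (hc : PI c) {t f : c.V} (h : c.Hyp t f)
    (hL : t ∈ c.sub .L ∨ ∃ v ∈ c.sub .L, c.B t v = 1)
    (hE : t ∈ c.sub .E ∨ ∃ v ∈ c.sub .E, c.B t v = 1) : PI (c.red t f) :=
  ⟨red_nondeg h hc.nd, isMax_red h hc.L hL, isMax_red h hc.E hE,
    fun _ _ hjk => le_red (hc.mono hjk), fun k => isot_red h (hc.iso k)⟩

theorem PZ.red {c : Cfg F (Option (LE κ))} (hc : PZ c) {t f : c.V} (h : c.Hyp t f)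
    (hL : t ∈ c.sub (some .L) ∨ ∃ v ∈ c.sub (some .L), c.B t v = 1)
    (hE : t ∈ c.sub (some .E) ∨ ∃ v ∈ c.sub (some .E), c.B t v = 1)
    (hZ : ∀ z ∈ c.sub none, c.B t z = 0) : PZ (c.red t f) := by
  refine ⟨red_nondeg h hc.nd, isMax_red h hc.L hL, isMax_red h hc.E hE,
    fun _ _ hjk => le_red (hc.mono hjk), fun k => isot_red h (hc.iso k), ?_⟩
  obtain ⟨z, h1, h2, h3, h4⟩ := hc.Z
  have hz : c.B t z = 0 := hZ z (h4 ▸ Submodule.mem_span_singleton_self z)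
  have hz' : c.B z t = 0 := by rw [c.symm, hz]
  refine ⟨pr h z, ?_, fun x hx => ?_, fun x hx => ?_, ?_⟩
  · simp [red_B, rv_pr, hz, hz', h1, h.tt]
  · obtain ⟨a, ha⟩ := mem_red.1 hx
    simpa [red_B, rv_pr, hz, hz'] using h2 _ ha
  · obtain ⟨a, ha⟩ := mem_red.1 hx
    simpa [red_B, rv_pr, hz, hz'] using h3 _ ha
  · ext x
    rw [mem_red, h4]
    simp only [Submodule.mem_span_singleton]
    constructor
    · rintro ⟨a, b, hb⟩
      refine ⟨b, rv_inj ?_⟩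
      have hfx : c.B f (b • z) = c.B f (rv x + a • t) := by rw [hb]
      simp [h.ft] at hfx
      rw [map_smul, rv_pr, hz, zero_smul, sub_zero, smul_sub, hb, smul_smul, hfx]
      simp
    · rintro ⟨b, rfl⟩
      refine ⟨b * c.B f z, b, ?_⟩
      simp [rv_pr, hz, smul_sub, smul_smul]

/-- Adding the common normal line. -/
def addZ (c : Cfg F (LE κ)) : Cfg F (Option (LE κ)) where
  V := c.V
  B := c.B
  symm := c.symm
  sub
    | none => orth c.B (c.sub .L) ⊓ orth c.B (c.sub .E)
    | some i => c.sub i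

theorem Iso.addZ {κ : Type} {c d : Cfg F (LE κ)} (h : Iso c d) : Iso c.addZ d.addZ := by
  obtain ⟨g, g1, g2⟩ := h
  refine ⟨g, g1, ?_⟩
  rintro (_ | i) x
  · exact and_congr (mem_tws_iff g1 g2 .perp .L x) (mem_tws_iff g1 g2 .perp .E x)
  · exact g2 i x

/-- The one-dimensional configuration. -/
def pointZ (F : Type u) [Field F] (κ : Type) : Cfg F (Option (LE κ)) where
  V := F
  B := LinearMap.mul F F
  symm x y := mul_comm x y
  sub
    | none => ⊤
    | some _ => ⊥

/-- The possible reductions. -/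
def PZStep (c : Cfg F (Option (LE κ))) : Prop :=
  (∃ t f, c.Hyp t f ∧ PZ (c.red t f) ∧ LineOK c t f) ∨
  (∃ c0 : Cfg F (LE κ), Iso c c0.addZ ∧ finrank F c0.V = finrank F c.V ∧
    ∃ t f, c0.Hyp t f ∧ PI (c0.red t f) ∧ LineOK c0 t f) ∨ Iso c (pointZ F κ)

theorem PZ.one {c : Cfg F (Option (LE κ))} (hc : PZ c) (h2 : (2 : F) ≠ 0) {t v : c.V}
    (h : c.Hyp t v)
    (hL : t ∈ c.sub (some .L) ∨ v ∈ c.sub (some .L))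
    (hE : t ∈ c.sub (some .E) ∨ v ∈ c.sub (some .E))
    (hZ : ∀ z ∈ c.sub none, c.B t z = 0) (hZ' : ∀ z ∈ c.sub none, c.B v z = 0)
    (hC : ∀ k, ∃ τ, HasTy c.B t v τ (c.sub (some (.C k)))) : PZStep c := by
  choose τ hτ using hC
  have aux : ∀ i, Isot c.B (c.sub i) → (t ∈ c.sub i ∨ v ∈ c.sub i) →
      ∃ τ, HasTy c.B t v τ (c.sub i) := by
    rintro i hi (ht | hv)
    · exact ⟨.inn, ht, hi t ht⟩
    · exact ⟨.non, hv, hi⟩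
  have aux' : ∀ i, (t ∈ c.sub i ∨ v ∈ c.sub i) → (t ∈ c.sub i ∨ ∃ v ∈ c.sub i, c.B t v = 1) :=
    fun i hi => hi.imp_right fun hv => ⟨v, hv, h.tf⟩
  obtain ⟨τL, hτL⟩ := aux _ hc.L.iso hL
  obtain ⟨τE, hτE⟩ := aux _ hc.E.iso hE
  refine Or.inl ⟨t, v, h, hc.red h (aux' _ hL) (aux' _ hE) hZ, line_step_one h2 h
    (LE.fnZ .perp τL τE τ) ?_⟩
  rintro (_ | _ | _ | k)
  · exact fun z hz => ⟨hZ z hz, hZ' z hz⟩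
  · exact hτL
  · exact hτE
  · exact hτ k

theorem PZ.step [Finite κ] [Nonempty κ] {c : Cfg F (Option (LE κ))} (hc : PZ c)
    (h2 : (2 : F) ≠ 0) : PZStep c := by
  classical
  obtain ⟨z, hz1, hzL, hzE, hzZ⟩ := hc.Z
  have memZ : ∀ {x}, x ∈ c.sub none ↔ ∃ a : F, a • z = x := fun {x} => by
    rw [hzZ, Submodule.mem_span_singleton]
  have symm := c.symm
  -- a common line
  by_cases h1 : ∃ t ∈ c.sub (some .L), t ∈ c.sub (some .E) ∧ t ≠ 0
  · obtain ⟨t, htL, htE, ht0⟩ := h1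
    obtain ⟨v, hv, τ, g, hτ, hg⟩ := exists_hyp_chain h2 hc.nd (hc.L.iso t htL t htL) ht0 hc.mono
      hc.iso
    have htz : c.B t z = 0 := by rw [symm, hzL t htL]
    have hZt : ∀ x ∈ c.sub none, c.B t x = 0 := by
      intro x hx
      obtain ⟨a, rfl⟩ := memZ.1 hx
      simp [htz]
    by_cases hvz : c.B v z = 0
    · refine hc.one h2 hv (Or.inl htL) (Or.inl htE) hZt ?_ fun k => ⟨_, hτ k⟩
      intro x hx
      obtain ⟨a, rfl⟩ := memZ.1 hx
      simp [hvz]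
    · set b := c.B v z with hb
      have hv' : c.Hyp t (v - b • z + (b ^ 2 / 2) • t) := by
        refine ⟨hv.tt, ?_, ?_⟩
        · simp [hv.ff, hv.ft, hv.tf, hv.tt, symm z v, ← hb, hz1, htz, symm z t]
          field_simp
          ring
        · simp [hv.tf, htz, hv.tt]
      have hvz' : c.B (v - b • z + (b ^ 2 / 2) • t) z = 0 := by
        simp [← hb, hz1, htz]
      refine Or.inl ⟨t, v, hv, hc.red hv (Or.inl htL) (Or.inl htE) hZt,
        line_step h2 hc.nd hv hv' (LE.fnZ .perp .inn .inn τ)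
            (LE.fnZ true false false fun _ => false) ?_ (some (.C g)) none ?_ ?_
          none (by simp) ?_⟩
      · rintro (_ | _ | _ | k)
        · intro x hx
          obtain ⟨a, rfl⟩ := memZ.1 hx
          refine ⟨hZt _ hx, ?_⟩
          change c.B (v - b • z + (b ^ 2 / 2) • t) (a • z) = 0
          rw [map_smul, hvz', smul_zero]
        · exact ⟨htL, fun x hx => hc.L.iso t htL x hx⟩
        · exact ⟨htE, fun x hx => hc.E.iso t htE x hx⟩
        · exact hτ k
      · rintro (_ | _ | _ | k) h
        · cases h
        · trivial
        · trivial
        · exact hg k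
      · rintro (_ | _ | _ | k) h <;> cases h
        simp [Dom, LE.fnZ]
      · rintro x htx hvx hvx' - ⟨a, ha⟩
        left
        obtain ⟨r, hr⟩ := memZ.1 ha
        have hx : x = r • z - a • t := by rw [hr]; simp
        subst hx
        simp [hv.ft, hv.tt, hz1, htz, symm z t, ← hb] at hvx hvx'
        have hr0 : r = 0 := by
          have : r * b = 0 := by linear_combination hvx - hvx'
          exact (mul_eq_zero.1 this).resolve_right hvz
        have ha0 : a = 0 := by
          rw [hr0] at hvx
          linear_combination -hvx
        simp [hr0, ha0]
  push Not at h1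
  have h1' : ∀ x ∈ c.sub (some .L), x ∈ c.sub (some .E) → x = 0 := h1
  have noZ : ∀ t, c.B t t = 0 → (∃ a : F, a • z = t) → t = 0 := by
    rintro t ht ⟨a, rfl⟩
    simp [hz1] at ht
    simp [ht]
  have zL : ∀ v ∈ c.sub (some .L), ∀ x ∈ c.sub none, c.B v x = 0 := by
    intro v hv x hx
    obtain ⟨a, rfl⟩ := memZ.1 hx
    simp [symm v z, hzL v hv]
  have zE : ∀ v ∈ c.sub (some .E), ∀ x ∈ c.sub none, c.B v x = 0 := by
    intro v hv x hx
    obtain ⟨a, rfl⟩ := memZ.1 hx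
    simp [symm v z, hzE v hv]
  by_cases h0 : ∀ k, c.sub (some (.C k)) = ⊥
  · by_cases hL0 : ∃ t ∈ c.sub (some .L), t ≠ 0
    · obtain ⟨t, ht, ht0⟩ := hL0
      have htE : t ∉ c.sub (some .E) := fun h => ht0 (h1 t ht h)
      obtain ⟨v, hv, htv⟩ := hc.E.exists_not_perp symm (hc.L.iso t ht t ht) htE
      refine hc.one h2 ⟨hc.L.iso t ht t ht, hc.E.iso v hv v hv, htv⟩ (Or.inl ht) (Or.inr hv)
        (zL t ht) (zE v hv) fun k => ⟨.perp, fun x hx => ?_⟩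
      rw [h0 k] at hx
      have : x = 0 := hx
      simp [this]
    · push Not at hL0
      have hspan : ∀ x, ∃ a : F, x = a • z := fun x => by
        obtain ⟨a, ha⟩ := hc.L.of_norm symm hz1 hzL (x := x) fun y hy => by simp [hL0 y hy]
        exact ⟨a, sub_eq_zero.1 (hL0 _ ha)⟩
      have hE0 : ∀ x ∈ c.sub (some .E), x = 0 := fun x hx => by
        obtain ⟨a, ha⟩ := hspan x
        exact noZ x (hc.E.iso x hx x hx) ⟨a, ha.symm⟩
      have hz0 : ∀ a : F, a • z = 0 → a = 0 := fun a ha => by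
        have := congrArg (c.B z) ha
        simpa [hz1] using this
      let g : F ≃ₗ[F] c.V := LinearEquiv.ofBijective (LinearMap.toSpanSingleton F c.V z)
        ⟨(injective_iff_map_eq_zero _).2 hz0, fun x => by
          obtain ⟨a, rfl⟩ := hspan x
          exact ⟨a, rfl⟩⟩
      have hbot : ∀ i, (∀ x ∈ c.sub i, x = 0) → ∀ x : F, x ∈ (⊥ : Submodule F F) ↔
          x • z ∈ c.sub i := fun i hi x =>
        ⟨fun hx => by rw [(Submodule.mem_bot F).1 hx, zero_smul]; exact zero_mem _,
          fun hx => (Submodule.mem_bot F).2 (hz0 x (hi _ hx))⟩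
      refine Or.inr (Or.inr (Iso.symm ⟨g, fun (x y : F) => ?_, ?_⟩))
      · change c.B (x • z) (y • z) = x * y
        simp [hz1]
        ring
      · rintro (_ | _ | _ | k) (x : F)
        · exact ⟨fun _ => memZ.2 ⟨x, rfl⟩, fun _ => trivial⟩
        · exact hbot _ hL0 x
        · exact hbot _ hE0 x
        · exact hbot _ (fun y hy => by simpa [h0 k] using hy) x
  push Not at h0
  obtain ⟨k, hk, hkmin⟩ := (Set.toFinite {k | c.sub (some (.C k)) ≠ ⊥}).exists_minimal h0
  have hlow : ∀ j, ¬ k ≤ j → c.sub (some (.C j)) = ⊥ := fun j hj => by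
    by_contra h
    exact hj (hkmin h (le_of_not_ge hj))
  have hty : ∀ t ∈ c.sub (some (.C k)), ∀ v, ∀ j,
      HasTy c.B t v (if k ≤ j then .inn else .perp) (c.sub (some (.C j))) := by
    intro t ht v j
    split_ifs with hj
    · exact ⟨hc.mono hj ht, fun x hx => hc.iso j t (hc.mono hj ht) x hx⟩
    · rw [hlow j hj]
      intro x hx
      have : x = 0 := hx
      simp [this]
  by_cases h3 : ∃ t ∈ c.sub (some (.C k)), t ∈ c.sub (some .L) ∧ t ≠ 0
  · obtain ⟨t, htC, ht, ht0⟩ := h3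
    have htE : t ∉ c.sub (some .E) := fun h => ht0 (h1 t ht h)
    obtain ⟨v, hv, htv⟩ := hc.E.exists_not_perp symm (hc.L.iso t ht t ht) htE
    exact hc.one h2 ⟨hc.L.iso t ht t ht, hc.E.iso v hv v hv, htv⟩ (Or.inl ht) (Or.inr hv)
        (zL t ht) (zE v hv) fun j => ⟨_, hty t htC v j⟩
  by_cases h4 : ∃ t ∈ c.sub (some (.C k)), t ∈ c.sub (some .E) ∧ t ≠ 0
  · obtain ⟨t, htC, ht, ht0⟩ := h4
    have htE : t ∉ c.sub (some .L) := fun h => ht0 (h1 t h ht)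
    obtain ⟨v, hv, htv⟩ := hc.L.exists_not_perp symm (hc.E.iso t ht t ht) htE
    exact hc.one h2 ⟨hc.E.iso t ht t ht, hc.L.iso v hv v hv, htv⟩ (Or.inr hv) (Or.inl ht)
        (zE t ht) (zL v hv) fun j => ⟨_, hty t htC v j⟩
  push Not at h3 h4
  have frame : ∀ t ∈ c.sub (some (.C k)), t ≠ 0 → ∃ v₁ ∈ c.sub (some .L), ∃ v₂ ∈ c.sub (some .E),
      c.Hyp t v₁ ∧ c.Hyp t v₂ ∧ ∀ x, c.B t x = 0 → c.B v₁ x = 0 → c.B v₂ x = 0 →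
        DD c.B t .non (c.sub (some .L)) x → DD c.B t .non (c.sub (some .E)) x →
        ∃ a : F, x = a • z := by
    intro t ht ht0
    have htt := hc.iso k t ht t ht
    obtain ⟨v₁, hv₁, h5⟩ := hc.L.exists_not_perp symm htt fun h => ht0 (h3 t ht h)
    obtain ⟨v₂, hv₂, h6⟩ := hc.E.exists_not_perp symm htt fun h => ht0 (h4 t ht h)
    refine ⟨v₁, hv₁, v₂, hv₂, ⟨htt, hc.L.iso _ hv₁ _ hv₁, h5⟩, ⟨htt, hc.E.iso _ hv₂ _ hv₂, h6⟩,
      fun x htx h7 h8 hD1 hD2 => ?_⟩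
    refine perp_both symm hc.L hc.E h1' hz1 hzL hzE (fun y hy => ?_) fun y hy => ?_
    · have := hD1 (y - c.B t y • v₁) (sub_mem hy (Submodule.smul_mem _ _ hv₁)) (by simp [h5])
      simpa [symm x v₁, h7] using this
    · have := hD2 (y - c.B t y • v₂) (sub_mem hy (Submodule.smul_mem _ _ hv₂)) (by simp [h6])
      simpa [symm x v₂, h8] using this
  have domL : ∀ (τ : Option (LE κ) → Ty), τ (some .L) = .non →
      (∀ j, τ (some (.C j)) = if k ≤ j then .inn else .perp) →
      ∀ j, Dom c.B τ c.sub (some .L) (some (.C j)) := by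
    intro τ hτ hτ' j
    simp only [Dom, hτ, hτ']
    split_ifs with hj
    · trivial
    · rw [hlow j hj]
      intro x hx
      have : x = 0 := hx
      simp [this]
  by_cases h5 : ∃ t ∈ c.sub (some (.C k)), c.B t z ≠ 0
  · obtain ⟨t, ht, htz⟩ := h5
    have ht0 : t ≠ 0 := by rintro rfl; simp at htz
    obtain ⟨v₁, hv₁, v₂, hv₂, hh₁, hh₂, hK⟩ := frame t ht ht0
    refine Or.inr (Or.inl ⟨c.reindex some, ⟨LinearEquiv.refl F c.V, fun _ _ => rfl, ?_⟩, rfl,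
      t, v₁, ⟨hh₁.tt, hh₁.ff, hh₁.tf⟩, ?_, ?_⟩)
    · rintro (_ | i) x
      · change _ ↔ x ∈ orth c.B (c.sub (some .L)) ∧ x ∈ orth c.B (c.sub (some .E))
        constructor
        · intro hx
          exact ⟨fun y hy => by rw [symm]; exact zL y hy x hx,
            fun y hy => by rw [symm]; exact zE y hy x hx⟩
        · rintro ⟨hx1, hx2⟩
          obtain ⟨a, rfl⟩ := perp_both symm hc.L hc.E h1' hz1 hzL hzE hx1 hx2
          exact memZ.2 ⟨a, rfl⟩
      · rfl
    · exact PI.red (c := c.reindex some) ⟨hc.nd, hc.L, hc.E, hc.mono, hc.iso⟩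
        ⟨hh₁.tt, hh₁.ff, hh₁.tf⟩ (Or.inr ⟨v₁, hv₁, hh₁.tf⟩) (Or.inr ⟨v₂, hv₂, hh₂.tf⟩)
    · refine line_step (c := c.reindex some) h2 hc.nd (v₂ := v₂) ⟨hh₁.tt, hh₁.ff, hh₁.tf⟩
        ⟨hh₂.tt, hh₂.ff, hh₂.tf⟩
        (LE.fn .non .non fun j => if k ≤ j then .inn else .perp)
        (LE.fn false true fun _ => false) ?_ .L .E ?_ ?_ none (by simp) ?_
      · rintro (_ | _ | j)
        · exact ⟨hv₁, hc.L.iso⟩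
        · exact ⟨hv₂, hc.E.iso⟩
        · exact hty t ht _ j
      · rintro (_ | _ | j) h
        · simp [Dom, LE.fn]
        · cases h
        · exact domL (LE.fnZ .perp .non .non fun j => if k ≤ j then .inn else .perp) rfl
              (fun _ => rfl) j
      · rintro (_ | _ | j) h <;> cases h
        simp [Dom, LE.fn]
      · intro x htx h7 h8 hD1 hD2
        obtain ⟨a, rfl⟩ := hK x htx h7 h8 hD1 hD2
        left
        have : a * c.B t z = 0 := by simpa using htx
        simp [(mul_eq_zero.1 this).resolve_right htz]
  · push Not at h5
    obtain ⟨t, ht, ht0⟩ := (Submodule.ne_bot_iff _).1 hk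
    obtain ⟨v₁, hv₁, v₂, hv₂, hh₁, hh₂, hK⟩ := frame t ht ht0
    have hZt : ∀ x ∈ c.sub none, c.B t x = 0 := by
      intro x hx
      obtain ⟨a, rfl⟩ := memZ.1 hx
      simp [h5 t ht]
    refine Or.inl ⟨t, v₁, hh₁, hc.red hh₁ (Or.inr ⟨v₁, hv₁, hh₁.tf⟩) (Or.inr ⟨v₂, hv₂, hh₂.tf⟩)
      hZt, ?_⟩
    refine line_step h2 hc.nd hh₁ hh₂
        (LE.fnZ .perp .non .non fun j => if k ≤ j then .inn else .perp)
        (LE.fnZ false false true fun _ => false) ?_ (some .L) (some .E) ?_ ?_ (some none) ?_ ?_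
    · rintro (_ | _ | _ | j)
      · exact fun x hx => ⟨hZt x hx, zL _ hv₁ x hx⟩
      · exact ⟨hv₁, hc.L.iso⟩
      · exact ⟨hv₂, hc.E.iso⟩
      · exact hty t ht _ j
    · rintro (_ | _ | _ | j) h
      · intro x hx y hy
        rw [symm]
        exact zL y hy x hx
      · simp [Dom, LE.fn, LE.fnZ]
      · cases h
      · exact domL _ rfl (fun _ => rfl) j
    · rintro (_ | _ | _ | j) h <;> cases h
      simp [Dom, LE.fn, LE.fnZ]
    · rintro z' hz' x hx
      cases hz'
      rw [zL _ hv₁ x hx, zE _ hv₂ x hx]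
    · intro x htx h7 h8 hD1 hD2
      obtain ⟨a, rfl⟩ := hK x htx h7 h8 hD1 hD2
      exact Or.inr ⟨none, rfl, 0, by simpa using memZ.2 ⟨a, rfl⟩⟩

theorem PI.exists_PZ {c : Cfg F (LE κ)} (hc : PI c) :
    ∃ c' : Cfg F (Option (LE κ)), (PZ c' ∧ finrank F c'.V = finrank F c.V) ∧
      Iso c (c'.reindex some) := by
  obtain ⟨z, h1, h2, h3⟩ := exists_common_norm c.symm hc.L hc.E
  refine ⟨{ V := c.V, B := c.B, symm := c.symm, sub := fun | none => Submodule.span F {z}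
                                                            | some i => c.sub i },
    ⟨⟨hc.nd, hc.L, hc.E, hc.mono, hc.iso, z, h1, h2, h3, rfl⟩, rfl⟩, Iso.refl c⟩

theorem finIso_PZ [Finite κ] [Nonempty κ] (h2 : (2 : F) ≠ 0) (m : ℕ) :
    FinIso fun c : Cfg F (Option (LE κ)) => PZ c ∧ finrank F c.V < m := by
  induction m with
  | zero => exact ⟨∅, Set.finite_empty, fun c hc => absurd hc.2 (Nat.not_lt_zero _)⟩
  | succ m ih =>
    have ih' : FinIso fun c : Cfg F (LE κ) => PI c ∧ finrank F c.V < m :=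
      ih.reindex some fun c hc => by
        obtain ⟨c', ⟨h3, h4⟩, h5⟩ := hc.1.exists_PZ
        exact ⟨c', ⟨h3, h4 ▸ hc.2⟩, h5⟩
    refine FinIso.mono (((ih.reduces lineModel).or (ih'.reduces fun d p => (lineModel d p).addZ)).or
      ⟨{pointZ F κ}, Set.finite_singleton _, fun c hc => ⟨_, rfl, hc⟩⟩) ?_
    rintro c ⟨hc, hm⟩
    rcases hc.step h2 with ⟨t, f, h, hP, hOK⟩ | ⟨c0, hcc, hr, t, f, h, hP, hOK⟩ | h
    · exact Or.inl (Or.inl ⟨_, ⟨hP, lt_of_lt_of_le (red_finrank h) (Nat.lt_succ_iff.1 hm)⟩, hOK⟩)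
    · refine Or.inl (Or.inr ⟨_, ⟨hP, ?_⟩, fun d hd => ?_⟩)
      · have := red_finrank h
        omega
      · obtain ⟨p, hp⟩ := hOK d hd
        exact ⟨p, hcc.trans hp.addZ⟩
    · exact Or.inr h

/-- Finiteness for two maximal isotropic subspaces and a chain. -/
theorem finIso_PI [Finite κ] [Nonempty κ] (h2 : (2 : F) ≠ 0) (m : ℕ) :
    FinIso fun c : Cfg F (LE κ) => PI c ∧ finrank F c.V < m :=
  (finIso_PZ h2 m).reindex some fun c hc => by
    obtain ⟨c', ⟨h3, h4⟩, h5⟩ := hc.1.exists_PZ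
    exact ⟨c', ⟨h3, h4 ▸ hc.2⟩, h5⟩

end Cfg

namespace Cfg

variable {F : Type u} [Field F]

/-- A maximal isotropic subspace `L`, an isotropic subspace `E` and an isotropic flag `A ≤ C`. -/
structure PF (c : Cfg F (LE Bool)) : Prop where
  nd : Nondeg c.B
  L : IsMax c.B (c.sub .L)
  E : Isot c.B (c.sub .E)
  AC : c.sub (.C false) ≤ c.sub (.C true)
  C : Isot c.B (c.sub (.C true))

/-- A reduction along a line. -/
def PFLine (c : Cfg F (LE Bool)) : Prop := ∃ t f, c.Hyp t f ∧ PF (c.red t f) ∧ LineOK c t f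

/-- The configurations without elementary reductions. -/
structure PFStar (c : Cfg F (LE Bool)) : Prop where
  EL : ∀ x ∈ c.sub .E, x ∈ c.sub .L → x = 0
  AE : ∀ x ∈ c.sub (.C false), (∀ y ∈ c.sub .E, c.B x y = 0) → x = 0
  LC : ∀ x ∈ c.sub .L, x ∈ c.sub (.C true) → x = 0
  EC : ∀ x ∈ c.sub .E, (∀ y ∈ c.sub (.C true), c.B x y = 0) → x = 0
  LEA : ∀ x ∈ c.sub .L, (∀ y ∈ c.sub .E, c.B x y = 0) →
    (∀ y ∈ c.sub (.C false), c.B x y = 0) → x = 0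

theorem PF.red {c : Cfg F (LE Bool)} (hc : PF c) {t f : c.V} (h : c.Hyp t f) :
    PF (c.red t f) := by
  refine ⟨red_nondeg h hc.nd, isMax_red h hc.L ?_, isot_red h hc.E, le_red hc.AC, isot_red h hc.C⟩
  by_cases ht : t ∈ c.sub .L
  · exact Or.inl ht
  · exact Or.inr (hc.L.exists_not_perp c.symm h.tt ht)

theorem PF.A {c : Cfg F (LE Bool)} (hc : PF c) : Isot c.B (c.sub (.C false)) :=
  fun x hx y hy => hc.C x (hc.AC hx) y (hc.AC hy)

theorem exists_hyp_one {ι : Type} {c : Cfg F ι} (h2 : (2 : F) ≠ 0)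
    (hnd : Nondeg c.B) {t : c.V} (htt : c.B t t = 0) (ht0 : t ≠ 0)
    {S : Submodule F c.V} (hi : Isot c.B S) : ∃ v, c.Hyp t v ∧ ∃ τ, HasTy c.B t v τ S := by
  obtain ⟨v, hv, τ, -, hτ, -⟩ := exists_hyp_chain (κ := Unit) h2 hnd htt ht0 (C := fun _ => S)
    (fun _ _ _ => le_rfl) fun _ => hi
  exact ⟨v, hv, τ (), hτ ()⟩

theorem perp_of_dd_non {V : Type u} [AddCommGroup V] [Module F V] {B : V →ₗ[F] V →ₗ[F] F}
    (hs : ∀ x y, B x y = B y x) {S : Submodule F V} {t v x : V} (hv : v ∈ S) (htv : B t v = 1)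
    (hvx : B v x = 0) (h : DD B t .non S x) : ∀ y ∈ S, B x y = 0 := by
  intro y hy
  have := h (y - B t y • v) (sub_mem hy (Submodule.smul_mem _ _ hv)) (by simp [htv])
  simpa [hs x v, hvx] using this

theorem mem_of_dd_perp {ι : Type} {c : Cfg F ι} {S : Submodule F c.V} {t v x : c.V}
    (h : c.Hyp t v) (hS : ∀ y ∈ S, c.B v y = 0)
    (hvx : c.B v x = 0) (hD : DD c.B t .perp S x) : x ∈ S := by
  obtain ⟨a, ha⟩ := hD
  have := hS _ ha
  simp [hvx, h.ft] at this
  simpa [this] using ha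

theorem PF.one {c : Cfg F (LE Bool)} (hc : PF c) (h2 : (2 : F) ≠ 0) {t v : c.V}
    (h : c.Hyp t v) (hτ : ∀ i, ∃ τ, HasTy c.B t v τ (c.sub i)) : PFLine c := by
  choose τ hτ using hτ
  exact ⟨t, v, h, hc.red h, line_step_one h2 h τ hτ⟩

theorem PF.line_or_star {c : Cfg F (LE Bool)} (hc : PF c) (h2 : (2 : F) ≠ 0) :
    PFLine c ∨ PFStar c := by
  have symm := c.symm
  by_cases h0a : ∃ t ∈ c.sub .E, t ∈ c.sub .L ∧ t ≠ 0
  · obtain ⟨t, htE, htL, ht0⟩ := h0a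
    obtain ⟨v, hv, τ, -, hτ, -⟩ := exists_hyp_chain (κ := Bool) h2 hc.nd (hc.E t htE t htE) ht0
      (C := fun k => c.sub (.C k)) (by
        rintro (_ | _) (_ | _) h
        · exact le_rfl
        · exact hc.AC
        · cases h rfl
        · exact le_rfl) (by
        rintro (_ | _)
        · exact hc.A
        · exact hc.C)
    refine Or.inl (hc.one h2 hv ?_)
    rintro (_ | _ | k)
    · exact ⟨.inn, htL, hc.L.iso t htL⟩
    · exact ⟨.inn, htE, hc.E t htE⟩
    · exact ⟨τ k, hτ k⟩
  push Not at h0a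
  by_cases h0b : ∃ t ∈ c.sub .E, t ∈ c.sub (.C false) ∧ t ≠ 0
  · obtain ⟨t, htE, htA, ht0⟩ := h0b
    obtain ⟨v, hv, τ, hτ⟩ := exists_hyp_one h2 hc.nd (hc.E t htE t htE) ht0 hc.L.iso
    refine Or.inl (hc.one h2 hv ?_)
    rintro (_ | _ | _ | _)
    · exact ⟨τ, hτ⟩
    · exact ⟨.inn, htE, hc.E t htE⟩
    · exact ⟨.inn, htA, hc.A t htA⟩
    · exact ⟨.inn, hc.AC htA, hc.C t (hc.AC htA)⟩
  push Not at h0b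
  by_cases h0c : ∃ t ∈ c.sub (.C false), t ∈ c.sub .L ∧ t ≠ 0
  · obtain ⟨t, htA, htL, ht0⟩ := h0c
    obtain ⟨v, hv, τ, hτ⟩ := exists_hyp_one h2 hc.nd (hc.L.iso t htL t htL) ht0 hc.E
    refine Or.inl (hc.one h2 hv ?_)
    rintro (_ | _ | _ | _)
    · exact ⟨.inn, htL, hc.L.iso t htL⟩
    · exact ⟨τ, hτ⟩
    · exact ⟨.inn, htA, hc.A t htA⟩
    · exact ⟨.inn, hc.AC htA, hc.C t (hc.AC htA)⟩
  push Not at h0c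
  by_cases h1 : ∃ t ∈ c.sub (.C false), (∀ y ∈ c.sub .E, c.B t y = 0) ∧ t ≠ 0
  · obtain ⟨t, htA, htE, ht0⟩ := h1
    have htt := hc.A t htA t htA
    obtain ⟨v₁, hv₁, htv₁⟩ := hc.L.exists_not_perp symm htt fun h => ht0 (h0c t htA h)
    obtain ⟨v₂, hv₂, hv₂E⟩ := exists_hyp hc.nd htt _ (fun h => ht0 (h0b t h htA)) htE h2
    have hh₁ : c.Hyp t v₁ := ⟨htt, hc.L.iso _ hv₁ _ hv₁, htv₁⟩
    refine Or.inl ⟨t, v₁, hh₁, hc.red hh₁, line_step h2 hc.nd hh₁ hv₂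
      (LE.fn .non .perp fun _ => .inn) (LE.fn false true fun _ => false) ?_ .L .E ?_ ?_ none
      (by simp) ?_⟩
    · rintro (_ | _ | _ | _)
      · exact ⟨hv₁, hc.L.iso⟩
      · exact fun x hx => ⟨htE x hx, hv₂E x hx⟩
      · exact ⟨htA, hc.A t htA⟩
      · exact ⟨hc.AC htA, hc.C t (hc.AC htA)⟩
    · rintro (_ | _ | _ | _) h
      · exact le_rfl
      · cases h
      · trivial
      · trivial
    · rintro (_ | _ | _ | _) h <;> cases h
      exact le_rfl
    · intro x htx hx1 hx2 hD1 hD2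
      have hxE := mem_of_dd_perp hv₂ hv₂E hx2 hD2
      exact Or.inl (h0a x hxE (hc.L.mem symm (perp_of_dd_non symm hv₁ htv₁ hx1 hD1)
        (hc.E x hxE x hxE)))
  push Not at h1
  by_cases h2' : ∃ t ∈ c.sub .L, t ∈ c.sub (.C true) ∧ t ≠ 0
  · obtain ⟨t, htL, htC, ht0⟩ := h2'
    have htt := hc.L.iso t htL t htL
    have htA : ∀ x ∈ c.sub (.C false), c.B t x = 0 := fun x hx => hc.C t htC x (hc.AC hx)
    obtain ⟨v₁, hv₁, hv₁A⟩ := exists_hyp hc.nd htt _ (fun h => ht0 (h0c t h htL)) htA h2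
    obtain ⟨v₂, hv₂, τ, hτ⟩ := exists_hyp_one h2 hc.nd htt ht0 hc.E
    refine Or.inl ⟨t, v₁, hv₁, hc.red hv₁, line_step h2 hc.nd hv₁ hv₂
      (LE.fn .inn τ fun k => bif k then .inn else .perp) (LE.fn false true fun _ => false) ?_
      (.C false) .E ?_ ?_ none (by simp) ?_⟩
    · rintro (_ | _ | _ | _)
      · exact ⟨htL, hc.L.iso t htL⟩
      · exact hτ
      · exact fun x hx => ⟨htA x hx, hv₁A x hx⟩
      · exact ⟨htC, hc.C t htC⟩
    · rintro (_ | _ | _ | _) h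
      · trivial
      · cases h
      · exact le_rfl
      · trivial
    · rintro (_ | _ | _ | _) h <;> cases h
      cases τ <;> simp [Dom, LE.fn]
    · intro x htx hx1 hx2 hD1 hD2
      have hxA := mem_of_dd_perp hv₁ hv₁A hx1 hD1
      left
      cases τ
      · exact hD2
      · exact h0b x (mem_of_dd_perp hv₂ (fun y hy => (hτ y hy).2) hx2 hD2) hxA
      · exact h1 x hxA (perp_of_dd_non symm hτ.1 hv₂.tf hx2 hD2)
  push Not at h2'
  by_cases h3 : ∃ t ∈ c.sub .E, (∀ y ∈ c.sub (.C true), c.B t y = 0) ∧ t ≠ 0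
  · obtain ⟨t, htE, htC, ht0⟩ := h3
    have htt := hc.E t htE t htE
    obtain ⟨v₁, hv₁, htv₁⟩ := hc.L.exists_not_perp symm htt fun h => ht0 (h0a t htE h)
    have hh₁ : c.Hyp t v₁ := ⟨htt, hc.L.iso _ hv₁ _ hv₁, htv₁⟩
    have htA : t ∉ c.sub (.C false) := fun h => ht0 (h0b t htE h)
    have hK : ∀ x, c.B v₁ x = 0 → DD c.B t .non (c.sub .L) x → x ∈ c.sub (.C true) → x = 0 :=
      fun x hx1 hD1 hxC => h2' x (hc.L.mem symm (perp_of_dd_non symm hv₁ htv₁ hx1 hD1)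
        (hc.C x hxC x hxC)) hxC
    by_cases htC' : t ∈ c.sub (.C true)
    · have htA' : ∀ x ∈ c.sub (.C false), c.B t x = 0 := fun x hx => htC x (hc.AC hx)
      obtain ⟨v₂, hv₂, hv₂A⟩ := exists_hyp hc.nd htt _ htA htA' h2
      refine Or.inl ⟨t, v₁, hh₁, hc.red hh₁, line_step h2 hc.nd hh₁ hv₂
        (LE.fn .non .inn fun k => bif k then .inn else .perp) (LE.fn false false fun k => !k) ?_
        .L (.C false) ?_ ?_ none (by simp) ?_⟩
      · rintro (_ | _ | _ | _)
        · exact ⟨hv₁, hc.L.iso⟩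
        · exact ⟨htE, hc.E t htE⟩
        · exact fun x hx => ⟨htA' x hx, hv₂A x hx⟩
        · exact ⟨htC', htC⟩
      · rintro (_ | _ | _ | _) h
        · exact le_rfl
        · trivial
        · cases h
        · trivial
      · rintro (_ | _ | _ | _) h <;> cases h
        exact le_rfl
      · intro x htx hx1 hx2 hD1 hD2
        exact Or.inl (hK x hx1 hD1 (hc.AC (mem_of_dd_perp hv₂ hv₂A hx2 hD2)))
    · obtain ⟨v₂, hv₂, hv₂C⟩ := exists_hyp hc.nd htt _ htC' htC h2
      refine Or.inl ⟨t, v₁, hh₁, hc.red hh₁, line_step h2 hc.nd hh₁ hv₂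
        (LE.fn .non .inn fun _ => .perp) (LE.fn false false fun _ => true) ?_
        .L (.C true) ?_ ?_ none (by simp) ?_⟩
      · rintro (_ | _ | _ | _)
        · exact ⟨hv₁, hc.L.iso⟩
        · exact ⟨htE, hc.E t htE⟩
        · exact fun x hx => ⟨htC x (hc.AC hx), hv₂C x (hc.AC hx)⟩
        · exact fun x hx => ⟨htC x hx, hv₂C x hx⟩
      · rintro (_ | _ | _ | _) h
        · exact le_rfl
        · trivial
        · cases h
        · cases h
      · rintro (_ | _ | _ | _) h <;> cases h
        · exact hc.AC
        · exact le_rfl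
      · intro x htx hx1 hx2 hD1 hD2
        exact Or.inl (hK x hx1 hD1 (mem_of_dd_perp hv₂ hv₂C hx2 hD2))
  push Not at h3
  by_cases h4 : ∃ t ∈ c.sub .L, (∀ y ∈ c.sub .E, c.B t y = 0) ∧
    (∀ y ∈ c.sub (.C false), c.B t y = 0) ∧ t ≠ 0
  · obtain ⟨t, htL, htE, htA, ht0⟩ := h4
    have htt := hc.L.iso t htL t htL
    obtain ⟨v₁, hv₁, hv₁E⟩ := exists_hyp hc.nd htt _ (fun h => ht0 (h0a t h htL)) htE h2
    obtain ⟨v₂, hv₂, τ, g, hτ, hg⟩ := exists_hyp_chain (κ := Bool) h2 hc.nd htt ht0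
      (C := fun k => c.sub (.C k)) (by
        rintro (_ | _) (_ | _) h
        · exact le_rfl
        · exact hc.AC
        · cases h rfl
        · exact le_rfl) (by
        rintro (_ | _)
        · exact hc.A
        · exact hc.C)
    refine Or.inl ⟨t, v₁, hv₁, hc.red hv₁, line_step h2 hc.nd hv₁ hv₂
        (LE.fn .inn .perp τ) (LE.fn false false fun _ => true) ?_
        .E (.C g) ?_ ?_ none (by simp) ?_⟩
    · rintro (_ | _ | k)
      · exact ⟨htL, hc.L.iso t htL⟩
      · exact fun x hx => ⟨htE x hx, hv₁E x hx⟩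
      · exact hτ k
    · rintro (_ | _ | k) h
      · trivial
      · exact le_rfl
      · cases h
    · rintro (_ | _ | k) h
      · cases h
      · cases h
      · exact hg k
    · intro x htx hx1 hx2 hD1 hD2
      have hxE := mem_of_dd_perp hv₁ hv₁E hx1 hD1
      left
      change DD c.B t (τ g) (c.sub (.C g)) x at hD2
      have hτg := hτ g
      cases hg' : τ g <;> rw [hg'] at hD2 hτg
      · exact hD2
      · have hxC : x ∈ c.sub (.C true) := by
          have := mem_of_dd_perp hv₂ (fun y hy => (hτg y hy).2) hx2 hD2
          cases g
          · exact hc.AC this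
          · exact this
        exact h3 x hxE (hc.C x hxC)
      · cases g
        · exact absurd (htA v₂ hτg.1) (by simp [hv₂.tf])
        · exact h3 x hxE (perp_of_dd_non symm hτg.1 hv₂.tf hx2 hD2)
  push Not at h4
  exact Or.inr ⟨h0a, h1, h2', h3, h4⟩

/-- An isotropic subspace in duality with a maximal one is maximal. -/
theorem IsMax.of_dual {V : Type u} [AddCommGroup V] [Module F V] [FiniteDimensional F V]
    {B : V →ₗ[F] V →ₗ[F] F} (symm : ∀ x y, B x y = B y x) {L E : Submodule F V} (hL : IsMax B L)
    (hE : Isot B E) (hEL : ∀ x ∈ E, x ∈ L → x = 0)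
    (h : ∀ x ∈ L, (∀ y ∈ E, B x y = 0) → x = 0) : IsMax B E := by
  obtain ⟨z, h1, h2, h3⟩ := hL.ex
  obtain ⟨l, hl, hlE⟩ := exists_rep B L E (-B z) fun e he h' => by
    have := hEL e he (hL.mem symm (fun y hy => by rw [symm]; exact h' y hy) (hE e he e he))
    simp [this]
  have hz1 : B (z + l) (z + l) = 1 := by
    simp [h1, symm l z, h2 l hl, hL.iso l hl l hl]
  have hzL : ∀ x ∈ L, B (z + l) x = 0 := fun x hx => by
    simp [h2 x hx, hL.iso l hl x hx]
  have hzE : ∀ x ∈ E, B (z + l) x = 0 := fun x hx => by simp [hlE x hx]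
  refine ⟨hE, z + l, hz1, hzE, fun x hx => ?_⟩
  obtain ⟨e, he, heL⟩ := exists_rep B E L (B x) fun l hl h' => by
    rw [h l hl fun y hy => by rw [symm]; exact h' y hy, map_zero]
  obtain ⟨a, ha⟩ := hL.of_norm symm hz1 hzL (x := x - e) fun y hy => by simp [heL y hy]
  have h5 := h _ ha fun y hy => by
    have h6 := hzE y hy
    have h7 := hx y hy
    have h8 := hE e he y hy
    rw [map_sub, map_sub, map_smul, LinearMap.sub_apply, LinearMap.sub_apply, LinearMap.smul_apply,
      h6, h7, h8]
    simp
  refine ⟨a, ?_⟩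
  have : x - a • (z + l) = e := by
    rw [← sub_eq_zero, ← h5]
    abel
  rw [this]
  exact he

theorem PF.toPI {c : Cfg F (LE Bool)} (hc : PF c) (h : IsMax c.B (c.sub .E)) : PI c := by
  refine ⟨hc.nd, hc.L, h, ?_, ?_⟩
  · rintro (_ | _) (_ | _) h
    · exact le_rfl
    · exact hc.AC
    · cases h rfl
    · exact le_rfl
  · rintro (_ | _)
    · exact hc.A
    · exact hc.C

end Cfg

/-- A space `V` with subspaces `R ≤ E2` and `N`, a bilinear map `E2 × V → F` and a functional on
`E2`, both extended arbitrarily to `V`. -/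
structure Dat (F : Type u) [Field F] where
  V : Type u
  [acg : AddCommGroup V]
  [mod : Module F V]
  [fin : FiniteDimensional F V]
  β : V →ₗ[F] V →ₗ[F] F
  f : V →ₗ[F] F
  R : Submodule F V
  S : Submodule F V
  N : Submodule F V

attribute [instance] Dat.acg Dat.mod Dat.fin

namespace Dat

variable {F : Type u} [Field F]

/-- The compatibility conditions. -/
structure Valid (D : Dat F) : Prop where
  RS : D.R ≤ D.S
  skew : ∀ u ∈ D.S, ∀ v ∈ D.S, D.β u v + D.β v u + D.f u * D.f v = 0
  fR : ∀ r ∈ D.R, D.f r = 0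
  RN : ∀ r ∈ D.R, ∀ y ∈ D.N, D.β r y = 0
  nd : ∀ y ∈ D.N, (∀ u ∈ D.S, D.β u y = 0) → y = 0

/-- Isomorphism of data; the functional matters only up to sign. -/
def DIso (D D' : Dat F) : Prop :=
  ∃ (g : D.V ≃ₗ[F] D'.V) (σ : F), (σ = 1 ∨ σ = -1) ∧
    (∀ u ∈ D.S, ∀ v, D'.β (g u) (g v) = D.β u v) ∧ (∀ u ∈ D.S, D'.f (g u) = σ * D.f u) ∧
    (∀ x, x ∈ D.R ↔ g x ∈ D'.R) ∧ (∀ x, x ∈ D.S ↔ g x ∈ D'.S) ∧ ∀ x, x ∈ D.N ↔ g x ∈ D'.N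

/-- Finitely many isomorphism classes. -/
def FinD (P : Dat F → Prop) : Prop :=
  ∃ s : Set (Dat F), s.Finite ∧ ∀ D, P D → ∃ d ∈ s, DIso D d

/-- The finite set of structure constants. -/
def sval (F : Type u) [Field F] : Fin 5 → F := ![0, 1, -1, 1 / 2, -1 / 2]

theorem sval_neg (s : Fin 5) : ∃ s', sval F s' = -sval F s := by
  fin_cases s
  · exact ⟨0, by simp [sval]⟩
  · exact ⟨2, by simp [sval]⟩
  · exact ⟨1, by simp [sval]⟩
  · exact ⟨4, by simp [sval]; ring⟩
  · exact ⟨3, by simp [sval]; ring⟩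

/-- The parameters of a split datum: dimension, membership in `R`, `S`, `N`, and the structure
constants. -/
abbrev SpParam := Σ k : Fin 5, ((Fin k → Bool) × (Fin k → Bool) × (Fin k → Bool)) ×
  (Fin k → Fin k → Fin 5) × (Fin k → Fin 5)

/-- The subspace of a split space. -/
def spSub {V : Type u} [AddCommGroup V] [Module F V] {k : ℕ} (T : Submodule F V)
    (m : Fin k → Bool) : Submodule F ((Fin k → F) × V) where
  carrier := {x | x.2 ∈ T ∧ ∀ i, m i = false → x.1 i = 0}
  add_mem' := fun hx hy => ⟨T.add_mem hx.1 hy.1, fun i hi => by simp [hx.2 i hi, hy.2 i hi]⟩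
  zero_mem' := ⟨T.zero_mem, fun _ _ => rfl⟩
  smul_mem' := fun a _ hx => ⟨T.smul_mem a hx.1, fun i hi => by simp [hx.2 i hi]⟩

/-- A split datum. -/
def sp (D : Dat F) (p : SpParam) : Dat F where
  V := (Fin p.1 → F) × D.V
  β := LinearMap.mk₂ F (fun x y => ∑ i, ∑ j, x.1 i * y.1 j * sval F (p.2.2.1 i j) + D.β x.2 y.2 -
      D.f x.2 * ∑ j, y.1 j * sval F (p.2.2.2 j))
    (by intros; simp only [Prod.fst_add, Prod.snd_add, Pi.add_apply, map_add, add_mul,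
          Finset.sum_add_distrib, LinearMap.add_apply]; ring)
    (by intros; simp only [Prod.smul_fst, Prod.smul_snd, Pi.smul_apply, map_smul, smul_eq_mul,
          LinearMap.smul_apply, mul_sub, mul_add, Finset.mul_sum, mul_assoc])
    (by intros; simp only [Prod.fst_add, Prod.snd_add, Pi.add_apply, map_add, add_mul, mul_add,
          Finset.sum_add_distrib]; ring)
    (by intros; simp only [Prod.smul_fst, Prod.smul_snd, Pi.smul_apply, map_smul, smul_eq_mul,
          mul_sub, mul_add, Finset.mul_sum, mul_assoc, mul_left_comm])
  f := (∑ j, sval F (p.2.2.2 j) • LinearMap.proj j) ∘ₗ LinearMap.fst F _ _ +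
    D.f ∘ₗ LinearMap.snd F _ _
  R := spSub D.R p.2.1.1
  S := spSub D.S p.2.1.2.1
  N := spSub D.N p.2.1.2.2

theorem sp_f (D : Dat F) (p : SpParam) (x : (Fin p.1 → F) × D.V) : (D.sp p).f x =
    ∑ j, sval F (p.2.2.2 j) * x.1 j + D.f x.2 := by
  change (((∑ j, sval F (p.2.2.2 j) • LinearMap.proj j) ∘ₗ LinearMap.fst F _ _ +
    D.f ∘ₗ LinearMap.snd F _ _ : ((Fin p.1 → F) × D.V) →ₗ[F] F)) x = _
  simp

/-- Restriction to a subspace. -/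
def res (D : Dat F) (T : Submodule F D.V) : Dat F where
  V := T
  β := D.β.domRestrict₁₂ T T
  f := D.f.domRestrict T
  R := D.R.comap T.subtype
  S := D.S.comap T.subtype
  N := D.N.comap T.subtype

/-- `D` splits off a nonzero subspace of bounded dimension. -/
def Splits (D : Dat F) : Prop :=
  ∃ D', Valid D' ∧ finrank F D'.V < finrank F D.V ∧ ∀ D'', DIso D' D'' → ∃ p, DIso D (D''.sp p)

theorem Valid.splits {D : Dat F} (hD : Valid D) {k : ℕ} (hk : k < 5) (hk0 : 0 < k)
    (p : Fin k → D.V) (φ : Fin k → D.V →ₗ[F] F) (hφ : ∀ i j, φ i (p j) = if i = j then 1 else 0)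
    (hR : ∀ i, p i ∉ D.R → ∀ u ∈ D.R, φ i u = 0) (hS : ∀ i, p i ∉ D.S → ∀ u ∈ D.S, φ i u = 0)
    (hN : ∀ i, p i ∉ D.N → ∀ u ∈ D.N, φ i u = 0)
    (hc : ∀ i, p i ∈ D.S → ∀ m, (∀ j, φ j m = 0) → D.β (p i) m = 0)
    (hd : ∀ i, p i ∉ D.S → ∀ m ∈ D.S, (∀ j, φ j m = 0) → D.β m (p i) = 0)
    (hb : ∀ i, p i ∈ D.S → ∀ j, ∃ s, D.β (p i) (p j) = sval F s)
    (hf : ∀ i, p i ∈ D.S → ∃ s, D.f (p i) = sval F s) : Splits D := by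
  classical
  set T : Submodule F D.V := ⨅ i, LinearMap.ker (φ i) with hT
  have memT : ∀ {x}, x ∈ T ↔ ∀ i, φ i x = 0 := fun {x} => by simp [hT]
  set q : D.V →ₗ[F] D.V := LinearMap.id - ∑ i, (φ i).smulRight (p i) with hq
  have hqa : ∀ x, q x = x - ∑ i, φ i x • p i := fun x => by simp [hq, LinearMap.sum_apply]
  have hqT : ∀ x, q x ∈ T := fun x => memT.2 fun i => by
    simp [hqa, hφ]
  have hmem : ∀ U : Submodule F D.V, (∀ i, p i ∉ U → ∀ u ∈ U, φ i u = 0) →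
      ∀ x, x ∈ U ↔ q x ∈ U ∧ ∀ i, p i ∉ U → φ i x = 0 := by
    intro U hU x
    have aux : (∀ i, p i ∉ U → φ i x = 0) → ∑ i, φ i x • p i ∈ U := fun h =>
      U.sum_mem fun i _ => by
        by_cases hi : p i ∈ U
        · exact U.smul_mem _ hi
        · simp [h i hi]
    constructor
    · intro hx
      have h := fun i hi => hU i hi x hx
      exact ⟨by rw [hqa]; exact U.sub_mem hx (aux h), h⟩
    · rintro ⟨h1, h⟩
      have := U.add_mem h1 (aux h)
      rwa [hqa, sub_add_cancel] at this
  refine ⟨D.res T, ⟨fun (x : T) hx => hD.RS hx, fun (x : T) hx (y : T) hy =>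
    hD.skew x.1 hx y.1 hy, fun (x : T) hx => hD.fR x.1 hx, fun (x : T) hx (y : T) hy =>
    hD.RN x.1 hx y.1 hy, fun (y : T) hy h => ?_⟩, ?_, ?_⟩
  · refine Subtype.ext (hD.nd y.1 hy fun u hu => ?_)
    have hu' := (hmem _ hS u).1 hu
    have e : u = q u + ∑ i, φ i u • p i := by rw [hqa, sub_add_cancel]
    rw [e, map_add, LinearMap.add_apply, map_sum, LinearMap.sum_apply]
    have e1 : D.β (q u) y = 0 := h ⟨q u, hqT u⟩ hu'.1
    rw [e1, zero_add]
    refine Finset.sum_eq_zero fun i _ => ?_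
    by_cases hi : p i ∈ D.S
    · simp [hc i hi y (memT.1 y.2)]
    · simp [hu'.2 i hi]
  · refine Submodule.finrank_lt (s := T) fun h => ?_
    have : p ⟨0, hk0⟩ ∈ T := h ▸ trivial
    have := memT.1 this ⟨0, hk0⟩
    simp [hφ] at this
  · intro D'' hD''
    obtain ⟨g, σ, hσ, g1, g2, gR, gS, gN⟩ : ∃ (g : T ≃ₗ[F] D''.V) (σ : F), (σ = 1 ∨ σ = -1) ∧
      (∀ u : T, u.1 ∈ D.S → ∀ v : T, D''.β (g u) (g v) = D.β u.1 v.1) ∧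
      (∀ u : T, u.1 ∈ D.S → D''.f (g u) = σ * D.f u.1) ∧
      (∀ x : T, x.1 ∈ D.R ↔ g x ∈ D''.R) ∧ (∀ x : T, x.1 ∈ D.S ↔ g x ∈ D''.S) ∧
      ∀ x : T, x.1 ∈ D.N ↔ g x ∈ D''.N := hD''
    have hb' : ∀ i j, ∃ s, p i ∈ D.S → D.β (p i) (p j) = sval F s := fun i j => by
      by_cases h : p i ∈ D.S
      · obtain ⟨s, hs⟩ := hb i h j
        exact ⟨s, fun _ => hs⟩
      · exact ⟨0, fun h' => absurd h' h⟩
    have hf' : ∀ i, ∃ s, sval F s = if p i ∈ D.S then σ * D.f (p i) else 0 := fun i => by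
      by_cases h : p i ∈ D.S
      · obtain ⟨s, hs⟩ := hf i h
        rcases hσ with rfl | rfl
        · exact ⟨s, by simp [h, hs]⟩
        · obtain ⟨s', hs'⟩ := sval_neg (F := F) s
          exact ⟨s', by simp [h, hs, hs']⟩
      · exact ⟨0, by simp [h, sval]⟩
    choose b hb using hb'
    choose fv hfv using hf'
    let P : SpParam := ⟨⟨k, hk⟩, (fun i => decide (p i ∈ D.R), fun i => decide (p i ∈ D.S),
      fun i => decide (p i ∈ D.N)), b, fv⟩
    let G : D.V ≃ₗ[F] (Fin k → F) × D''.V :=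
      { toFun := fun x => (fun i => φ i x, g ⟨q x, hqT x⟩)
        map_add' := fun x y => by
          refine Prod.ext (by funext i; simp) ?_
          change g _ = g _ + g _
          rw [← map_add]
          exact congrArg g (Subtype.ext (map_add q x y))
        map_smul' := fun a x => by
          refine Prod.ext (by funext i; simp) ?_
          change g _ = a • g _
          rw [← map_smul]
          exact congrArg g (Subtype.ext (map_smul q a x))
        invFun := fun y => (g.symm y.2 : T).1 + ∑ i, y.1 i • p i
        left_inv := fun x => by simp [hqa]
        right_inv := fun y => by
          have h0 := memT.1 (g.symm y.2 : T).2
          have h1 : ∀ i, φ i ((g.symm y.2 : T).1 + ∑ i, y.1 i • p i) = y.1 i := fun i => by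
            simp [h0, hφ]
          refine Prod.ext (funext h1) ?_
          have : (⟨q ((g.symm y.2 : T).1 + ∑ i, y.1 i • p i), hqT _⟩ : T) = g.symm y.2 :=
            Subtype.ext (by change q _ = _; rw [hqa]; simp only [h1]; simp)
          change g _ = _
          rw [this, LinearEquiv.apply_symm_apply] }
    refine ⟨P, G, σ, hσ, ?_, ?_, ?_, ?_, ?_⟩
    · intro u hu v
      have hu' := (hmem _ hS u).1 hu
      change ∑ i, ∑ j, φ i u * φ j v * sval F (b i j) +
        D''.β (g ⟨q u, hqT u⟩) (g ⟨q v, hqT v⟩) -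
          D''.f (g ⟨q u, hqT u⟩) * ∑ j, φ j v * sval F (fv j) = _
      have e1 : D''.β (g ⟨q u, hqT u⟩) (g ⟨q v, hqT v⟩) = D.β (q u) (q v) := g1 ⟨q u, hqT u⟩ hu'.1 _
      have e2 : D''.f (g ⟨q u, hqT u⟩) = σ * D.f (q u) := g2 ⟨q u, hqT u⟩ hu'.1
      have eu : u = q u + ∑ i, φ i u • p i := by rw [hqa, sub_add_cancel]
      have ev : v = q v + ∑ i, φ i v • p i := by rw [hqa, sub_add_cancel]
      have hσσ : σ * σ = 1 := by rcases hσ with rfl | rfl <;> ring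
      have e3 : D.β u v = D.β (q u) (q v) + ∑ j, φ j v * D.β (q u) (p j) +
          ∑ i, φ i u * D.β (p i) (q v) + ∑ i, ∑ j, φ i u * φ j v * D.β (p i) (p j) := by
        conv_lhs => rw [eu, ev]
        simp only [map_add, LinearMap.add_apply, map_sum, LinearMap.sum_apply, map_smul,
          LinearMap.smul_apply, smul_eq_mul]
        simp only [mul_add, Finset.sum_add_distrib, Finset.mul_sum]
        have : ∑ i, ∑ j, φ j v * (φ i u * D.β (p i) (p j)) =
            ∑ i, ∑ j, φ i u * φ j v * D.β (p i) (p j) :=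
          Finset.sum_congr rfl fun i _ => Finset.sum_congr rfl fun j _ => by ring
        rw [Finset.sum_comm] at this
        linear_combination this
      rw [e3]
      simp only [e1, e2]
      have e4 : ∑ i, φ i u * D.β (p i) (q v) = 0 := Finset.sum_eq_zero fun i _ => by
        by_cases hi : p i ∈ D.S
        · simp [hc i hi _ (memT.1 (hqT v))]
        · simp [hu'.2 i hi]
      have e5 : ∑ i, ∑ j, φ i u * φ j v * sval F (b i j) =
          ∑ i, ∑ j, φ i u * φ j v * D.β (p i) (p j) := by
        refine Finset.sum_congr rfl fun i _ => Finset.sum_congr rfl fun j _ => ?_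
        by_cases hi : p i ∈ D.S
        · rw [hb i j hi]
        · simp [hu'.2 i hi]
      have e6 : ∑ j, φ j v * D.β (q u) (p j) = -(σ * D.f (q u) * ∑ j, φ j v * sval F (fv j)) := by
        rw [Finset.mul_sum, ← Finset.sum_neg_distrib]
        refine Finset.sum_congr rfl fun j _ => ?_
        rw [hfv]
        split_ifs with hj
        · have h1 := hD.skew _ hj _ hu'.1
          rw [hc j hj _ (memT.1 (hqT u)), zero_add] at h1
          linear_combination φ j v * h1 + φ j v * D.f (q u) * D.f (p j) * hσσ
        · simp [hd j hj _ hu'.1 (memT.1 (hqT u))]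
      change ∑ i, ∑ j, φ i u * φ j v * sval F (b i j) + D.β (q u) (q v) -
        σ * D.f (q u) * ∑ j, φ j v * sval F (fv j) = _
      rw [e4, e5, e6]
      ring
    · intro u hu
      have hu' := (hmem _ hS u).1 hu
      refine (sp_f D'' P (G u)).trans ?_
      have e2 : D''.f (g ⟨q u, hqT u⟩) = σ * D.f (q u) := g2 ⟨q u, hqT u⟩ hu'.1
      have eu : D.f u = D.f (q u) + ∑ i, φ i u * D.f (p i) := by
        conv_lhs => rw [show u = q u + ∑ i, φ i u • p i by rw [hqa, sub_add_cancel]]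
        simp
      change ∑ j, sval F (fv j) * φ j u + D''.f (g ⟨q u, hqT u⟩) = _
      rw [e2, eu, mul_add, add_comm, Finset.mul_sum]
      congr 1
      refine Finset.sum_congr rfl fun j _ => ?_
      rw [hfv]
      split_ifs with hj
      · ring
      · simp [hu'.2 j hj]
    · intro x
      rw [hmem _ hR x]
      refine and_congr (gR ⟨q x, hqT x⟩) (forall_congr' fun i => ?_)
      change _ ↔ (decide (p i ∈ D.R) = false → φ i x = 0)
      simp
    · intro x
      rw [hmem _ hS x]
      refine and_congr (gS ⟨q x, hqT x⟩) (forall_congr' fun i => ?_)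
      change _ ↔ (decide (p i ∈ D.S) = false → φ i x = 0)
      simp
    · intro x
      rw [hmem _ hN x]
      refine and_congr (gN ⟨q x, hqT x⟩) (forall_congr' fun i => ?_)
      change _ ↔ (decide (p i ∈ D.N) = false → φ i x = 0)
      simp

end Dat

namespace Dat

variable {F : Type u} [Field F]

theorem Valid.splits_scaled {D : Dat F} (hD : Valid D) {k : ℕ} (hk : k < 5) (hk0 : 0 < k)
    (a : Fin k → F) (ha : ∀ i, a i ≠ 0)
    (p : Fin k → D.V) (φ : Fin k → D.V →ₗ[F] F) (hφ : ∀ i j, φ i (p j) = if i = j then 1 else 0)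
    (hR : ∀ i, p i ∉ D.R → ∀ u ∈ D.R, φ i u = 0) (hS : ∀ i, p i ∉ D.S → ∀ u ∈ D.S, φ i u = 0)
    (hN : ∀ i, p i ∉ D.N → ∀ u ∈ D.N, φ i u = 0)
    (hc : ∀ i, p i ∈ D.S → ∀ m, (∀ j, φ j m = 0) → D.β (p i) m = 0)
    (hd : ∀ i, p i ∉ D.S → ∀ m ∈ D.S, (∀ j, φ j m = 0) → D.β m (p i) = 0)
    (hb : ∀ i, p i ∈ D.S → ∀ j, ∃ s, a i * a j * D.β (p i) (p j) = sval F s)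
    (hf : ∀ i, p i ∈ D.S → ∃ s, a i * D.f (p i) = sval F s) : Splits D := by
  have mem : ∀ (U : Submodule F D.V) i, a i • p i ∈ U ↔ p i ∈ U := fun U i =>
    U.smul_mem_iff (ha i)
  have z : ∀ m, (∀ j, ((a j)⁻¹ • φ j) m = 0) → ∀ j, φ j m = 0 := fun m hm j => by
    have := hm j
    rw [LinearMap.smul_apply, smul_eq_mul] at this
    exact (mul_eq_zero.1 this).resolve_left (inv_ne_zero (ha j))
  refine hD.splits hk hk0 (fun i => a i • p i) (fun i => (a i)⁻¹ • φ i) ?_ ?_ ?_ ?_ ?_ ?_ ?_ ?_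
  · intro i j
    simp only [LinearMap.smul_apply, map_smul, hφ, smul_eq_mul]
    split_ifs with h
    · subst h
      rw [mul_one, mul_inv_cancel₀ (ha i)]
    · ring
  · intro i hi u hu
    simp [hR i (fun h => hi ((mem _ i).2 h)) u hu]
  · intro i hi u hu
    simp [hS i (fun h => hi ((mem _ i).2 h)) u hu]
  · intro i hi u hu
    simp [hN i (fun h => hi ((mem _ i).2 h)) u hu]
  · intro i hi m hm
    simp [hc i ((mem _ i).1 hi) m (z m hm)]
  · intro i hi m hmS hm
    simp [hd i (fun h => hi ((mem _ i).2 h)) m hmS (z m hm)]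
  · intro i hi j
    obtain ⟨s, hs⟩ := hb i ((mem _ i).1 hi) j
    exact ⟨s, by simp [← hs]; ring⟩
  · intro i hi
    obtain ⟨s, hs⟩ := hf i ((mem _ i).1 hi)
    exact ⟨s, by simp [← hs]⟩

theorem sval_zero : ∃ s, (0 : F) = sval F s := ⟨0, rfl⟩
theorem sval_one : ∃ s, (1 : F) = sval F s := ⟨1, rfl⟩
theorem sval_neg_one : ∃ s, (-1 : F) = sval F s := ⟨2, rfl⟩

theorem Valid.skewR {D : Dat F} (hD : Valid D) {r u : D.V} (hr : r ∈ D.R) (hu : u ∈ D.S) :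
    D.β u r = -D.β r u := by
  have := hD.skew _ hu _ (hD.RS hr)
  rw [hD.fR r hr] at this
  linear_combination this

theorem Valid.splits_inf {D : Dat F} (hD : Valid D) {e : D.V} (he : e ∈ D.R) (he0 : e ≠ 0)
    (hg : D.β e = 0) : Splits D := by
  have : ∃ φ : D.V →ₗ[F] F, φ e = 1 ∧ (e ∉ D.N → ∀ n ∈ D.N, φ n = 0) := by
    by_cases h : e ∈ D.N
    · obtain ⟨φ, h1, -⟩ := exists_functional (⊥ : Submodule F D.V) (x := e) (by simpa using he0)
      exact ⟨φ, h1, fun h' => absurd h h'⟩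
    · obtain ⟨φ, h1, h2⟩ := exists_functional D.N h
      exact ⟨φ, h1, fun _ => h2⟩
  obtain ⟨φ, h1, h2⟩ := this
  refine hD.splits (k := 1) (by norm_num) one_pos (fun _ => e) (fun _ => φ) ?_
    (fun _ h => absurd he h) (fun _ h => absurd (hD.RS he) h) (fun _ => h2) ?_
    (fun _ h => absurd (hD.RS he) h) ?_ ?_
  · intro i j
    simp [h1, Subsingleton.elim i j]
  · intro i _ m _
    simp [hg]
  · intro i _ j
    exact ⟨0, by simp [hg, sval]⟩
  · intro i _
    exact ⟨0, by simp [hD.fR e he, sval]⟩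

theorem Valid.splits_pair_right {D : Dat F} (hD : Valid D) {e : D.V} (he : e ∈ D.R) (hg : D.β e ≠ 0)
    (hgS : ∀ u ∈ D.S, D.β e u = 0) : Splits D := by
  have heN : e ∉ D.N := fun h => hg (by
    rw [hD.nd e h fun u hu => by rw [hD.skewR he hu, hgS u hu, neg_zero], map_zero])
  obtain ⟨ψ, ψe, ψN⟩ := exists_functional (D.N ⊓ D.S) (x := e) fun h => heN h.1
  obtain ⟨x, -, hx⟩ := exists_rep D.β.flip ⊤ (Submodule.span F {e} ⊔ (D.N ⊓ D.S)) ψ (by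
    intro v hv h
    obtain ⟨a, ha, n, ⟨hnN, hnS⟩, rfl⟩ := Submodule.mem_sup.1 hv
    obtain ⟨a, rfl⟩ := Submodule.mem_span_singleton.1 ha
    have h' : ∀ l, a * D.β e l + D.β n l = 0 := fun l => by simpa using h l trivial
    have hnv : ∀ v ∈ D.S, D.β n v = 0 := fun v hv => by
      have := h' v
      rwa [hgS v hv, mul_zero, zero_add] at this
    have hfn : D.f n = 0 := by
      have := hD.skew n hnS n hnS
      rw [hnv n hnS, zero_add, zero_add] at this
      exact mul_self_eq_zero.1 this
    have hn0 : n = 0 := hD.nd n hnN fun u hu => by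
      have := hD.skew u hu n hnS
      rw [hnv u hu, hfn] at this
      linear_combination this
    have : a = 0 := by
      by_contra ha0
      refine hg (LinearMap.ext fun l => ?_)
      have := h' l
      rw [hn0, map_zero, LinearMap.zero_apply, add_zero] at this
      exact (mul_eq_zero.1 this).resolve_left ha0
    simp [this, hn0])
  have hx1 : D.β e x = 1 := by
    rw [← ψe]
    exact hx e (Submodule.mem_sup_left (Submodule.mem_span_singleton_self e))
  have hxN : ∀ n ∈ D.N, n ∈ D.S → D.β n x = 0 := fun n h1 h2 => by
    rw [← ψN n ⟨h1, h2⟩]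
    exact hx n (Submodule.mem_sup_right ⟨h1, h2⟩)
  have hxS : x ∉ D.S := fun h => by simp [hgS x h] at hx1
  have hxN' : x ∉ D.N := fun h => by simp [hD.RN e he x h] at hx1
  obtain ⟨χ, χS, χN⟩ := exists_glue D.S (D.N ⊔ Submodule.span F {x}) (D.β.flip x) 0 (by
    intro v hv hv'
    obtain ⟨n, hn, b, hb, rfl⟩ := Submodule.mem_sup.1 hv'
    obtain ⟨b, rfl⟩ := Submodule.mem_span_singleton.1 hb
    have := hgS _ hv
    rw [map_add, hD.RN e he n hn, map_smul, hx1, smul_eq_mul, mul_one, zero_add] at this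
    subst this
    rw [zero_smul, add_zero] at hv ⊢
    simpa using hxN n hn hv)
  have χx : χ x = 0 := χN x (Submodule.mem_sup_right (Submodule.mem_span_singleton_self x))
  have χN' : ∀ n ∈ D.N, χ n = 0 := fun n hn => χN n (Submodule.mem_sup_left hn)
  have heS := hD.RS he
  have χe : χ e = 1 := by rw [χS e heS]; exact hx1
  have hee := hgS e heS
  refine hD.splits (k := 2) (by norm_num) two_pos ![e, x] ![χ, D.β e] ?_ ?_ ?_ ?_ ?_ ?_ ?_ ?_
  · simp [Fin.forall_fin_two, χe, χx, hx1, hee]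
  · simp only [Fin.forall_fin_two]
    exact ⟨fun h => absurd he h, fun _ u hu => hgS u (hD.RS hu)⟩
  · simp only [Fin.forall_fin_two]
    exact ⟨fun h => absurd heS h, fun _ => hgS⟩
  · simp only [Fin.forall_fin_two]
    exact ⟨fun _ => χN', fun _ => hD.RN e he⟩
  · simp only [Fin.forall_fin_two]
    exact ⟨fun _ m hm => hm.2, fun h => absurd h hxS⟩
  · simp only [Fin.forall_fin_two]
    exact ⟨fun h => absurd heS h, fun _ m hm h => (χS m hm).symm.trans h.1⟩
  · simp only [Fin.forall_fin_two]
    refine ⟨fun _ => ⟨?_, ?_⟩, fun h => absurd h hxS⟩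
    · change ∃ s, D.β e e = _
      exact hee ▸ sval_zero
    · change ∃ s, D.β e x = _
      exact hx1 ▸ sval_one
  · simp only [Fin.forall_fin_two]
    refine ⟨fun _ => ?_, fun h => absurd h hxS⟩
    change ∃ s, D.f e = _
    exact hD.fR e he ▸ sval_zero

/-- Modify `x` to make it orthogonal to the part of `N` killed by `φ`. -/
theorem Valid.exists_modify {D : Dat F} (hD : Valid D) {e x y : D.V} (T : Submodule F D.V)
    (hx : x ∈ D.S)
    (h1 : D.β e x = 1) (hT : T ≤ D.N) (hy : y ∈ D.N)
    (hSy : ∀ u ∈ D.S, D.β u y = -D.β e u) (hyT : ∀ a : F, a • y ∈ T → a = 0) :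
    ∃ x' ∈ D.S, D.β e x' = 1 ∧ ∀ n ∈ T, D.β x' n = 0 := by
  obtain ⟨h, ⟨hS, he'⟩, hh⟩ := exists_rep D.β (D.S ⊓ LinearMap.ker (D.β e)) T (-D.β x) (by
    intro n hn h
    set a := D.β x n with ha
    have hxy : D.β x y = -1 := by rw [hSy x hx, h1]
    have : n + a • y = 0 := hD.nd _ (D.N.add_mem (hT hn) (D.N.smul_mem _ hy)) fun u hu => by
      have hu' := h (u - D.β e u • x) ⟨D.S.sub_mem hu (D.S.smul_mem _ hx), by simp [h1]⟩
      rw [map_sub, LinearMap.sub_apply, map_smul, LinearMap.smul_apply, smul_eq_mul] at hu'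
      rw [map_add, map_smul, hSy u hu, smul_eq_mul]
      linear_combination hu' + D.β e u * ha
    have ha0 := hyT (-a) (by
      rw [neg_smul, ← eq_neg_of_add_eq_zero_left this]
      exact hn)
    rw [LinearMap.neg_apply, ← ha, ha0])
  refine ⟨x + h, D.S.add_mem hx hS, ?_, fun n hn => ?_⟩
  · rw [map_add, h1, show D.β e h = 0 from he', add_zero]
  · rw [map_add, LinearMap.add_apply, hh n hn, LinearMap.neg_apply, add_neg_cancel]

theorem Valid.self_zero {D : Dat F} (hD : Valid D) (h2 : (2 : F) ≠ 0) {u : D.V} (hu : u ∈ D.S)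
    (hf : D.f u = 0) : D.β u u = 0 := by
  have := hD.skew _ hu _ hu
  rw [hf] at this
  exact (mul_eq_zero.1 (show (2 : F) * D.β u u = 0 by linear_combination this)).resolve_left h2

theorem Valid.exists_scale {D : Dat F} (hD : Valid D) (h2 : (2 : F) ≠ 0) {x : D.V} (hx : x ∈ D.S) :
    ∃ l : F, l ≠ 0 ∧
    (∃ s, l * D.f x = sval F s) ∧ ∃ s, l * l * D.β x x = sval F s := by
  have h := hD.skew _ hx _ hx
  by_cases h0 : D.f x = 0
  · exact ⟨1, one_ne_zero, ⟨0, by simp [h0, sval]⟩, ⟨0, by simp [hD.self_zero h2 hx h0, sval]⟩⟩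
  · refine ⟨(D.f x)⁻¹, inv_ne_zero h0, ⟨1, by simp [h0, sval]⟩, ⟨4, ?_⟩⟩
    change _ = -1 / 2
    field_simp
    linear_combination h

theorem Valid.splits_pair_R {D : Dat F} (hD : Valid D) (h2 : (2 : F) ≠ 0) {e x : D.V}
    (he : e ∈ D.R) (hx : x ∈ D.R) (h1 : D.β e x = 1) :
    Splits D := by
  have heS := hD.RS he
  have hxS := hD.RS hx
  have hee := hD.self_zero h2 heS (hD.fR e he)
  have hxx := hD.self_zero h2 hxS (hD.fR x hx)
  have hxe : D.β x e = -1 := by rw [hD.skewR he hxS, h1]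
  refine hD.splits (k := 2) (by norm_num) two_pos ![e, x] ![-D.β x, D.β e] ?_ ?_ ?_ ?_ ?_ ?_ ?_ ?_
  · simp [Fin.forall_fin_two, hxe, hxx, h1, hee]
  · simp only [Fin.forall_fin_two]
    exact ⟨fun h => absurd he h, fun h => absurd hx h⟩
  · simp only [Fin.forall_fin_two]
    exact ⟨fun h => absurd heS h, fun h => absurd hxS h⟩
  · simp only [Fin.forall_fin_two]
    exact ⟨fun _ n hn => by simp [hD.RN x hx n hn], fun _ => hD.RN e he⟩
  · simp only [Fin.forall_fin_two]
    exact ⟨fun _ m hm => hm.2, fun _ m hm => neg_eq_zero.1 hm.1⟩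
  · simp only [Fin.forall_fin_two]
    exact ⟨fun h => absurd heS h, fun h => absurd hxS h⟩
  · simp only [Fin.forall_fin_two]
    refine ⟨fun _ => ⟨?_, ?_⟩, fun _ => ⟨?_, ?_⟩⟩
    · change ∃ s, D.β e e = _
      exact hee ▸ sval_zero
    · change ∃ s, D.β e x = _
      exact h1 ▸ sval_one
    · change ∃ s, D.β x e = _
      exact hxe ▸ sval_neg_one
    · change ∃ s, D.β x x = _
      exact hxx ▸ sval_zero
  · simp only [Fin.forall_fin_two]
    refine ⟨fun _ => ?_, fun _ => ?_⟩
    · change ∃ s, D.f e = _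
      exact hD.fR e he ▸ sval_zero
    · change ∃ s, D.f x = _
      exact hD.fR x hx ▸ sval_zero

theorem Valid.splits_pair {D : Dat F} (hD : Valid D) (h2 : (2 : F) ≠ 0) {e x : D.V} (he : e ∈ D.R)
    (hx : x ∈ D.S) (h1 : D.β e x = 1)
    (hRR : ∀ r ∈ D.R, ∀ r' ∈ D.R, D.β r r' = 0) (hN : e ∈ D.N ∨ ∀ n ∈ D.N, D.β x n = 0) :
    Splits D := by
  have heS := hD.RS he
  have hee := hD.self_zero h2 heS (hD.fR e he)
  have hxe : D.β x e = -1 := by rw [hD.skewR he hx, h1]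
  obtain ⟨l, hl, hl1, hl2⟩ := hD.exists_scale h2 hx
  have hxN : x ∉ D.N := fun h => by simp [hD.RN e he x h] at h1
  have hxR : x ∉ D.R := fun h => by simp [hRR e he x h] at h1
  refine hD.splits_scaled (k := 2) (by norm_num) two_pos ![l⁻¹, l]
      (by simp [Fin.forall_fin_two, hl])
    ![e, x] ![-D.β x + D.β x x • D.β e, D.β e] ?_ ?_ ?_ ?_ ?_ ?_ ?_ ?_
  · simp [Fin.forall_fin_two, hxe, h1, hee]
  · simp only [Fin.forall_fin_two]
    exact ⟨fun h => absurd he h, fun _ => hRR e he⟩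
  · simp only [Fin.forall_fin_two]
    exact ⟨fun h => absurd heS h, fun h => absurd hx h⟩
  · simp only [Fin.forall_fin_two]
    exact ⟨fun h n hn => by simp [hN.resolve_left h n hn, hD.RN e he n hn], fun _ => hD.RN e he⟩
  · simp only [Fin.forall_fin_two]
    exact ⟨fun _ m hm => hm.2, fun _ m hm => by simpa [show D.β e m = 0 from hm.2] using hm.1⟩
  · simp only [Fin.forall_fin_two]
    exact ⟨fun h => absurd heS h, fun h => absurd hx h⟩
  · simp only [Fin.forall_fin_two]
    refine ⟨fun _ => ⟨?_, ?_⟩, fun _ => ⟨?_, hl2⟩⟩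
    · change ∃ s, l⁻¹ * l⁻¹ * D.β e e = _
      rw [hee, mul_zero]
      exact sval_zero
    · change ∃ s, l⁻¹ * l * D.β e x = _
      rw [h1, inv_mul_cancel₀ hl, one_mul]
      exact sval_one
    · change ∃ s, l * l⁻¹ * D.β x e = _
      rw [hxe, mul_inv_cancel₀ hl, one_mul]
      exact sval_neg_one
  · simp only [Fin.forall_fin_two]
    refine ⟨fun _ => ?_, fun _ => hl1⟩
    change ∃ s, _ * D.f e = _
    rw [hD.fR e he, mul_zero]
    exact sval_zero

theorem Valid.splits_triple {D : Dat F} (hD : Valid D) (h2 : (2 : F) ≠ 0) {e x y : D.V}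
    {φ : D.V →ₗ[F] F} (he : e ∈ D.R) (hx : x ∈ D.S)
    (hy : y ∈ D.N) (h1 : D.β e x = 1) (hRR : ∀ r ∈ D.R, ∀ r' ∈ D.R, D.β r r' = 0)
    (φy : φ y = 1) (φx : φ x = 0) (φR : ∀ r ∈ D.R, φ r = 0)
    (hSy : ∀ u ∈ D.S, D.β u y = -D.β e u) (hxn : ∀ n ∈ D.N, φ n = 0 → D.β x n = 0)
    (h : (y ∉ D.S ∧ ∀ u ∈ D.S, φ u = 0) ∨ (y ∈ D.S ∧ D.β y = D.β e)) : Splits D := by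
  have heS := hD.RS he
  have hee := hD.self_zero h2 heS (hD.fR e he)
  have hxe : D.β x e = -1 := by rw [hD.skewR he hx, h1]
  have hxy : D.β x y = -1 := by rw [hSy x hx, h1]
  have hey : D.β e y = 0 := hD.RN e he y hy
  obtain ⟨l, hl, hl1, hl2⟩ := hD.exists_scale h2 hx
  have hxN : x ∉ D.N := fun h => by simp [hD.RN e he x h] at h1
  have hxR : x ∉ D.R := fun h => by simp [hRR e he x h] at h1
  have hN : ∀ n ∈ D.N, D.β x n = -φ n := fun n hn => by
    have := hxn (n - φ n • y) (D.N.sub_mem hn (D.N.smul_mem _ hy)) (by simp [φy])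
    rw [map_sub, map_smul, hxy, smul_eq_mul] at this
    linear_combination this
  have hfy : y ∈ D.S → D.f y = 0 := fun hyS => by
    have := hD.skew y hyS y hyS
    rw [hSy y hyS, hey] at this
    simpa using this
  refine hD.splits_scaled (k := 3) (by norm_num) (by norm_num) ![l, l⁻¹, l⁻¹]
    (by simp [Fin.forall_fin_succ, hl])
    ![x, y, e] ![D.β e, φ, -D.β x + D.β x x • D.β e - φ] ?_ ?_ ?_ ?_ ?_ ?_ ?_ ?_
  · simp [Fin.forall_fin_succ, hxe, h1, hee, hxy, hey, φy, φx, φR e he]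
  · simp only [Fin.forall_fin_succ, IsEmpty.forall_iff, and_true]
    exact ⟨fun _ => hRR e he, fun _ => φR, fun h => absurd he h⟩
  · simp only [Fin.forall_fin_succ, IsEmpty.forall_iff, and_true]
    exact ⟨fun h => absurd hx h, fun hy' => (h.resolve_right fun h => hy' h.1).2,
      fun h => absurd heS h⟩
  · simp only [Fin.forall_fin_succ, IsEmpty.forall_iff, and_true]
    exact ⟨fun _ => hD.RN e he, fun h => absurd hy h,
      fun _ n hn => by simp [hD.RN e he n hn, hN n hn]⟩
  · simp only [Fin.forall_fin_succ, IsEmpty.forall_iff, and_true]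
    refine ⟨fun _ m hm => ?_, fun hy' m hm => ?_, fun _ m hm => hm.1⟩
    · obtain ⟨hm1, hm2, hm3⟩ := hm
      simpa [show D.β e m = 0 from hm1, show φ m = 0 from hm2] using hm3
    · change D.β y m = 0
      rw [(h.resolve_left fun h => h.1 hy').2]
      exact hm.1
  · simp only [Fin.forall_fin_succ, IsEmpty.forall_iff, and_true]
    refine ⟨fun h => absurd hx h, fun _ m hmS hm => ?_, fun h => absurd heS h⟩
    change D.β m y = 0
    rw [hSy m hmS, show D.β e m = 0 from hm.1, neg_zero]
  · have hyy : y ∈ D.S → D.β y x = 1 ∧ D.β y y = 0 ∧ D.β y e = 0 := fun hy' => by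
      rw [(h.resolve_left fun h => h.1 hy').2]
      exact ⟨h1, hey, hee⟩
    simp only [Fin.forall_fin_succ, IsEmpty.forall_iff, and_true]
    refine ⟨fun _ => ⟨hl2, ?_, ?_⟩, fun hy' => ⟨?_, ?_, ?_⟩, fun _ => ⟨?_, ?_, ?_⟩⟩
    · change ∃ s, l * l⁻¹ * D.β x y = _
      rw [hxy, mul_inv_cancel₀ hl, one_mul]
      exact sval_neg_one
    · change ∃ s, l * l⁻¹ * D.β x e = _
      rw [hxe, mul_inv_cancel₀ hl, one_mul]
      exact sval_neg_one
    · change ∃ s, l⁻¹ * l * D.β y x = _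
      rw [(hyy hy').1, inv_mul_cancel₀ hl, one_mul]
      exact sval_one
    · change ∃ s, l⁻¹ * l⁻¹ * D.β y y = _
      rw [(hyy hy').2.1, mul_zero]
      exact sval_zero
    · change ∃ s, l⁻¹ * l⁻¹ * D.β y e = _
      rw [(hyy hy').2.2, mul_zero]
      exact sval_zero
    · change ∃ s, l⁻¹ * l * D.β e x = _
      rw [h1, inv_mul_cancel₀ hl, one_mul]
      exact sval_one
    · change ∃ s, l⁻¹ * l⁻¹ * D.β e y = _
      rw [hey, mul_zero]
      exact sval_zero
    · change ∃ s, l⁻¹ * l⁻¹ * D.β e e = _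
      rw [hee, mul_zero]
      exact sval_zero
  · simp only [Fin.forall_fin_succ, IsEmpty.forall_iff, and_true]
    refine ⟨fun _ => hl1, fun hy' => ?_, fun _ => ?_⟩
    · change ∃ s, _ * D.f y = _
      rw [hfy hy', mul_zero]
      exact sval_zero
    · change ∃ s, _ * D.f e = _
      rw [hD.fR e he, mul_zero]
      exact sval_zero

theorem Valid.splits_quad {D : Dat F} (hD : Valid D) (h2 : (2 : F) ≠ 0) {e x y w : D.V}
    {φ : D.V →ₗ[F] F} (he : e ∈ D.R) (hx : x ∈ D.S)
    (hy : y ∈ D.N) (hyS : y ∈ D.S) (h1 : D.β e x = 1) (hRR : ∀ r ∈ D.R, ∀ r' ∈ D.R, D.β r r' = 0)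
    (hSy : ∀ u ∈ D.S, D.β u y = -D.β e u) (hyw : D.β y w = 1) (hRw : ∀ r ∈ D.R, D.β r w = 0)
    (hw : w ∈ D.N ∨ ∀ n ∈ D.N, D.β y n = 0) (φS : ∀ u ∈ D.S, φ u = D.β u w) (φw : φ w = 0)
    (hxw : D.β x w = 0)
    (hxn : ∀ n ∈ D.N, φ n = 0 → (w ∈ D.N → D.β y n = 0) → D.β x n = 0) : Splits D := by
  have heS := hD.RS he
  have hee := hD.self_zero h2 heS (hD.fR e he)
  have hxe : D.β x e = -1 := by rw [hD.skewR he hx, h1]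
  have hxy : D.β x y = -1 := by rw [hSy x hx, h1]
  have hey : D.β e y = 0 := hD.RN e he y hy
  have hew : D.β e w = 0 := hRw e he
  have hyy : D.β y y = 0 := by rw [hSy y hyS, hey, neg_zero]
  have hfy : D.f y = 0 := by
    have := hD.skew y hyS y hyS
    rw [hyy] at this
    simpa using this
  have hys : ∀ u ∈ D.S, D.β y u = D.β e u := fun u hu => by
    have := hD.skew y hyS u hu
    rw [hfy, hSy u hu] at this
    linear_combination this
  have hyx : D.β y x = 1 := by rw [hys x hx, h1]
  have hye : D.β y e = 0 := by rw [hys e heS, hee]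
  have φx : φ x = 0 := by rw [φS x hx, hxw]
  have φy : φ y = 1 := by rw [φS y hyS, hyw]
  have φe : φ e = 0 := by rw [φS e heS, hew]
  obtain ⟨l, hl, hl1, hl2⟩ := hD.exists_scale h2 hx
  have hxN : x ∉ D.N := fun h => by simp [hD.RN e he x h] at h1
  have hxR : x ∉ D.R := fun h => by simp [hRR e he x h] at h1
  have hwS : w ∉ D.S := fun h => by simpa [hyw, hew] using hys w h
  have hN : ∀ n ∈ D.N, D.β x n = -φ n := fun n hn => by
    by_cases hwN : w ∈ D.N
    · have := hxn (n - φ n • y - D.β y n • w)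
        (D.N.sub_mem (D.N.sub_mem hn (D.N.smul_mem _ hy)) (D.N.smul_mem _ hwN)) (by simp [φy, φw])
        (fun _ => by simp [hyy, hyw])
      rw [map_sub, map_sub, map_smul, map_smul, hxy, hxw, smul_eq_mul, smul_eq_mul] at this
      linear_combination this
    · have := hxn (n - φ n • y) (D.N.sub_mem hn (D.N.smul_mem _ hy)) (by simp [φy])
        (fun h => absurd h hwN)
      rw [map_sub, map_smul, hxy, smul_eq_mul] at this
      linear_combination this
  refine hD.splits_scaled (k := 4) (by norm_num) (by norm_num) ![l, l, l⁻¹, l⁻¹]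
    (by simp [Fin.forall_fin_succ, hl])
    ![x, w, y, e] ![D.β e, D.β y - D.β e, φ, -D.β x + D.β x x • D.β e - φ] ?_ ?_ ?_ ?_ ?_ ?_ ?_ ?_
  · simp [Fin.forall_fin_succ, hxe, h1, hee, hxy, hey, φy, φx, φe, φw, hew, hyx, hyw, hyy, hye, hxw]
  · simp only [Fin.forall_fin_succ, IsEmpty.forall_iff, and_true]
    refine ⟨fun _ => hRR e he, fun _ u hu => ?_, fun _ u hu => ?_, fun h => absurd he h⟩
    · change D.β y u - D.β e u = 0
      rw [hys u (hD.RS hu), sub_self]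
    · change φ u = 0
      rw [φS u (hD.RS hu), hRw u hu]
  · simp only [Fin.forall_fin_succ, IsEmpty.forall_iff, and_true]
    refine ⟨fun h => absurd hx h, fun _ u hu => ?_, fun h => absurd hyS h, fun h => absurd heS h⟩
    change D.β y u - D.β e u = 0
    rw [hys u hu, sub_self]
  · simp only [Fin.forall_fin_succ, IsEmpty.forall_iff, and_true]
    refine ⟨fun _ => hD.RN e he, fun h n hn => ?_, fun h => absurd hy h,
      fun _ n hn => by simp [hD.RN e he n hn, hN n hn]⟩
    change D.β y n - D.β e n = 0
    rw [hw.resolve_left h n hn, hD.RN e he n hn, sub_self]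
  · simp only [Fin.forall_fin_succ, IsEmpty.forall_iff, and_true]
    refine ⟨fun _ m hm => ?_, fun h => absurd h hwS, fun hy' m hm => ?_, fun _ m hm => hm.1⟩
    · obtain ⟨hm1, -, hm2, hm3⟩ := hm
      simpa [show D.β e m = 0 from hm1, show φ m = 0 from hm2] using hm3
    · obtain ⟨hm1, hm2, -⟩ := hm
      have : D.β y m - D.β e m = 0 := hm2
      rwa [show D.β e m = 0 from hm1, sub_zero] at this
  · simp only [Fin.forall_fin_succ, IsEmpty.forall_iff, and_true]
    refine ⟨fun h => absurd hx h, fun _ m hmS hm => ?_, fun h => absurd hyS h,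
      fun h => absurd heS h⟩
    exact (φS m hmS).symm.trans hm.2.2.1
  · simp only [Fin.forall_fin_succ, IsEmpty.forall_iff, and_true]
    refine ⟨fun _ => ⟨hl2, ?_, ?_, ?_⟩, fun h => absurd h hwS, fun hy' => ⟨?_, ?_, ?_, ?_⟩,
      fun _ => ⟨?_, ?_, ?_, ?_⟩⟩
    · change ∃ s, l * l * D.β x w = _
      rw [hxw, mul_zero]
      exact sval_zero
    · change ∃ s, l * l⁻¹ * D.β x y = _
      rw [hxy, mul_inv_cancel₀ hl, one_mul]
      exact sval_neg_one
    · change ∃ s, l * l⁻¹ * D.β x e = _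
      rw [hxe, mul_inv_cancel₀ hl, one_mul]
      exact sval_neg_one
    · change ∃ s, l⁻¹ * l * D.β y x = _
      rw [hyx, inv_mul_cancel₀ hl, one_mul]
      exact sval_one
    · change ∃ s, l⁻¹ * l * D.β y w = _
      rw [hyw, inv_mul_cancel₀ hl, one_mul]
      exact sval_one
    · change ∃ s, l⁻¹ * l⁻¹ * D.β y y = _
      rw [hyy, mul_zero]
      exact sval_zero
    · change ∃ s, l⁻¹ * l⁻¹ * D.β y e = _
      rw [hye, mul_zero]
      exact sval_zero
    · change ∃ s, l⁻¹ * l * D.β e x = _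
      rw [h1, inv_mul_cancel₀ hl, one_mul]
      exact sval_one
    · change ∃ s, l⁻¹ * l * D.β e w = _
      rw [hew, mul_zero]
      exact sval_zero
    · change ∃ s, l⁻¹ * l⁻¹ * D.β e y = _
      rw [hey, mul_zero]
      exact sval_zero
    · change ∃ s, l⁻¹ * l⁻¹ * D.β e e = _
      rw [hee, mul_zero]
      exact sval_zero
  · simp only [Fin.forall_fin_succ, IsEmpty.forall_iff, and_true]
    refine ⟨fun _ => hl1, fun h => absurd h hwS, fun _ => ?_, fun _ => ?_⟩
    · change ∃ s, _ * D.f y = _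
      rw [hfy, mul_zero]
      exact sval_zero
    · change ∃ s, _ * D.f e = _
      rw [hD.fR e he, mul_zero]
      exact sval_zero

theorem Valid.splits_y {D : Dat F} (hD : Valid D) (h2 : (2 : F) ≠ 0) {e x y : D.V} (he : e ∈ D.R)
    (hx : x ∈ D.S)
    (hy : y ∈ D.N) (h1 : D.β e x = 1) (hRR : ∀ r ∈ D.R, ∀ r' ∈ D.R, D.β r r' = 0)
    (hRN : ∀ r ∈ D.R, r ∈ D.N → r = 0) (hSy : ∀ u ∈ D.S, D.β u y = -D.β e u) : Splits D := by
  classical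
  have hxy : D.β x y = -1 := by rw [hSy x hx, h1]
  have hy0 : y ≠ 0 := fun h => by simp [h] at hxy
  by_cases hyS : y ∈ D.S
  swap
  · obtain ⟨φ, φy, φS⟩ := exists_functional D.S hyS
    obtain ⟨x', hx', h1', h⟩ := hD.exists_modify (D.N ⊓ LinearMap.ker φ) hx h1 inf_le_left hy
      hSy (fun a ha => by simpa [φy] using ha.2)
    exact hD.splits_triple h2 he hx' hy h1' hRR φy (φS x' hx') (fun r hr => φS r (hD.RS hr)) hSy
      (fun n hn hn' => h n ⟨hn, hn'⟩) (Or.inl ⟨hyS, φS⟩)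
  have hyR : y ∉ D.R := fun h => hy0 (hRN y h hy)
  have hey : D.β e y = 0 := hD.RN e he y hy
  have hyy : D.β y y = 0 := by rw [hSy y hyS, hey, neg_zero]
  have hfy : D.f y = 0 := by
    have := hD.skew y hyS y hyS
    rw [hyy] at this
    simpa using this
  have hys : ∀ u ∈ D.S, D.β y u = D.β e u := fun u hu => by
    have := hD.skew y hyS u hu
    rw [hfy, hSy u hu] at this
    linear_combination this
  by_cases hr : ∃ r ∈ D.R, D.β y = D.β r
  · obtain ⟨r, hr, hyr⟩ := hr
    have hr1 : D.β r x = 1 := by rw [← hyr, hys x hx, h1]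
    have hSy' : ∀ u ∈ D.S, D.β u y = -D.β r u := fun u hu => by rw [← hyr, hys u hu, hSy u hu]
    obtain ⟨φ, φy, φR⟩ := exists_functional D.R hyR
    obtain ⟨x', hx', h1', h⟩ := hD.exists_modify (D.N ⊓ LinearMap.ker φ) hx hr1 inf_le_left hy
      hSy' (fun a ha => by simpa [φy] using ha.2)
    refine hD.splits_triple h2 (x := x' - φ x' • y) hr (D.S.sub_mem hx' (D.S.smul_mem _ hyS)) hy ?_
      hRR φy (by simp [φy]) φR hSy' (fun n hn hn' => ?_) (Or.inr ⟨hyS, hyr⟩)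
    · rw [map_sub, h1', map_smul, hD.RN r hr y hy, smul_zero, sub_zero]
    · rw [map_sub, LinearMap.sub_apply, h n ⟨hn, hn'⟩, map_smul, LinearMap.smul_apply, hyr,
        hD.RN r hr n hn, smul_zero, sub_zero]
  push Not at hr
  obtain ⟨w, hyw, hRw, hw⟩ : ∃ w, D.β y w = 1 ∧ (∀ r ∈ D.R, D.β r w = 0) ∧
      (w ∈ D.N ∨ ∀ n ∈ D.N, D.β y n = 0) := by
    by_cases h : ∀ n ∈ D.N, D.β y n = 0
    · obtain ⟨ψ, ψy, ψR⟩ := exists_functional D.R hyR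
      obtain ⟨w, -, hw⟩ := exists_rep D.β.flip ⊤ (D.R ⊔ Submodule.span F {y}) ψ (by
        intro v hv hl
        obtain ⟨r, hr', b, hb, rfl⟩ := Submodule.mem_sup.1 hv
        obtain ⟨b, rfl⟩ := Submodule.mem_span_singleton.1 hb
        by_cases hb0 : b = 0
        · simp [hb0, ψR r hr']
        · refine absurd (LinearMap.ext fun l => ?_) (hr (-b⁻¹ • r) (D.R.smul_mem _ hr'))
          have : D.β r l + b * D.β y l = 0 := by simpa using hl l trivial
          rw [map_smul, LinearMap.smul_apply, smul_eq_mul]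
          field_simp
          linear_combination this)
      refine ⟨w, ?_, fun r hr => ?_, Or.inr h⟩
      · rw [← ψy]
        exact hw y (Submodule.mem_sup_right (Submodule.mem_span_singleton_self y))
      · rw [← ψR r hr]
        exact hw r (Submodule.mem_sup_left hr)
    · push Not at h
      obtain ⟨n, hn, h⟩ := h
      exact ⟨(D.β y n)⁻¹ • n, by simp [h], fun r hr => by simp [hD.RN r hr n hn],
        Or.inl (D.N.smul_mem _ hn)⟩
  have hew := hRw e he
  have hwS : w ∉ D.S := fun h => by simpa [hyw, hew] using hys w h
  obtain ⟨φ, φS, φw⟩ := exists_glue D.S (Submodule.span F {w}) (D.β.flip w) 0 (by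
    intro v hv hv'
    obtain ⟨b, rfl⟩ := Submodule.mem_span_singleton.1 hv'
    by_cases hb : b = 0
    · simp [hb]
    · exact absurd ((D.S.smul_mem_iff hb).1 hv) hwS)
  have φS' : ∀ u ∈ D.S, φ u = D.β u w := φS
  obtain ⟨x', hx', h1', h⟩ := hD.exists_modify
    (D.N ⊓ LinearMap.ker φ ⊓ (if w ∈ D.N then LinearMap.ker (D.β y) else ⊤)) hx h1
    (inf_le_left.trans inf_le_left) hy hSy (fun a ha => by simpa [φS' y hyS, hyw] using ha.1.2)
  refine hD.splits_quad h2 (x := x' - D.β x' w • y) he (D.S.sub_mem hx' (D.S.smul_mem _ hyS)) hy hyS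
    ?_ hRR hSy hyw hRw hw φS' (φw w (Submodule.mem_span_singleton_self w)) ?_
        (fun n hn hn' hn2 => ?_)
  · rw [map_sub, map_smul, hey, h1', smul_zero, sub_zero]
  · simp [hyw]
  · have h0 : D.β y n = 0 := by
      by_cases hwN : w ∈ D.N
      · exact hn2 hwN
      · exact hw.resolve_left hwN n hn
    rw [map_sub, LinearMap.sub_apply, map_smul, LinearMap.smul_apply, h0, smul_zero, sub_zero]
    refine h n ⟨⟨hn, hn'⟩, ?_⟩
    split_ifs
    exacts [h0, trivial]

theorem Valid.splits_of_R {D : Dat F} (hD : Valid D) (h2 : (2 : F) ≠ 0) (hR : D.R ≠ ⊥) :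
    Splits D := by
  obtain ⟨e₀, he₀, he0⟩ := D.R.ne_bot_iff.1 hR
  by_cases hA : ∃ e ∈ D.R, e ≠ 0 ∧ D.β e = 0
  · obtain ⟨e, he, h0, h⟩ := hA
    exact hD.splits_inf he h0 h
  push Not at hA
  by_cases hB : ∃ e ∈ D.R, e ≠ 0 ∧ ∀ u ∈ D.S, D.β e u = 0
  · obtain ⟨e, he, h0, h⟩ := hB
    exact hD.splits_pair_right he (hA e he h0) h
  push Not at hB
  by_cases hRR : ∀ r ∈ D.R, ∀ r' ∈ D.R, D.β r r' = 0
  swap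
  · push Not at hRR
    obtain ⟨r, hr, r', hr', h⟩ := hRR
    exact hD.splits_pair_R h2 hr (D.R.smul_mem (D.β r r')⁻¹ hr') (by simp [h])
  by_cases hRN : ∀ r ∈ D.R, r ∈ D.N → r = 0
  swap
  · push Not at hRN
    obtain ⟨e, he, heN, h0⟩ := hRN
    obtain ⟨x, hx, h⟩ := hB e he h0
    exact hD.splits_pair h2 (x := (D.β e x)⁻¹ • x) he (D.S.smul_mem _ hx) (by simp [h]) hRR
      (Or.inl heN)
  obtain ⟨x₀, hx₀, h₀⟩ := hB e₀ he₀ he0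
  set x := (D.β e₀ x₀)⁻¹ • x₀ with hx_def
  have hx : x ∈ D.S := D.S.smul_mem _ hx₀
  have h1 : D.β e₀ x = 1 := by simp [hx_def, h₀]
  by_cases hY : ∃ y ∈ D.N, D.β x y ≠ 0 ∧ ∀ u ∈ D.S, D.β e₀ u = 0 → D.β u y = 0
  · obtain ⟨y, hy, hxy, h⟩ := hY
    refine hD.splits_y h2 (y := -(D.β x y)⁻¹ • y) he₀ hx (D.N.smul_mem _ hy) h1 hRR hRN
      fun u hu => ?_
    have := h (u - D.β e₀ u • x) (D.S.sub_mem hu (D.S.smul_mem _ hx)) (by simp [h1])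
    rw [map_sub, LinearMap.sub_apply, map_smul, LinearMap.smul_apply, smul_eq_mul] at this
    rw [map_smul, smul_eq_mul]
    field_simp
    linear_combination -this
  · push Not at hY
    obtain ⟨h, ⟨hS, he'⟩, hh⟩ := exists_rep D.β (D.S ⊓ LinearMap.ker (D.β e₀)) D.N (-D.β x) (by
      intro n hn h
      by_contra hne
      obtain ⟨u, hu, hu', hne'⟩ := hY n hn (by simpa using hne)
      exact hne' (h u ⟨hu, hu'⟩))
    refine hD.splits_pair h2 (x := x + h) he₀ (D.S.add_mem hx hS) ?_ hRR (Or.inr fun n hn => ?_)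
    · rw [map_add, h1, show D.β e₀ h = 0 from he', add_zero]
    · rw [map_add, LinearMap.add_apply, hh n hn, LinearMap.neg_apply, add_neg_cancel]

/-- Finiteness of the valid data reduces to the case `R = 0`. -/
theorem finD (h2 : (2 : F) ≠ 0) (M : ℕ)
    (h0 : FinD fun D : Dat F => Valid D ∧ D.R = ⊥ ∧ finrank F D.V < M) (m : ℕ) :
    FinD fun D : Dat F => Valid D ∧ finrank F D.V < M ∧ finrank F D.V < m := by
  induction m with
  | zero => exact ⟨∅, Set.finite_empty, fun D hD => absurd hD.2.2 (Nat.not_lt_zero _)⟩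
  | succ m ih =>
    obtain ⟨s, hs, hs'⟩ := h0
    obtain ⟨t, ht, ht'⟩ := ih
    refine ⟨s ∪ ⋃ d ∈ t, Set.range d.sp, hs.union (ht.biUnion fun d _ => Set.finite_range _), ?_⟩
    rintro D ⟨hD, hM, hm⟩
    by_cases hR : D.R = ⊥
    · obtain ⟨d, hd, h⟩ := hs' D ⟨hD, hR, hM⟩
      exact ⟨d, Or.inl hd, h⟩
    · obtain ⟨D', hD', hlt, h⟩ := hD.splits_of_R h2 hR
      obtain ⟨d, hd, hi⟩ := ht' D' ⟨hD', by omega, by omega⟩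
      obtain ⟨p, hp⟩ := h d hi
      exact ⟨_, Or.inr (Set.mem_biUnion hd ⟨p, rfl⟩), hp⟩

end Dat

/-- Linear version of `exists_rep`. -/
theorem exists_linear_rep {F : Type u} [Field F] {V : Type u} [AddCommGroup V] [Module F V]
    [FiniteDimensional F V] {W K : Type u} [AddCommGroup W] [Module F W] [AddCommGroup K]
    [Module F K] [FiniteDimensional F K] (B : W →ₗ[F] V →ₗ[F] F) (L : Submodule F W)
    (E : Submodule F V) (δ : V →ₗ[F] K) (h : ∀ e ∈ E, (∀ l ∈ L, B l e = 0) → δ e = 0) :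
    ∃ r : Dual F K →ₗ[F] W, (∀ φ, r φ ∈ L) ∧ ∀ φ, ∀ e ∈ E, B (r φ) e = φ (δ e) := by
  classical
  have key : ∀ φ : Dual F K, ∃ l ∈ L, ∀ e ∈ E, B l e = φ (δ e) := fun φ =>
    exists_rep B L E (φ.comp δ) fun e he h' => by simp [h e he h']
  choose l hl hl' using key
  let b := Module.finBasis F (Dual F K)
  have hr : ∀ φ, b.constr F (fun i => l (b i)) φ = ∑ i, b.repr φ i • l (b i) := fun φ =>
    b.constr_apply_fintype F _ φ
  refine ⟨b.constr F fun i => l (b i), fun φ => ?_, fun φ e he => ?_⟩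
  · rw [hr]
    exact Submodule.sum_mem _ fun i _ => Submodule.smul_mem _ _ (hl _)
  · rw [hr]
    conv_rhs => rw [← b.sum_repr φ]
    simp only [map_sum, map_smul, LinearMap.sum_apply, LinearMap.smul_apply, hl' _ e he]

/-- Maps into `K` given by their composites with the functionals on `K`. -/
theorem exists_double_dual {F : Type u} [Field F] {V K : Type u} [AddCommGroup V] [Module F V]
    [AddCommGroup K] [Module F K] [FiniteDimensional F K] (B : V →ₗ[F] Dual F K →ₗ[F] F) :
    ∃ s : V →ₗ[F] K, ∀ x φ, φ (s x) = B x φ := by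
  refine ⟨(Module.evalEquiv F K).symm.toLinearMap.comp B, fun x φ => ?_⟩
  simp

namespace Cfg

variable {F : Type u} [Field F]

/-- Finiteness transported along a relation. -/
theorem FinIso.rel {ι : Type} {Q : Cfg F ι → Prop} (hQ : FinIso Q) {X : Type*} {P : X → Prop}
    {r : X → X → Prop} (Rel : X → Cfg F ι → Prop) (h : ∀ x, P x → ∃ c, Q c ∧ Rel x c)
    (h' : ∀ x y c d, Rel x c → Rel y d → Iso c d → r x y) :
    ∃ s : Set X, s.Finite ∧ ∀ x, P x → ∃ d ∈ s, r x d := by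
  classical
  obtain ⟨s, hs, hs'⟩ := hQ
  let G : Cfg F ι → Set X := fun d =>
    if hd : ∃ x c, P x ∧ Rel x c ∧ Iso c d then {hd.choose} else ∅
  refine ⟨⋃ d ∈ s, G d, hs.biUnion fun d _ => ?_, fun x hx => ?_⟩
  · simp only [G]
    split_ifs <;> simp
  · obtain ⟨c, hc, hr⟩ := h x hx
    obtain ⟨d, hd, hi⟩ := hs' c hc
    have hex : ∃ x c, P x ∧ Rel x c ∧ Iso c d := ⟨x, c, hx, hr, hi⟩
    obtain ⟨c', -, hr', hi'⟩ := hex.choose_spec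
    refine ⟨hex.choose, Set.mem_biUnion hd ?_, h' x _ c c' hr hr' (hi.trans hi'.symm)⟩
    simp only [G, dif_pos hex, Set.mem_singleton_iff]

/-- The configurations left after splitting off the part of `L` orthogonal to `E`; the labels
`none`, `C false`, `C true` stand for subspaces `N`, `R`, `C`. -/
structure PW (c : Cfg F (Option (LE Bool))) : Prop where
  nd : Nondeg c.B
  L : IsMax c.B (c.sub (some .L))
  E : IsMax c.B (c.sub (some .E))
  LE : ∀ x ∈ c.sub (some .L), x ∈ c.sub (some .E) → x = 0
  NE : c.sub none ≤ c.sub (some .E)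
  RC : c.sub (some (.C false)) ≤ c.sub (some (.C true))
  C : Isot c.B (c.sub (some (.C true)))
  RN : ∀ x ∈ c.sub (some (.C false)), ∀ y ∈ c.sub none, c.B x y = 0
  LC : ∀ x ∈ c.sub (some .L), x ∈ c.sub (some (.C true)) → x = 0
  NC : ∀ x ∈ c.sub none, (∀ y ∈ c.sub (some (.C true)), c.B x y = 0) → x = 0

section Model

variable (W : Cfg F (Option (LE Bool))) (K : Type u) [AddCommGroup K] [Module F K]

/-- The hyperbolic form on `K × Dual K` plus `W`. -/
def dualForm : (K × Dual F K × W.V) →ₗ[F] (K × Dual F K × W.V) →ₗ[F] F :=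
  LinearMap.mk₂ F (fun p q => q.2.1 p.1 + p.2.1 q.1 + W.B p.2.2 q.2.2)
    (by intros; simp; ring) (by intros; simp; ring) (by intros; simp; ring)
    (by intros; simp; ring)

@[simp] theorem dualForm_apply (p q : K × Dual F K × W.V) :
    W.dualForm K p q = q.2.1 p.1 + p.2.1 q.1 + W.B p.2.2 q.2.2 := rfl

/-- The graph of a map on `S`. -/
def graphSub {W K : Type u} [AddCommGroup W] [Module F W] [AddCommGroup K] [Module F K]
    (S : Submodule F W) (ψ : W →ₗ[F] K) : Submodule F (K × Dual F K × W) where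
  carrier := {p | p.2.1 = 0 ∧ p.2.2 ∈ S ∧ p.1 = ψ p.2.2}
  add_mem' := by
    rintro p q ⟨h1, h2, h3⟩ ⟨h4, h5, h6⟩
    exact ⟨by simp [h1, h4], S.add_mem h2 h5, by simp [h3, h6]⟩
  zero_mem' := by simp
  smul_mem' := by
    rintro a p ⟨h1, h2, h3⟩
    exact ⟨by simp [h1], S.smul_mem a h2, by simp [h3]⟩

/-- The subspaces of `dualModel`. -/
def dualSub (ψ : W.V →ₗ[F] K) : LE Bool → Submodule F (K × Dual F K × W.V) :=
  LE.fn (Submodule.prod ⊤ (Submodule.prod ⊥ (W.sub (some .L)))) (graphSub (W.sub (some .E)) ψ)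
    fun k => Submodule.prod ⊥ (Submodule.prod ⊤ (W.sub (some (.C k))))

/-- The model of the configurations for which a subspace `K` of `L` orthogonal to `E` has been
split off. -/
abbrev dualModel [FiniteDimensional F K] (ψ : W.V →ₗ[F] K) : Cfg F (LE Bool) where
  V := K × Dual F K × W.V
  B := W.dualForm K
  symm x y := by simp [W.symm x.2.2]; ring
  sub := W.dualSub K ψ

variable {W K}

/-- The admissible gluing maps. -/
structure Glue (W : Cfg F (Option (LE Bool))) (ψ : W.V →ₗ[F] K) : Prop where
  surj : ∀ k, ∃ y ∈ W.sub (some .E), (∀ r ∈ W.sub (some (.C false)), W.B r y = 0) ∧ ψ y = k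
  ker : ∀ y ∈ W.sub (some .E), (∀ r ∈ W.sub (some (.C false)), W.B r y = 0) →
    (ψ y = 0 ↔ y ∈ W.sub none)

/-- Isomorphic gluings give isometric models. -/
theorem dualModel_congr {K' : Type u} [AddCommGroup K'] [Module F K'] [FiniteDimensional F K]
    [FiniteDimensional F K'] {W' : Cfg F (Option (LE Bool))} {ψ : W.V →ₗ[F] K}
    {ψ' : W'.V →ₗ[F] K'} {g : W.V ≃ₗ[F] W'.V} (h1 : ∀ x y, W'.B (g x) (g y) = W.B x y)
    (h2 : ∀ i x, x ∈ W.sub i ↔ g x ∈ W'.sub i) (k : K ≃ₗ[F] K')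
    (h3 : ∀ x, ψ' (g x) = k (ψ x)) : Iso (W.dualModel K ψ) (W'.dualModel K' ψ') := by
  refine ⟨k.prodCongr (k.symm.dualMap.prodCongr g), ?_, ?_⟩
  · intro x y
    simp [h1]
  · rintro (_ | _ | b) ⟨x, φ, w⟩
    · change (x ∈ (⊤ : Submodule F K) ∧ φ ∈ (⊥ : Submodule F (Dual F K)) ∧ w ∈ W.sub (some .L)) ↔
        (k x ∈ (⊤ : Submodule F K') ∧ k.symm.dualMap φ ∈ (⊥ : Submodule F (Dual F K')) ∧ g w ∈
            W'.sub (some .L))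
      rw [h2]
      simp
    · change (φ = 0 ∧ w ∈ _ ∧ x = ψ w) ↔ (k.symm.dualMap φ = 0 ∧ g w ∈ _ ∧ k x = ψ' (g w))
      rw [h2, h3]
      simp
    · change (x ∈ (⊥ : Submodule F K) ∧ φ ∈ (⊤ : Submodule F (Dual F K)) ∧ w ∈ W.sub (some (.C b)))
          ↔
        (k x ∈ (⊥ : Submodule F K') ∧ k.symm.dualMap φ ∈ (⊤ : Submodule F (Dual F K')) ∧
          g w ∈ W'.sub (some (.C b)))
      rw [h2]
      simp

/-- Gluings which agree on the part of `E` orthogonal to `R` give isometric models. -/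
theorem dualModel_twist [FiniteDimensional F K] {ψ ψ' : W.V →ₗ[F] K} (hW : PW W)
    (h : ∀ y ∈ W.sub (some .E), (∀ r ∈ W.sub (some (.C false)), W.B r y = 0) → ψ y = ψ' y) :
    Iso (W.dualModel K ψ) (W.dualModel K ψ') := by
  obtain ⟨r, hr, hr'⟩ := exists_linear_rep W.B (W.sub (some (.C false))) (W.sub (some .E))
    (ψ - ψ') fun e he h' => by simp [h e he h']
  obtain ⟨s, hs⟩ := exists_double_dual (-(W.B.compl₂ r))
  have hs' : ∀ x φ, φ (s x) = -W.B x (r φ) := hs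
  have s0 : ∀ x, (∀ φ, W.B x (r φ) = 0) → s x = 0 := fun x hx => by
    rw [← Module.forall_dual_apply_eq_zero_iff F]
    intro φ
    rw [hs', hx, neg_zero]
  have hC := hW.C
  have hRC := hW.RC
  have sr : ∀ φ, s (r φ) = 0 := fun φ => s0 _ fun φ' => hC _ (hRC (hr _)) _ (hRC (hr _))
  let g : (K × Dual F K × W.V) ≃ₗ[F] (K × Dual F K × W.V) :=
    { toFun := fun p => (p.1 + s p.2.2, p.2.1, p.2.2 + r p.2.1)
      invFun := fun p => (p.1 - s p.2.2, p.2.1, p.2.2 - r p.2.1)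
      map_add' := fun p q => by
        refine Prod.ext ?_ (Prod.ext ?_ ?_)
        · simp; abel
        · simp
        · simp; abel
      map_smul' := fun a p => by
        refine Prod.ext ?_ (Prod.ext ?_ ?_) <;> simp
      left_inv := fun p => by simp [sr]
      right_inv := fun p => by simp [sr] }
  refine ⟨g, ?_, ?_⟩
  · rintro ⟨k, φ, w⟩ ⟨k', φ', w'⟩
    have := hC _ (hRC (hr φ)) _ (hRC (hr φ'))
    change φ' (k + s w) + φ (k' + s w') + W.B (w + r φ) (w' + r φ') = φ' k + φ k' + W.B w w'
    simp [hs', this, W.symm w' (r φ)]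
    ring
  · rintro (_ | _ | b) ⟨k, φ, w⟩
    · change (k ∈ (⊤ : Submodule F K) ∧ φ = 0 ∧ w ∈ _) ↔
        (k + s w ∈ (⊤ : Submodule F K) ∧ φ = 0 ∧ w + r φ ∈ _)
      simp only [Submodule.mem_top, true_and]
      refine and_congr_right fun h0 => ?_
      simp [h0]
    · change (φ = 0 ∧ w ∈ _ ∧ k = ψ w) ↔ (φ = 0 ∧ w + r φ ∈ _ ∧ k + s w = ψ' (w + r φ))
      refine and_congr_right fun h0 => ?_
      rw [h0, map_zero, add_zero]
      refine and_congr_right fun hw => ?_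
      have : s w = ψ' w - ψ w := by
        rw [← sub_eq_zero, ← Module.forall_dual_apply_eq_zero_iff F]
        intro φ
        have := hr' φ w hw
        simp only [map_sub, LinearMap.sub_apply] at this ⊢
        rw [hs', W.symm, this]
        ring
      rw [this]
      constructor
      · rintro rfl
        abel
      · intro h'
        rw [← sub_eq_zero] at h' ⊢
        rw [← h']
        abel
    · have hb : W.sub (some (.C b)) ≤ W.sub (some (.C true)) := by
        cases b
        · exact hRC
        · exact le_rfl
      have hb' : ∀ φ, r φ ∈ W.sub (some (.C b)) := fun φ => by
        cases b
        · exact hr φ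
        · exact hRC (hr φ)
      change (k = 0 ∧ φ ∈ (⊤ : Submodule F (Dual F K)) ∧ w ∈ W.sub (some (.C b))) ↔
        (k + s w = 0 ∧ φ ∈ (⊤ : Submodule F (Dual F K)) ∧
          w + r φ ∈ W.sub (some (.C b)))
      rw [Submodule.add_mem_iff_left _ (hb' φ)]
      have : w ∈ W.sub (some (.C b)) → s w = 0 := fun hw =>
        s0 _ fun φ' => hC _ (hb hw) _ (hRC (hr _))
      constructor
      · rintro ⟨h1, h2, h3⟩
        exact ⟨by rw [h1, this h3, zero_add], h2, h3⟩
      · rintro ⟨h1, h2, h3⟩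
        exact ⟨by rwa [this h3, add_zero] at h1, h2, h3⟩

/-- The model depends only on the smaller configuration. -/
theorem dualModel_iso {K' : Type u} [AddCommGroup K'] [Module F K'] [FiniteDimensional F K]
    [FiniteDimensional F K'] {W' : Cfg F (Option (LE Bool))} {ψ : W.V →ₗ[F] K}
    {ψ' : W'.V →ₗ[F] K'} (hW : PW W) (hψ : Glue W ψ) (hψ' : Glue W' ψ')
    (h : Iso W W') : Iso (W.dualModel K ψ) (W'.dualModel K' ψ') := by
  obtain ⟨g, h1, h2⟩ := h
  let X : Submodule F W.V :=
    { carrier := {y | y ∈ W.sub (some .E) ∧ ∀ r ∈ W.sub (some (.C false)), W.B r y = 0}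
      add_mem' := fun hx hy => ⟨add_mem hx.1 hy.1, fun r hr => by simp [hx.2 r hr, hy.2 r hr]⟩
      zero_mem' := ⟨zero_mem _, by simp⟩
      smul_mem' := fun a x hx => ⟨Submodule.smul_mem _ a hx.1, fun r hr => by simp [hx.2 r hr]⟩ }
  have hX : ∀ y, y ∈ W.sub (some .E) → (∀ r ∈ W.sub (some (.C false)), W.B r y = 0) →
      g y ∈ W'.sub (some .E) ∧ ∀ r ∈ W'.sub (some (.C false)), W'.B r (g y) = 0 := by
    intro y h3 h4
    refine ⟨(h2 _ _).1 h3, fun r hr => ?_⟩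
    obtain ⟨r, rfl⟩ := g.surjective r
    rw [h1]
    exact h4 r ((h2 _ _).2 hr)
  let p : X →ₗ[F] K := ψ.comp X.subtype
  let p' : X →ₗ[F] K' := (ψ'.comp g.toLinearMap).comp X.subtype
  have hp : Function.Surjective p := fun k => by
    obtain ⟨y, h3, h4, h5⟩ := hψ.surj k
    exact ⟨⟨y, h3, h4⟩, h5⟩
  have hp' : Function.Surjective p' := fun k => by
    obtain ⟨y, h3, h4, h5⟩ := hψ'.surj k
    obtain ⟨y, rfl⟩ := g.surjective y
    refine ⟨⟨y, (h2 _ _).2 h3, fun r hr => ?_⟩, h5⟩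
    rw [← h1]
    exact h4 _ ((h2 _ _).1 hr)
  have hker : LinearMap.ker p = LinearMap.ker p' := by
    ext ⟨y, h3, h4⟩
    rw [LinearMap.mem_ker, LinearMap.mem_ker]
    obtain ⟨h5, h6⟩ := hX y h3 h4
    exact (hψ.ker y h3 h4).trans ((h2 _ _).trans (hψ'.ker _ h5 h6).symm)
  let e : K ≃ₗ[F] K' := (p.quotKerEquivOfSurjective hp).symm.trans
    ((Submodule.quotEquivOfEq _ _ hker).trans (p'.quotKerEquivOfSurjective hp'))
  have he : ∀ x : X, e (p x) = p' x := by
    intro x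
    have : (p.quotKerEquivOfSurjective hp).symm (p x) = Submodule.Quotient.mk x := by
      rw [LinearEquiv.symm_apply_eq]
      rfl
    simp only [e, LinearEquiv.trans_apply, this]
    rfl
  refine (dualModel_twist hW (ψ' := e.symm.toLinearMap.comp (ψ'.comp g.toLinearMap))
    fun y h3 h4 => ?_).trans (dualModel_congr h1 h2 e fun x => ?_)
  · have := he ⟨y, h3, h4⟩
    change e (ψ y) = ψ' (g y) at this
    simp [← this]
  · simp

end Model

end Cfg

namespace Cfg

variable {F : Type u} [Field F]

/-- Splitting off the part of `L` orthogonal to `E`. -/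
theorem PF.exists_dualModel {c : Cfg F (LE Bool)} (hc : PF c) (hs : PFStar c) {x : c.V}
    (hxL : x ∈ c.sub .L) (hxE : ∀ y ∈ c.sub .E, c.B x y = 0) (hx0 : x ≠ 0) :
    ∃ W : Cfg F (Option (LE Bool)), PW W ∧ finrank F W.V < finrank F c.V ∧
      ∃ (K : Submodule F c.V) (ψ : W.V →ₗ[F] K), Glue W ψ ∧ Iso c (W.dualModel K ψ) := by
  have symm := c.symm
  have hLi := hc.L.iso
  have hAi := hc.A
  let K : Submodule F c.V := c.sub .L ⊓ orth c.B (c.sub .E)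
  have hKL : ∀ k : K, (k : c.V) ∈ c.sub .L := fun k => k.2.1
  have hKE : ∀ k : K, ∀ e ∈ c.sub .E, c.B k e = 0 := fun k => k.2.2
  have hKE' : ∀ k : K, ∀ e ∈ c.sub .E, c.B e k = 0 := fun k e he => by rw [symm, hKE k e he]
  have hKK : ∀ k k' : K, c.B k k' = 0 := fun k k' => hLi _ (hKL k) _ (hKL k')
  obtain ⟨δ, hδ⟩ := K.subtype.exists_leftInverse_of_injective K.ker_subtype
  have hδ' : ∀ k : K, δ k = k := LinearMap.congr_fun hδ
  obtain ⟨a, haA, ha⟩ := exists_linear_rep c.B (c.sub (.C false)) K δ fun e he h' => by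
    have := hs.LEA e he.1 he.2 fun y hy => by rw [symm]; exact h' y hy
    simp [this]
  have haK : ∀ φ (k : K), c.B (a φ) k = φ k := fun φ k => by rw [ha φ k k.2, hδ']
  have haK' : ∀ φ (k : K), c.B k (a φ) = φ k := fun φ k => by rw [symm, haK]
  have haC : ∀ φ, a φ ∈ c.sub (.C true) := fun φ => hc.AC (haA φ)
  have haa : ∀ φ φ', c.B (a φ) (a φ') = 0 := fun φ φ' => hAi _ (haA φ) _ (haA φ')
  obtain ⟨κ, hκ⟩ := exists_double_dual (c.B.compl₂ a)
  replace hκ : ∀ x φ, φ (κ x) = c.B x (a φ) := hκ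
  have κ0 : ∀ x, (∀ φ, c.B x (a φ) = 0) → κ x = 0 := fun x hx => by
    rw [← Module.forall_dual_apply_eq_zero_iff F]
    intro φ
    rw [hκ, hx]
  have κK : ∀ k : K, κ k = k := fun k => by
    rw [← sub_eq_zero, ← Module.forall_dual_apply_eq_zero_iff F]
    intro φ
    rw [map_sub, hκ, haK', sub_self]
  have κC : ∀ y ∈ c.sub (.C true), κ y = 0 := fun y hy => κ0 _ fun φ => hc.C y hy _ (haC φ)
  have κa : ∀ φ, κ (a φ) = 0 := fun φ => κC _ (haC φ)
  let μ : c.V →ₗ[F] Dual F K := (LinearMap.lcomp F F K.subtype).comp c.B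
  have hμ : ∀ x (k : K), μ x k = c.B x k := fun x k => rfl
  have μ0 : ∀ x, (∀ k : K, c.B x k = 0) → μ x = 0 := fun x hx => LinearMap.ext hx
  have μa : ∀ φ, μ (a φ) = φ := fun φ => LinearMap.ext fun k => haK φ k
  have μL : ∀ x ∈ c.sub .L, μ x = 0 := fun x hx => μ0 x fun k => hLi x hx _ (hKL k)
  have μE : ∀ x ∈ c.sub .E, μ x = 0 := fun x hx => μ0 x fun k => hKE' k x hx
  have μK : ∀ k : K, μ k = 0 := fun k => μL _ (hKL k)
  let U : Submodule F c.V := LinearMap.ker κ ⊓ LinearMap.ker μ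
  have Uκ : ∀ u : U, κ u = 0 := fun u => u.2.1
  have Uμ : ∀ u : U, μ u = 0 := fun u => u.2.2
  have Ua : ∀ (u : U) φ, c.B u (a φ) = 0 := fun u φ => by rw [← hκ, Uκ, map_zero]
  have Uk : ∀ (u : U) (k : K), c.B u k = 0 := fun u k => by rw [← hμ, Uμ]; rfl
  let p : c.V →ₗ[F] U := LinearMap.codRestrict U
    (LinearMap.id - K.subtype.comp κ - a.comp μ) fun x => by
      constructor
      · simp [κK, κa]
      · simp [μK, μa]
  have hp : ∀ x, (p x : c.V) = x - κ x - a (μ x) := fun x => rfl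
  have hxp : ∀ x, x = κ x + a (μ x) + p x := fun x => by rw [hp]; abel
  have pU : ∀ u : U, p u = u := fun u => Subtype.ext (by rw [hp, Uκ, Uμ]; simp)
  have pK : ∀ k : K, p k = 0 := fun k => Subtype.ext (by rw [hp, κK, μK]; simp)
  have pE : ∀ e ∈ c.sub .E, e = κ e + p e := fun e he => by
    conv_lhs => rw [hxp e, μE e he]
    simp
  have pinj : ∀ e ∈ c.sub .E, p e = 0 → e = 0 := fun e he h => by
    refine hs.EL e he ?_
    rw [pE e he, h]
    simpa using hKL (κ e)
  obtain ⟨q, hq⟩ := (p.comp (c.sub .E).subtype).exists_leftInverse_of_injective (by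
    rw [LinearMap.ker_eq_bot']
    rintro ⟨e, he⟩ h
    exact Subtype.ext (pinj e he h))
  have hq' : ∀ e (he : e ∈ c.sub .E), q (p e) = ⟨e, he⟩ := fun e he => LinearMap.congr_fun hq
      ⟨e, he⟩
  let ψ : U →ₗ[F] K := κ.comp ((c.sub .E).subtype.comp q)
  have hψ : ∀ e ∈ c.sub .E, ψ (p e) = κ e := fun e he => by
    change κ (q (p e)) = κ e
    rw [hq' e he]
  let W : Cfg F (Option (LE Bool)) :=
    { V := U
      B := c.B.domRestrict₁₂ U U
      symm := fun x y => c.symm x y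
      sub := LE.fnZ
        ((c.sub .E ⊓ orth c.B (c.sub (.C false))).comap U.subtype)
        ((c.sub .L).comap U.subtype)
        ((c.sub .E).map p)
        fun b => (c.sub (.C b)).comap U.subtype }
  have memN : ∀ u : U, u ∈ W.sub none ↔
    ((u : c.V) ∈ c.sub .E ∧ ∀ y ∈ c.sub (.C false), c.B u y = 0) := fun u => Iff.rfl
  have memL : ∀ u : U, u ∈ W.sub (some .L) ↔ (u : c.V) ∈ c.sub .L := fun u => Iff.rfl
  have memE : ∀ u : U, u ∈ W.sub (some .E) ↔ ∃ e ∈ c.sub .E, p e = u := fun u => Iff.rfl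
  have memC : ∀ b, ∀ u : U, u ∈ W.sub (some (.C b)) ↔ (u : c.V) ∈ c.sub (.C b) :=
    fun b u => Iff.rfl
  have WB : ∀ u v : U, W.B u v = c.B u v := fun u v => rfl
  have pL : ∀ x ∈ c.sub .L, (p x : c.V) ∈ c.sub .L := fun x hx => by
    rw [hp, μL x hx, map_zero, sub_zero]
    exact sub_mem hx (hKL _)
  have kE : ∀ u : U, ∀ e ∈ c.sub .E, c.B u (p e) = c.B u e := fun u e he => by
    conv_rhs => rw [pE e he]
    rw [map_add, Uk, zero_add]
  have bC : ∀ b, ∀ φ, a φ ∈ c.sub (.C b) := fun b φ => by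
    cases b
    · exact haA φ
    · exact haC φ
  have κCb : ∀ b, ∀ y ∈ c.sub (.C b), κ y = 0 := fun b y hy => by
    cases b
    · exact κC y (hc.AC hy)
    · exact κC y hy
  have pC : ∀ b, ∀ y ∈ c.sub (.C b), (p y : c.V) ∈ c.sub (.C b) := fun b y hy => by
    rw [hp, κCb b y hy]
    simpa using sub_mem hy (bC b (μ y))
  have perpC : ∀ b, ∀ x : c.V, (∀ φ, c.B x (a φ) = 0) →
      (∀ y : U, (y : c.V) ∈ c.sub (.C b) → c.B x y = 0) → ∀ y ∈ c.sub (.C b), c.B x y = 0 := by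
    intro b x h1 h2 y hy
    rw [hxp y, κCb b y hy, map_add, map_add, h1, h2 (p y) (pC b y hy)]
    simp
  have N0 : ∀ e ∈ c.sub .E, κ e = 0 → (p e : c.V) = e := fun e he h => by
    conv_rhs => rw [pE e he, h]
    simp
  have NE : W.sub none ≤ W.sub (some .E) := fun u hu => ⟨u, ((memN u).1 hu).1, pU u⟩
  have hLE : ∀ u ∈ W.sub (some .L), u ∈ W.sub (some .E) → u = 0 := by
    rintro u hu ⟨e, he, rfl⟩
    have := hs.EL e he (by
      rw [pE e he]
      exact add_mem (hKL _) ((memL _).1 hu))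
    rw [this, map_zero]
  have hLmax : IsMax W.B (W.sub (some .L)) := by
    obtain ⟨z, h1, h2, h3⟩ := hc.L.ex
    have hμz : μ z = 0 := μ0 z fun k => h2 _ (hKL k)
    have hpz : (p z : c.V) = z - κ z := by rw [hp, hμz]; simp
    refine ⟨fun x hx y hy => hLi _ hx _ hy, p z, ?_, fun (x : U) hx => ?_, fun (x : U) hx => ?_⟩
    · rw [WB, hpz]
      simp [h1, h2 _ (hKL (κ z)), symm (κ z) z, hKK]
    · rw [WB, hpz]
      replace hx : (x : c.V) ∈ c.sub .L := hx
      simp [h2 _ hx, hLi _ (hKL (κ z)) _ hx]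
    · obtain ⟨s, hs'⟩ := h3 x fun y hy => by
        have h4 : c.B x (p y) = 0 := hx (p y) (pL y hy)
        rw [hxp y, μL y hy, map_add, map_add, Uk, map_zero, h4]
        simp
      refine ⟨s, (memL _).2 ?_⟩
      change (x : c.V) - s • (p z : c.V) ∈ _
      rw [hpz]
      have := add_mem hs' (Submodule.smul_mem _ s (hKL (κ z)))
      convert this using 1
      module
  have hEmax : IsMax W.B (W.sub (some .E)) := by
    refine hLmax.of_dual W.symm ?_ (fun x hx hx' => hLE x hx' hx) fun (x : U) hx hx' => ?_
    · rintro _ ⟨e, he, rfl⟩ _ ⟨e', he', rfl⟩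
      have h1 : c.B e e' = 0 := hc.E e he e' he'
      rw [pE e he, map_add, LinearMap.add_apply, hKE (κ e) e' he', zero_add] at h1
      rw [WB, kE _ _ he', h1]
    · have hxK : (x : c.V) ∈ K := ⟨hx, fun e he => by
        rw [← kE x e he]
        exact hx' _ ⟨e, he, rfl⟩⟩
      have h1 := κK ⟨x, hxK⟩
      rw [Uκ] at h1
      exact Subtype.ext (congrArg Subtype.val h1).symm
  refine ⟨W, ⟨fun (x : U) hx => ?_, hLmax, hEmax, hLE, NE, fun u hu => hc.AC hu,
    fun u hu v hv => hc.C _ hu _ hv, fun (u : U) hu (v : U) hv => ?_, fun (u : U) hu hu' => ?_,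
    fun (u : U) hu hu' => ?_⟩, ?_, K, ψ, ⟨fun k => ?_, ?_⟩, ?_⟩
  · refine Subtype.ext (hc.nd x fun y => ?_)
    have h1 : c.B x (p y) = 0 := hx (p y)
    rw [hxp y, map_add, map_add, Uk, Ua, h1]
    simp
  · change c.B (u : c.V) v = 0
    rw [symm]
    exact ((memN v).1 hv).2 u hu
  · exact Subtype.ext (hs.LC u hu hu')
  · exact Subtype.ext (hs.EC u ((memN u).1 hu).1 (perpC true u (Ua u) fun y hy => hu' y hy))
  · refine Submodule.finrank_lt fun h => hx0 ?_
    have h1 : x ∈ U := by rw [h]; trivial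
    have h2 := κK ⟨x, hxL, hxE⟩
    have h3 : κ x = 0 := h1.1
    rw [h3] at h2
    exact (congrArg Subtype.val h2).symm
  · obtain ⟨e, he, h1⟩ := exists_rep c.B (c.sub .E) (c.sub (.C false)) (c.B k) fun y hy h => by
      have := hs.AE y hy fun e he => by rw [symm]; exact h e he
      rw [this, map_zero]
    have h2 : κ e = k := by
      rw [← sub_eq_zero, ← Module.forall_dual_apply_eq_zero_iff F]
      intro φ
      rw [map_sub, hκ, h1 _ (haA φ), haK', sub_self]
    refine ⟨p e, ⟨e, he, rfl⟩, fun (r : U) hr => ?_, by rw [hψ e he, h2]⟩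
    rw [WB, kE _ _ he, symm, h1 r hr, symm, Uk]
  · rintro _ ⟨e, he, rfl⟩ h1
    rw [hψ e he, memN]
    constructor
    · intro h
      have h2 := N0 e he h
      rw [h2]
      refine ⟨he, perpC false e (fun φ => by rw [← hκ, h, map_zero]) fun y hy => ?_⟩
      have h3 := h1 y hy
      rw [WB, h2] at h3
      rw [symm, h3]
    · rintro ⟨h2, -⟩
      have h3 := hs.EL (e - p e) (sub_mem he h2) (by
        nth_rw 1 [pE e he]
        rw [add_sub_cancel_right]
        exact hKL _)
      rw [sub_eq_zero.1 h3, Uκ]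
  · let g : c.V ≃ₗ[F] (K × Dual F K × U) :=
      { toFun := fun x => (κ x, μ x, p x)
        invFun := fun y => y.1 + a y.2.1 + y.2.2
        map_add' := fun x y => by simp
        map_smul' := fun s x => by simp
        left_inv := fun x => (hxp x).symm
        right_inv := fun y => by
          have pa : ∀ φ, p (a φ) = 0 := fun φ => Subtype.ext (by rw [hp, κa, μa]; simp)
          simp [κK, κa, μK, μa, pK, pa, pU, Uκ, Uμ] }
    refine ⟨g, fun x y => ?_, ?_⟩
    · change (μ y) (κ x) + (μ x) (κ y) + c.B (p x) (p y) = c.B x y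
      conv_rhs => rw [hxp x, hxp y]
      simp only [map_add, LinearMap.add_apply, hKK, haa, Uk, Ua, symm _ (p y : c.V), haK, haK']
      ring
    · rintro (_ | _ | b) x
      · change x ∈ c.sub .L ↔ κ x ∈ (⊤ : Submodule F K) ∧ μ x = 0 ∧ (p x : c.V) ∈ c.sub .L
        refine ⟨fun h => ⟨trivial, μL x h, pL x h⟩, fun h => ?_⟩
        rw [hxp x, h.2.1, map_zero, add_zero]
        exact add_mem (hKL _) h.2.2
      · change x ∈ c.sub .E ↔ μ x = 0 ∧ (∃ e ∈ c.sub .E, p e = p x) ∧ κ x = ψ (p x)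
        refine ⟨fun h => ⟨μE x h, ⟨x, h, rfl⟩, (hψ x h).symm⟩, ?_⟩
        rintro ⟨h1, ⟨e, he, h2⟩, h3⟩
        rw [← h2, hψ e he] at h3
        rw [hxp x, h1, ← h2, h3, map_zero, add_zero, ← pE e he]
        exact he
      · change x ∈ c.sub (.C b) ↔ κ x = 0 ∧ μ x ∈ (⊤ : Submodule F (Dual F K)) ∧
          (p x : c.V) ∈ c.sub (.C b)
        refine ⟨fun h => ⟨κCb b x h, trivial, pC b x h⟩, fun h => ?_⟩
        rw [hxp x, h.1]
        simpa using add_mem (bC b (μ x)) h.2.2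

end Cfg

namespace Cfg

variable {F : Type u} [Field F]

/-- A vector of `R` not orthogonal to the common normal of `L` and `E` yields a reduction. -/
theorem exists_line_of_pw {c : Cfg F (Option (LE Bool))} (hc : PW c) (h2 : (2 : F) ≠ 0) {z t : c.V}
    (hz : c.B z z = 1) (hzL : ∀ x ∈ c.sub (some .L), c.B z x = 0)
    (hzE : ∀ x ∈ c.sub (some .E), c.B z x = 0) (ht : t ∈ c.sub (some (.C false)))
    (htz : c.B z t ≠ 0) : ∃ f, c.Hyp t f ∧ PW (c.red t f) ∧ LineOK c t f := by
  have symm := c.symm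
  have htC := hc.RC ht
  have htt := hc.C t htC t htC
  obtain ⟨v₁, hv₁, h5⟩ := hc.L.exists_not_perp symm htt fun h => htz (hzL t h)
  obtain ⟨v₂, hv₂, h6⟩ := hc.E.exists_not_perp symm htt fun h => htz (hzE t h)
  have h : c.Hyp t v₁ := ⟨htt, hc.L.iso _ hv₁ _ hv₁, h5⟩
  have h' : c.Hyp t v₂ := ⟨htt, hc.E.iso _ hv₂ _ hv₂, h6⟩
  have zero : ∀ (x : (c.red t v₁).V) (a : F), rv x + a • t = 0 → x = 0 := by
    intro x a hx
    have h7 : c.B v₁ (rv x + a • t) = 0 := by rw [hx, map_zero]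
    have ha : a = 0 := by simpa [h.ft] using h7
    refine rv_inj ?_
    simpa [ha] using hx
  have hN : ∀ x ∈ c.sub none, ∀ y ∈ c.sub (some .E), c.B x y = 0 := fun x hx y hy =>
    hc.E.iso x (hc.NE hx) y hy
  refine ⟨v₁, h, ⟨red_nondeg h hc.nd, isMax_red h hc.L (Or.inr ⟨v₁, hv₁, h5⟩),
    isMax_red h hc.E (Or.inr ⟨v₂, hv₂, h6⟩), fun x hx hx' => ?_, le_red hc.NE, le_red hc.RC,
    isot_red h hc.C, perp_red h hc.RN, fun x hx hx' => ?_, fun x hx hx' => ?_⟩, ?_⟩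
  · obtain ⟨a, ha⟩ := mem_red.1 hx
    obtain ⟨b, hb⟩ := mem_red.1 hx'
    have h7 := hzL _ ha
    have h8 := hzE _ hb
    simp only [map_add, map_smul, smul_eq_mul] at h7 h8
    have h9 : (a - b) * c.B z t = 0 := by linear_combination h7 - h8
    have : a = b := sub_eq_zero.1 ((mul_eq_zero.1 h9).resolve_right htz)
    subst this
    exact zero x a (hc.LE _ ha hb)
  · obtain ⟨a, ha⟩ := mem_red.1 hx
    obtain ⟨b, hb⟩ := mem_red.1 hx'
    refine zero x a (hc.LC _ ha ?_)
    have := add_mem hb (Submodule.smul_mem _ (a - b) htC)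
    convert this using 1
    module
  · obtain ⟨a, ha⟩ := mem_red.1 hx
    refine zero x a (hc.NC _ ha fun y hy => ?_)
    have hty := hc.C t htC y hy
    have := hx' _ (pr_mem_red h hy hty)
    simpa [red_B, rv_pr, hty] using this
  · refine line_step h2 hc.nd h h'
        (LE.fnZ .perp .non .non fun _ => .inn)
        (LE.fnZ true false true fun _ => false) ?_ (some .L) (some .E) ?_ ?_ none (by simp) ?_
    · rintro (_ | _ | _ | j)
      · exact fun x hx => ⟨hc.RN t ht x hx, hc.E.iso _ hv₂ x (hc.NE hx)⟩
      · exact ⟨hv₁, hc.L.iso⟩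
      · exact ⟨hv₂, hc.E.iso⟩
      · have hj : c.sub (some (.C j)) ≤ c.sub (some (.C true)) := by
          cases j
          exacts [hc.RC, le_rfl]
        refine ⟨?_, fun x hx => hc.C t htC x (hj hx)⟩
        cases j
        exacts [ht, htC]
    · rintro (_ | _ | _ | j) h
      · cases h
      · simp [Dom, LE.fn, LE.fnZ]
      · cases h
      · simp [Dom, LE.fn, LE.fnZ]
    · rintro (_ | _ | _ | j) h
      · exact hN
      · cases h
      · simp [Dom, LE.fn, LE.fnZ]
      · simp [Dom, LE.fn, LE.fnZ]
    · intro x htx h7 h8 hD1 hD2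
      left
      obtain ⟨a, rfl⟩ := perp_both symm hc.L hc.E hc.LE hz hzL hzE (fun y hy => by
        have := hD1 (y - c.B t y • v₁) (sub_mem hy (Submodule.smul_mem _ _ hv₁)) (by simp [h5])
        simpa [symm x v₁, h7] using this) fun y hy => by
        have := hD2 (y - c.B t y • v₂) (sub_mem hy (Submodule.smul_mem _ _ hv₂)) (by simp [h6])
        simpa [symm x v₂, h8] using this
      have : a * c.B t z = 0 := by simpa using htx
      rw [symm t z] at this
      simp [(mul_eq_zero.1 this).resolve_right htz]

end Cfg

namespace Dat

variable {F : Type u} [Field F]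

/-- The hyperbolic form on `Dual V × F × V`. -/
def form (D : Dat F) :
    (Dual F D.V × F × D.V) →ₗ[F] (Dual F D.V × F × D.V) →ₗ[F] F :=
  LinearMap.mk₂ F (fun p q => p.1 q.2.2 + q.1 p.2.2 + p.2.1 * q.2.1)
    (by intros; simp; ring) (by intros; simp; ring) (by intros; simp; ring)
    (by intros; simp; ring)

/-- The graph of `(β, f)` on `T`. -/
def graph (D : Dat F) (T : Submodule F D.V) : Submodule F (Dual F D.V × F × D.V) where
  carrier := {p | p.2.2 ∈ T ∧ p.1 = D.β p.2.2 ∧ p.2.1 = D.f p.2.2}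
  add_mem' := by
    rintro p q ⟨h1, h2, h3⟩ ⟨h4, h5, h6⟩
    exact ⟨T.add_mem h1 h4, by simp [h2, h5], by simp [h3, h6]⟩
  zero_mem' := by simp
  smul_mem' := by
    rintro a p ⟨h1, h2, h3⟩
    exact ⟨T.smul_mem a h1, by simp [h2], by simp [h3]⟩

/-- The configuration of subspaces attached to a datum. -/
abbrev cfgOf (D : Dat F) : Cfg F (Option (Cfg.LE Bool)) where
  V := Dual F D.V × F × D.V
  B := D.form
  symm x y := by
    change x.1 y.2.2 + y.1 x.2.2 + x.2.1 * y.2.1 = y.1 x.2.2 + x.1 y.2.2 + y.2.1 * x.2.1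
    ring
  sub := Cfg.LE.fnZ (Submodule.prod ⊥ (Submodule.prod ⊥ D.N))
    (Submodule.prod ⊤ (Submodule.prod ⊥ ⊥)) (Submodule.prod ⊥ (Submodule.prod ⊥ ⊤))
    fun b => D.graph (if b then D.S else D.R)

theorem finrank_cfgOf (D : Dat F) : finrank F D.cfgOf.V = 2 * finrank F D.V + 1 := by
  change finrank F (Dual F D.V × F × D.V) = _
  rw [finrank_prod, finrank_prod, Subspace.dual_finrank_eq, finrank_self]
  omega

theorem DIso.iso {D D' : Dat F} (h : DIso D D') (hD : Valid D) : Cfg.Iso D.cfgOf D'.cfgOf := by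
  obtain ⟨g, σ, hσ, h1, h2, hR, hS, hN⟩ := h
  have hσ0 : σ ≠ 0 := by rcases hσ with rfl | rfl <;> simp
  have hσσ : σ * σ = 1 := by rcases hσ with rfl | rfl <;> simp
  let s : F ≃ₗ[F] F := LinearEquiv.smulOfNeZero F F σ hσ0
  have hs : ∀ x, s x = σ * x := fun x => rfl
  have hC : ∀ (T : Submodule F D.V) (T' : Submodule F D'.V), T ≤ D.S → (∀ x, x ∈ T ↔ g x ∈ T') →
      ∀ φ a u, (u ∈ T ∧ φ = D.β u ∧ a = D.f u) ↔
        (g u ∈ T' ∧ g.symm.dualMap φ = D'.β (g u) ∧ s a = D'.f (g u)) := by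
    intro T T' hT hTT' φ a u
    rw [← hTT']
    refine and_congr_right fun hu => ?_
    rw [h2 u (hT hu), hs, mul_right_inj' hσ0]
    refine and_congr_left fun _ => ?_
    constructor
    · rintro rfl
      refine LinearMap.ext fun v => ?_
      obtain ⟨v, rfl⟩ := g.surjective v
      rw [h1 u (hT hu)]
      simp
    · intro h
      refine LinearMap.ext fun v => ?_
      rw [← h1 u (hT hu), ← h]
      simp
  refine ⟨g.symm.dualMap.prodCongr (s.prodCongr g), ?_, ?_⟩
  · rintro ⟨φ, a, u⟩ ⟨φ', a', u'⟩
    change φ (g.symm (g u')) + φ' (g.symm (g u)) + s a * s a' = φ u' + φ' u + a * a'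
    rw [hs, hs, g.symm_apply_apply, g.symm_apply_apply]
    linear_combination a * a' * hσσ
  · rintro (_ | _ | _ | _ | _) ⟨φ, a, u⟩
    · change (φ = 0 ∧ a = 0 ∧ u ∈ D.N) ↔ (g.symm.dualMap φ = 0 ∧ s a = 0 ∧ g u ∈ D'.N)
      simp [hN]
    · change (φ ∈ (⊤ : Submodule F (Dual F D.V)) ∧ a = 0 ∧ u = 0) ↔
        (g.symm.dualMap φ ∈ (⊤ : Submodule F (Dual F D'.V)) ∧ s a = 0 ∧ g u = 0)
      simp
    · change (φ = 0 ∧ a = 0 ∧ u ∈ (⊤ : Submodule F D.V)) ↔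
        (g.symm.dualMap φ = 0 ∧ s a = 0 ∧ g u ∈ (⊤ : Submodule F D'.V))
      simp
    · exact hC D.R D'.R hD.RS hR φ a u
    · exact hC D.S D'.S le_rfl hS φ a u

/-- The relabelling under which the configuration of a datum with `R = ⊥` is of the original kind.
-/
def relabel : Cfg.LE Bool → Option (Cfg.LE Bool) :=
  Cfg.LE.fn (some .L) (some (.C true)) fun b => if b then some .E else none

theorem cfgOf_isMax (D : Dat F) : Cfg.IsMax D.form (Submodule.prod ⊤ (Submodule.prod ⊥ ⊥)) := by
  refine ⟨?_, (0, 1, 0), ?_, ?_, ?_⟩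
  · rintro ⟨φ, a, u⟩ ⟨-, ha, hu⟩ ⟨φ', a', u'⟩ ⟨-, ha', hu'⟩
    change a = 0 at ha
    change a' = 0 at ha'
    change u = 0 at hu
    change u' = 0 at hu'
    change φ u' + φ' u + a * a' = 0
    simp [ha, hu, hu']
  · change (0 : Dual F D.V) 0 + (0 : Dual F D.V) 0 + (1 : F) * 1 = 1
    simp
  · rintro ⟨φ, a, u⟩ ⟨-, ha, hu⟩
    change a = 0 at ha
    change u = 0 at hu
    change (0 : Dual F D.V) u + φ 0 + 1 * a = 0
    simp [ha]
  · rintro ⟨φ, a, u⟩ h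
    refine ⟨a, trivial, ?_, ?_⟩
    · change a - a * 1 = 0
      simp
    · change u - a • 0 = 0
      rw [smul_zero, sub_zero, ← Module.forall_dual_apply_eq_zero_iff F]
      intro φ'
      have : φ 0 + φ' u + a * 0 = 0 := h (φ', 0, 0) ⟨trivial, rfl, rfl⟩
      simpa using this

theorem cfgOf_nondeg (D : Dat F) : Nondeg D.form := by
  rintro ⟨φ, a, u⟩ h
  have h1 : φ = 0 := LinearMap.ext fun v => by
    have : φ v + (0 : Dual F D.V) u + a * 0 = 0 := h (0, 0, v)
    simpa using this
  have h2 : a = 0 := by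
    have : φ 0 + (0 : Dual F D.V) u + a * 1 = 0 := h (0, 1, 0)
    simpa using this
  have h3 : u = 0 := by
    rw [← Module.forall_dual_apply_eq_zero_iff F]
    intro φ'
    have : φ 0 + φ' u + a * 0 = 0 := h (φ', 0, 0)
    simpa using this
  rw [h1, h2, h3]
  rfl

theorem Valid.pf {D : Dat F} (hD : Valid D) : Cfg.PF (D.cfgOf.reindex relabel) := by
  refine ⟨D.cfgOf_nondeg, D.cfgOf_isMax, ?_, ?_, ?_⟩
  · rintro ⟨φ, a, u⟩ ⟨hu, h1, h2⟩ ⟨φ', a', u'⟩ ⟨hu', h1', h2'⟩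
    change φ = D.β u at h1
    change φ' = D.β u' at h1'
    change a = D.f u at h2
    change a' = D.f u' at h2'
    change φ u' + φ' u + a * a' = 0
    rw [h1, h1', h2, h2']
    exact hD.skew u hu u' hu'
  · rintro ⟨φ, a, u⟩ ⟨h1, h2, h3⟩
    exact ⟨h1, h2, trivial⟩
  · rintro ⟨φ, a, u⟩ ⟨h1, h2, -⟩ ⟨φ', a', u'⟩ ⟨h1', h2', -⟩
    change φ = 0 at h1
    change φ' = 0 at h1'
    change a = 0 at h2
    change φ u' + φ' u + a * a' = 0
    simp [h1, h1', h2]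

/-- A datum with `R = ⊥` is determined by its relabelled configuration. -/
theorem DIso.of_iso {D D' : Dat F} (hR : D.R = ⊥) (hR' : D'.R = ⊥)
    (h : Cfg.Iso (D.cfgOf.reindex relabel) (D'.cfgOf.reindex relabel)) : DIso D D' := by
  obtain ⟨g, h1, h2⟩ := h
  have form : ∀ (D : Dat F) (p q : Dual F D.V × F × D.V), D.form p q =
    p.1 q.2.2 + q.1 p.2.2 + p.2.1 * q.2.1 := fun _ _ _ => rfl
  replace h1 : ∀ p q, D'.form (g p) (g q) = D.form p q := h1
  have hL : ∀ p, p.2.1 = 0 → p.2.2 = 0 → (g p).2.1 = 0 ∧ (g p).2.2 = 0 := fun p h3 h4 =>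
    ((h2 .L p).1 ⟨trivial, h3, h4⟩).2
  have hL' : ∀ p, (g p).2.1 = 0 → (g p).2.2 = 0 → p.2.1 = 0 ∧ p.2.2 = 0 := fun p h3 h4 =>
    ((h2 .L p).2 ⟨trivial, h3, h4⟩).2
  have hE : ∀ p, p.1 = 0 ∧ p.2.1 = 0 ↔ (g p).1 = 0 ∧ (g p).2.1 = 0 := fun p =>
    ⟨fun h => ((h2 (.C true) p).1 ⟨h.1, h.2, trivial⟩).imp_right And.left,
      fun h => ((h2 (.C true) p).2 ⟨h.1, h.2, trivial⟩).imp_right And.left⟩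
  have hN : ∀ p, p.1 = 0 ∧ p.2.1 = 0 ∧ p.2.2 ∈ D.N ↔
    (g p).1 = 0 ∧ (g p).2.1 = 0 ∧ (g p).2.2 ∈ D'.N := h2 (.C false)
  have hS : ∀ p, p.2.2 ∈ D.S ∧ p.1 = D.β p.2.2 ∧ p.2.1 = D.f p.2.2 ↔
    (g p).2.2 ∈ D'.S ∧ (g p).1 = D'.β (g p).2.2 ∧ (g p).2.1 = D'.f (g p).2.2 := h2 .E
  set σ := (g (0, 1, 0)).2.1 with hσ
  have hz1 : (g (0, 1, 0)).1 = 0 := LinearMap.ext fun v => by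
    obtain ⟨q, hq⟩ := g.surjective (0, 0, v)
    obtain ⟨h3, h4⟩ := (hE q).2 (by rw [hq]; exact ⟨rfl, rfl⟩)
    have := h1 (0, 1, 0) q
    rw [hq, form, form] at this
    simpa [h3, h4] using this
  have hz2 : (g (0, 1, 0)).2.2 = 0 := by
    rw [← Module.forall_dual_apply_eq_zero_iff F]
    intro φ
    obtain ⟨q, hq⟩ := g.surjective (φ, 0, 0)
    obtain ⟨h3, h4⟩ := hL' q (by rw [hq]) (by rw [hq])
    have := h1 (0, 1, 0) q
    rw [hq, form, form] at this
    simpa [h3, h4] using this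
  have hσσ : σ * σ = 1 := by
    have := h1 (0, 1, 0) (0, 1, 0)
    rw [form, form, hz1, hz2] at this
    simpa using this
  let k : D.V →ₗ[F] D'.V := LinearMap.snd F F D'.V ∘ₗ LinearMap.snd F (Dual F D'.V) (F × D'.V) ∘ₗ
    g.toLinearMap ∘ₗ LinearMap.inr F (Dual F D.V) (F × D.V) ∘ₗ LinearMap.inr F F D.V
  have hk : ∀ u, k u = (g (0, 0, u)).2.2 := fun u => rfl
  have hgk : ∀ u, g (0, 0, u) = (0, 0, k u) := fun u => by
    obtain ⟨h3, h4⟩ := (hE (0, 0, u)).1 ⟨rfl, rfl⟩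
    exact Prod.ext h3 (Prod.ext h4 rfl)
  have hbij : Function.Bijective k := by
    constructor
    · intro u v h
      have := g.injective ((hgk u).trans (by rw [h, hgk]))
      exact congrArg (fun p => p.2.2) this
    · intro v
      obtain ⟨⟨φ, a, u⟩, hq⟩ := g.surjective (0, 0, v)
      obtain ⟨h3, h4⟩ := (hE (φ, a, u)).2 (by rw [hq]; exact ⟨rfl, rfl⟩)
      change φ = 0 at h3
      change a = 0 at h4
      refine ⟨u, ?_⟩
      rw [hk, ← h3, ← h4]
      exact congrArg (fun p => p.2.2) hq
  have g1 : ∀ p v, (g p).1 (k v) = p.1 v := fun p v => by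
    have := h1 p (0, 0, v)
    rw [hgk, form, form] at this
    simpa using this
  have g2 : ∀ p, (g p).2.1 = σ * p.2.1 := fun p => by
    have := h1 p (0, 1, 0)
    rw [form, form, hz1, hz2, ← hσ] at this
    have h3 : (g p).2.1 * σ = p.2.1 := by simpa using this
    linear_combination σ * h3 - (g p).2.1 * hσσ
  have g3 : ∀ p, (g p).2.2 = k p.2.2 := by
    rintro ⟨φ, a, u⟩
    have h3 : ((φ, a, u) : Dual F D.V × F × D.V) = (φ, 0, 0) + a • (0, 1, 0) + (0, 0, u) := by
      simp
    rw [congrArg g h3, map_add, map_add, map_smul]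
    change (g (φ, 0, 0)).2.2 + a • (g (0, 1, 0)).2.2 + (g (0, 0, u)).2.2 = k u
    rw [(hL (φ, 0, 0) rfl rfl).2, hz2, ← hk]
    simp
  have hSk : ∀ u ∈ D.S, k u ∈ D'.S ∧ (g (D.β u, D.f u, u)).1 = D'.β (k u) ∧
      σ * D.f u = D'.f (k u) := fun u hu => by
    have := (hS (D.β u, D.f u, u)).1 ⟨hu, rfl, rfl⟩
    rwa [g3, g2] at this
  refine ⟨LinearEquiv.ofBijective k hbij, σ, mul_self_eq_one_iff.1 hσσ, fun u hu v => ?_,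
    fun u hu => (hSk u hu).2.2.symm, fun x => ?_, fun u => ⟨fun hu => (hSk u hu).1, fun hu => ?_⟩,
    fun u => ?_⟩
  · change D'.β (k u) (k v) = _
    rw [← (hSk u hu).2.1, g1]
  · rw [hR, hR', Submodule.mem_bot, Submodule.mem_bot]
    exact (LinearEquiv.map_eq_zero_iff (LinearEquiv.ofBijective k hbij)).symm
  · replace hu : k u ∈ D'.S := hu
    obtain ⟨p, hp⟩ := g.surjective (D'.β (k u), D'.f (k u), k u)
    have h3 := (hS p).2 (by rw [hp]; exact ⟨hu, rfl, rfl⟩)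
    have h4 : k p.2.2 = k u := by rw [← g3, hp]
    rw [← hbij.1 h4]
    exact h3.1
  · change _ ↔ k u ∈ D'.N
    have := hN (0, 0, u)
    rw [hgk] at this
    simpa using this

end Dat

namespace Cfg

variable {F : Type u} [Field F]

/-- A configuration with `R` orthogonal to the common normal of `L` and `E` comes from a datum. -/
theorem exists_dat_of_pw {c : Cfg F (Option (LE Bool))} (hc : PW c) {z : c.V}
    (hz : c.B z z = 1) (hzL : ∀ x ∈ c.sub (some .L), c.B z x = 0)
    (hzE : ∀ x ∈ c.sub (some .E), c.B z x = 0) (hzR : ∀ x ∈ c.sub (some (.C false)), c.B z x = 0) :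
    ∃ D : Dat F, D.Valid ∧ Iso c D.cfgOf := by
  have symm := c.symm
  let E := c.sub (some .E)
  obtain ⟨δ, hδ⟩ := E.subtype.exists_leftInverse_of_injective E.ker_subtype
  have hδ' : ∀ k : E, δ k = k := LinearMap.congr_fun hδ
  obtain ⟨r, hrL, hr⟩ := exists_linear_rep c.B (c.sub (some .L)) E δ fun e he h => by
    have h1 : e = 0 := hc.LE e (hc.L.mem symm (fun y hy => by rw [symm]; exact h y hy)
      (hc.E.iso e he e he)) he
    rw [h1, map_zero]
  have hrE : ∀ φ (e : E), c.B (r φ) e = φ e := fun φ e => by rw [hr φ e e.2, hδ']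
  have hrE' : ∀ φ (e : E), c.B e (r φ) = φ e := fun φ e => by rw [symm, hrE]
  have hzr : ∀ φ, c.B z (r φ) = 0 := fun φ => hzL _ (hrL φ)
  have hzr' : ∀ φ, c.B (r φ) z = 0 := fun φ => by rw [symm, hzr]
  have hze : ∀ e : E, c.B z e = 0 := fun e => hzE e e.2
  have hze' : ∀ e : E, c.B e z = 0 := fun e => by rw [symm, hze]
  have hrr : ∀ φ φ', c.B (r φ) (r φ') = 0 := fun φ φ' => hc.L.iso _ (hrL φ) _ (hrL φ')
  have hEE : ∀ e e' : E, c.B e e' = 0 := fun e e' => hc.E.iso _ e.2 _ e'.2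
  let lam : c.V →ₗ[F] Dual F E := (LinearMap.lcomp F F E.subtype).comp c.B
  have hlam : ∀ x (e : E), lam x e = c.B x e := fun x e => rfl
  let ε : c.V →ₗ[F] E := LinearMap.codRestrict E
    (LinearMap.id - r.comp lam - (c.B z).smulRight z) fun x => by
      obtain ⟨y, hy⟩ : ∃ y, y = (LinearMap.id - r.comp lam - (c.B z).smulRight z :
        c.V →ₗ[F] c.V) x := ⟨_, rfl⟩
      have hy' : y = x - r (lam x) - c.B z x • z := hy
      rw [← hy]
      obtain ⟨a, ha⟩ := hc.E.of_norm symm hz hzE (x := y) fun e he => by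
        have h1 := hrE (lam x) ⟨e, he⟩
        rw [hlam] at h1
        replace h1 : c.B (r (lam x)) e = c.B x e := h1
        simp [hy', h1, hzE e he]
      have h1 := hzE _ ha
      have h2 : a = 0 := by
        rw [hy'] at h1
        simpa [hzr, hz] using h1
      simpa [h2] using ha
  have hε : ∀ x, (ε x : c.V) = x - r (lam x) - c.B z x • z := fun x => rfl
  have hx : ∀ x, x = r (lam x) + c.B z x • z + ε x := fun x => by rw [hε]; abel
  have lamr : ∀ φ, lam (r φ) = φ := fun φ => LinearMap.ext fun e => hrE φ e
  have lamz : lam z = 0 := LinearMap.ext fun e => hze e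
  have lamE : ∀ e : E, lam e = 0 := fun e => LinearMap.ext fun e' => hEE e e'
  have εr : ∀ φ, ε (r φ) = 0 := fun φ => Subtype.ext (by rw [hε, lamr, hzr]; simp)
  have εz : ε z = 0 := Subtype.ext (by rw [hε, lamz, hz]; simp)
  have εE : ∀ e : E, ε e = e := fun e => Subtype.ext (by rw [hε, lamE, hze]; simp)
  have hB : ∀ x y, c.B x y = lam x (ε y) + lam y (ε x) + c.B z x * c.B z y := fun x y => by
    conv_lhs => rw [hx x, hx y]
    simp [hrE, hrE', hzr, hzr', hze, hze', hrr, hEE, hz]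
    ring
  let C := c.sub (some (.C true))
  have inj : ∀ x ∈ C, ε x = 0 → x = 0 := fun x hxC h => by
    have h1 := hB x x
    rw [hc.C x hxC x hxC, h, map_zero, add_zero, zero_add] at h1
    have h2 := mul_self_eq_zero.1 h1.symm
    refine hc.LC x ?_ hxC
    rw [hx x, h, h2]
    simpa using hrL _
  obtain ⟨q, hq⟩ := (ε.comp C.subtype).exists_leftInverse_of_injective (by
    rw [LinearMap.ker_eq_bot']
    rintro ⟨x, hx⟩ h
    exact Subtype.ext (inj x hx h))
  have hq' : ∀ x (hx : x ∈ C), q (ε x) = ⟨x, hx⟩ := fun x hx => LinearMap.congr_fun hq ⟨x, hx⟩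
  let D : Dat F :=
    { V := E
      β := lam.comp (C.subtype.comp q)
      f := (c.B z).comp (C.subtype.comp q)
      R := (c.sub (some (.C false))).map ε
      S := C.map ε
      N := (c.sub none).comap E.subtype }
  have hβ : ∀ x ∈ C, D.β (ε x) = lam x := fun x hx => by
    change lam (q (ε x)) = lam x
    rw [hq' x hx]
  have hf : ∀ x ∈ C, D.f (ε x) = c.B z x := fun x hx => by
    change c.B z (q (ε x)) = c.B z x
    rw [hq' x hx]
  have hRC := hc.RC
  refine ⟨D, ⟨Submodule.map_mono hc.RC, ?_, ?_, ?_, fun y hy h => ?_⟩, ?_⟩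
  · rintro _ ⟨x, hx, rfl⟩ _ ⟨y, hy, rfl⟩
    rw [hβ x hx, hβ y hy, hf x hx, hf y hy]
    exact (hB x y).symm.trans (hc.C x hx y hy)
  · rintro _ ⟨x, hx, rfl⟩
    rw [hf x (hRC hx)]
    exact hzR x hx
  · rintro _ ⟨x, hx, rfl⟩ y hy
    rw [hβ x (hRC hx)]
    exact hc.RN x hx _ hy
  · refine Subtype.ext (hc.NC _ hy fun x hx => ?_)
    have := h _ ⟨x, hx, rfl⟩
    rw [hβ x hx] at this
    rw [symm]
    exact this
  · let g : c.V ≃ₗ[F] (Dual F E × F × E) :=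
      { toFun := fun x => (lam x, c.B z x, ε x)
        invFun := fun y => r y.1 + y.2.1 • z + y.2.2
        map_add' := fun x y => by simp
        map_smul' := fun s x => by simp
        left_inv := fun x => (hx x).symm
        right_inv := fun y => by simp [lamr, lamz, lamE, εr, εz, εE, hzr, hze, hz] }
    have hC : ∀ T, T ≤ C → ∀ x, x ∈ T ↔
        ε x ∈ T.map ε ∧ lam x = D.β (ε x) ∧ c.B z x = D.f (ε x) := fun T hT x => by
      constructor
      · intro h
        exact ⟨⟨x, h, rfl⟩, (hβ x (hT h)).symm, (hf x (hT h)).symm⟩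
      · rintro ⟨⟨y, hy, h1⟩, h2, h3⟩
        rw [← h1, hβ y (hT hy)] at h2
        rw [← h1, hf y (hT hy)] at h3
        rw [hx x, h2, h3, ← h1, ← hx y]
        exact hy
    refine ⟨g, fun x y => (hB x y).symm, ?_⟩
    rintro (_ | _ | _ | _ | _) x
    · change x ∈ c.sub none ↔ lam x = 0 ∧ c.B z x = 0 ∧ (ε x : c.V) ∈ c.sub none
      constructor
      · intro h
        have h1 := lamE ⟨x, hc.NE h⟩
        have h2 := hze ⟨x, hc.NE h⟩
        have h3 := εE ⟨x, hc.NE h⟩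
        exact ⟨h1, h2, by rw [congrArg Subtype.val h3]; exact h⟩
      · rintro ⟨h1, h2, h3⟩
        rw [hx x, h1, h2]
        simpa using h3
    · change x ∈ c.sub (some .L) ↔ lam x ∈ (⊤ : Submodule F (Dual F E)) ∧ c.B z x = 0 ∧ ε x = 0
      constructor
      · intro h
        refine ⟨trivial, hzL x h, ?_⟩
        have h2 : (ε x : c.V) ∈ c.sub (some .L) := by
          rw [hε, hzL x h, zero_smul, sub_zero]
          exact sub_mem h (hrL _)
        exact Subtype.ext (hc.LE _ h2 (ε x).2)
      · rintro ⟨-, h2, h3⟩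
        rw [hx x, h2, h3]
        simpa using hrL _
    · change x ∈ c.sub (some .E) ↔ lam x = 0 ∧ c.B z x = 0 ∧ ε x ∈ (⊤ : Submodule F E)
      constructor
      · intro h
        exact ⟨lamE ⟨x, h⟩, hze ⟨x, h⟩, trivial⟩
      · rintro ⟨h1, h2, -⟩
        rw [hx x, h1, h2]
        simp [E]
    · exact hC _ hc.RC x
    · exact hC C le_rfl x

/-- The intermediate configurations, given the original ones of the same dimension. -/
theorem finIso_PW (h2 : (2 : F) ≠ 0) (m : ℕ)
    (h0 : FinIso fun c : Cfg F (LE Bool) => PF c ∧ finrank F c.V < m) :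
    FinIso fun c : Cfg F (Option (LE Bool)) => PW c ∧ finrank F c.V < m := by
  have base : Dat.FinD fun D : Dat F => D.Valid ∧ D.R = ⊥ ∧ finrank F D.V < m / 2 := by
    refine h0.rel (fun (D : Dat F) c => D.R = ⊥ ∧ c = D.cfgOf.reindex Dat.relabel) (r := Dat.DIso)
      (fun D hD => ⟨_, ⟨hD.1.pf, ?_⟩, hD.2.1, rfl⟩) ?_
    · have := D.finrank_cfgOf
      change finrank F D.cfgOf.V < m
      omega
    · rintro D D' _ _ ⟨h1, rfl⟩ ⟨h2, rfl⟩ h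
      exact Dat.DIso.of_iso h1 h2 h
  obtain ⟨s, hs, hs'⟩ := Dat.finD h2 (m / 2) base (m / 2)
  have hD : FinIso fun c : Cfg F (Option (LE Bool)) => finrank F c.V < m ∧
      ∃ D : Dat F, D.Valid ∧ Iso c D.cfgOf := by
    refine ⟨Dat.cfgOf '' s, hs.image _, ?_⟩
    rintro c ⟨hm, D, hD, hi⟩
    have h1 := D.finrank_cfgOf
    have h3 : finrank F c.V = finrank F D.cfgOf.V := by
      obtain ⟨g, -⟩ := hi
      exact g.finrank_eq
    obtain ⟨d, hd, hd'⟩ := hs' D ⟨hD, by omega, by omega⟩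
    exact ⟨_, ⟨d, hd, rfl⟩, hi.trans (hd'.iso hD)⟩
  have key : ∀ k, FinIso fun c : Cfg F (Option (LE Bool)) =>
      PW c ∧ finrank F c.V < m ∧ finrank F c.V < k := fun k => by
    induction k with
    | zero => exact ⟨∅, Set.finite_empty, fun c hc => absurd hc.2.2 (Nat.not_lt_zero _)⟩
    | succ k ih =>
      refine ((ih.reduces lineModel).or hD).mono ?_
      rintro c ⟨hc, hm, hk⟩
      obtain ⟨z, h1, h3, h4⟩ := exists_common_norm c.symm hc.L hc.E
      by_cases h5 : ∃ t ∈ c.sub (some (.C false)), c.B z t ≠ 0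
      · obtain ⟨t, ht, htz⟩ := h5
        obtain ⟨f, h, hP, hOK⟩ := exists_line_of_pw hc h2 h1 h3 h4 ht htz
        have := red_finrank h
        exact Or.inl ⟨_, ⟨hP, by omega, by omega⟩, hOK⟩
      · push Not at h5
        exact Or.inr ⟨hm, exists_dat_of_pw hc h1 h3 h4 h5⟩
  exact (key m).mono fun c hc => ⟨hc.1, hc.2, hc.2⟩

/-- Finiteness for a maximal isotropic subspace, an isotropic subspace and a two-step isotropic
flag. -/
theorem finIso_PF (h2 : (2 : F) ≠ 0) (m : ℕ) :
    FinIso fun c : Cfg F (LE Bool) => PF c ∧ finrank F c.V < m := by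
  induction m with
  | zero => exact ⟨∅, Set.finite_empty, fun c hc => absurd hc.2 (Nat.not_lt_zero _)⟩
  | succ m ih =>
    have hW := finIso_PW h2 m ih
    have hK : FinIso fun c : Cfg F (LE Bool) => ∃ W, (PW W ∧ finrank F W.V < m) ∧
        ∃ (K : Submodule F c.V) (ψ : W.V →ₗ[F] K), Glue W ψ ∧ Iso c (W.dualModel K ψ) :=
      hW.rel (fun c W => PW W ∧ ∃ (K : Submodule F c.V) (ψ : W.V →ₗ[F] K), Glue W ψ ∧
        Iso c (W.dualModel K ψ)) (r := Iso) (fun c ⟨W, h1, h3⟩ => ⟨W, h1, h1.1, h3⟩)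
        fun c d W W' ⟨h1, K, ψ, h3, h4⟩ ⟨h1', K', ψ', h3', h4'⟩ h =>
          h4.trans ((dualModel_iso h1 h3 h3' h).trans h4'.symm)
    refine (((ih.reduces lineModel).or (finIso_PI h2 (m + 1))).or hK).mono ?_
    rintro c ⟨hc, hm⟩
    rcases hc.line_or_star h2 with ⟨t, f, h, hP, hOK⟩ | hs
    · have := red_finrank h
      exact Or.inl (Or.inl ⟨_, ⟨hP, by omega⟩, hOK⟩)
    by_cases h : ∃ x ∈ c.sub .L, (∀ y ∈ c.sub .E, c.B x y = 0) ∧ x ≠ 0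
    · obtain ⟨x, h1, h3, h4⟩ := h
      obtain ⟨W, h5, h6, h7⟩ := hc.exists_dualModel hs h1 h3 h4
      exact Or.inr ⟨W, ⟨h5, by omega⟩, h7⟩
    · push Not at h
      exact Or.inl (Or.inr ⟨hc.toPI (hc.L.of_dual c.symm hc.E hs.EL h), hm⟩)

end Cfg

namespace Cfg

variable {F : Type u} [Field F] {ι : Type}

/-- Isometry of configurations with a marked line. -/
def PIso (c : Cfg F ι) (v : c.V) (d : Cfg F ι) (w : d.V) : Prop :=
  ∃ g : c.V ≃ₗ[F] d.V, (∀ x y, d.B (g x) (g y) = c.B x y) ∧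
    (∀ i x, x ∈ c.sub i ↔ g x ∈ d.sub i) ∧ ∃ r : F, r ≠ 0 ∧ g v = r • w

theorem PIso.trans {c d e : Cfg F ι} {u : c.V} {v : d.V} {w : e.V} (h : PIso c u d v)
    (h' : PIso d v e w) : PIso c u e w := by
  obtain ⟨g, h1, h2, r, hr, h3⟩ := h
  obtain ⟨k, h4, h5, s, hs, h6⟩ := h'
  exact ⟨g.trans k, fun x y => by simp [h1, h4], fun i x => by rw [h2, h5]; rfl, r * s,
    mul_ne_zero hr hs, by simp [h3, h6, smul_smul]⟩

theorem PIso.refl (c : Cfg F ι) (v : c.V) : PIso c v c v :=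
  ⟨LinearEquiv.refl F c.V, by simp, by simp, 1, one_ne_zero, by simp⟩

theorem PIso.smul (c : Cfg F ι) (v : c.V) {r : F} (hr : r ≠ 0) : PIso c v c (r • v) :=
  ⟨LinearEquiv.refl F c.V, by simp, by simp, r⁻¹, inv_ne_zero hr, by simp [smul_smul, hr]⟩

/-- The marked configurations with property `P` fall into finitely many isometry classes. -/
def FinPt (P : ∀ c : Cfg F ι, c.V → Prop) : Prop :=
  ∃ s : Set (Σ c : Cfg F ι, c.V), s.Finite ∧ ∀ c v, P c v → ∃ d ∈ s, PIso c v d.1 d.2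

section Normal

variable (d : Cfg F ι)

/-- The untwisted standard configuration. -/
abbrev tw0 (τ : ι → Ty) : Cfg F ι := d.tw τ fun _ => 0

theorem mem_tw0 {τ : ι → Ty} {i : ι} {p : F × F × d.V} :
    p ∈ (d.tw0 τ).sub i ↔ p ∈ d.std (τ i) (d.sub i) := by
  have : d.eich 0 p = p := by ext <;> simp
  simp only [Submodule.mem_comap, this]

theorem torus (τ : ι → Ty) {s : F} (hs : s ≠ 0) (x y : F) (v : d.V) :
    PIso (d.tw0 τ) (x, y, v) (d.tw0 τ) (s * x, s⁻¹ * y, v) := by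
  let g : (F × F × d.V) ≃ₗ[F] (F × F × d.V) :=
    (LinearEquiv.smulOfNeZero F F s hs).prodCongr
      ((LinearEquiv.smulOfNeZero F F s⁻¹ (inv_ne_zero hs)).prodCongr (LinearEquiv.refl F d.V))
  have hg : ∀ p, g p = (s * p.1, s⁻¹ * p.2.1, p.2.2) := fun p => rfl
  refine ⟨g, fun p q => ?_, fun i p => ?_, 1, one_ne_zero, by simp [hg]⟩
  · rw [hg, hg]
    simp
    field_simp
  · rw [mem_tw0, mem_tw0, hg]
    obtain ⟨x, y, z⟩ := p
    cases τ i <;> simp [std, hs]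

theorem eich_move (h2 : (2 : F) ≠ 0) (τ : ι → Ty)
    (hS : ∀ i, τ i = .non → ∀ x ∈ d.sub i, ∀ y ∈ d.sub i, d.B x y = 0) {a : d.V}
    (ha : ∀ i, a ∈ d.tws (τ i) (d.sub i)) (p : F × F × d.V) :
    PIso (d.tw0 τ) p (d.tw0 τ) (d.eich a p) := by
  have hinv : ∀ p, d.eich (-a) (d.eich a p) = p := fun p => by
    rw [eich_add _ h2]; ext <;> simp
  have hinv' : ∀ p, d.eich a (d.eich (-a) p) = p := fun p => by
    rw [eich_add _ h2]; ext <;> simp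
  refine ⟨{ d.eich a with
      invFun := d.eich (-a)
      left_inv := hinv
      right_inv := hinv' }, fun p q => ?_, fun i p => ?_, 1, one_ne_zero, ?_⟩
  · change d.hypForm (d.eich a p) (d.eich a q) = d.hypForm p q
    simp [d.symm _ a]
    field_simp
    ring
  · change p ∈ (d.tw0 τ).sub i ↔ d.eich a p ∈ (d.tw0 τ).sub i
    rw [mem_tw0, mem_tw0]
    refine ⟨eich_std d (hS i) (ha i) p, fun hp => ?_⟩
    have := eich_std d (hS i) (neg_mem (ha i)) _ hp
    rwa [hinv] at this
  · change d.eich a p = 1 • d.eich a p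
    rw [one_smul]

/-- The possible first coordinates. -/
def xval (S : Set F) (w : d.V) : Option S → F
  | none => -(d.B w w) / 2
  | some s => s

/-- The second coordinate. -/
def yval (F : Type u) [Field F] : Bool → F
  | true => 1
  | false => 0

/-- The normal forms which are determined by the reduced marked line. -/
def XOK {S : Set F} (w : d.V) (y : Bool) (x : Option S) : Prop :=
  w = 0 ∨ (y = false ∧ x ≠ none) ∨ (y = true ∧ (x = none ∨ ∃ s : S, x = some s ∧ s.1 = 0))

theorem PIso.model {c d : Cfg F ι} {v : c.V} {w : d.V} (h : PIso c v d w) (τ : ι → Ty) {S : Set F}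
    {y : Bool} {x : Option S} (hx : XOK c v y x) :
    PIso (c.tw0 τ) (xval c S v x, yval F y, v) (d.tw0 τ) (xval d S w x, yval F y, w) := by
  obtain ⟨g, h1, h2, r, hr, h3⟩ := h
  have key : ∀ a b : F, PIso (c.tw0 τ) (a, b, v) (d.tw0 τ) (a, b, g v) := fun a b => by
    refine ⟨(LinearEquiv.refl F F).prodCongr ((LinearEquiv.refl F F).prodCongr g), ?_, ?_, 1,
      one_ne_zero, ?_⟩
    · intro x y
      simp [h1]
    · rintro i ⟨a, b, x⟩
      rw [mem_tw0, mem_tw0]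
      cases hτ : τ i <;> simp [std, h2]
    · rw [one_smul]
      rfl
  refine (key _ _).trans ?_
  rcases hx with rfl | ⟨rfl, hx⟩ | ⟨rfl, hx⟩
  · rw [map_zero] at h3 ⊢
    have hw : w = 0 := by
      rcases smul_eq_zero.1 h3.symm with h | h
      · exact absurd h hr
      · exact h
    subst hw
    have : xval c S 0 x = xval d S 0 x := by cases x <;> simp [xval]
    rw [this]
    exact PIso.refl _ _
  · obtain ⟨s, rfl⟩ := Option.ne_none_iff_exists'.1 hx
    refine (PIso.smul _ _ (inv_ne_zero hr)).trans ((torus d τ hr _ _ _).trans ?_)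
    convert PIso.refl _ _ using 1
    simp [xval, yval, h3, smul_smul, hr]
  · refine (PIso.smul _ _ (inv_ne_zero hr)).trans ((torus d τ (inv_ne_zero hr) _ _ _).trans ?_)
    convert PIso.refl _ _ using 1
    rcases hx with rfl | ⟨s, rfl, hs⟩
    · have : c.B v v = r * (r * d.B w w) := by rw [← h1, h3]; simp
      simp [xval, yval, h3, smul_smul, hr, this]
      field_simp
    · simp [xval, yval, h3, smul_smul, hr, hs]

/-- The marked vector is isotropic or orthogonal to the given subspace. -/
def VecOK (V : Submodule F d.V) (v : d.V) : Prop := d.B v v = 0 ∨ ∀ x ∈ V, d.B v x = 0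

/-- Normal forms for a marked vector in the standard configuration. -/
theorem exists_normal (h2 : (2 : F) ≠ 0) {S : Set F} (h0S : (0 : F) ∈ S) (h1S : (1 : F) ∈ S)
    (τ : ι → Ty) (i₀ : ι) (hV : Isot d.B (d.sub i₀))
    (hτ : ∀ i, i ≠ i₀ → d.tws (τ i) (d.sub i) = ⊤) (hτn : ∀ i, i ≠ i₀ → τ i ≠ .non)
    (hsq : τ i₀ = .perp → ∀ x : F, x ≠ 0 → ∃ s ∈ S, ∃ r : F, r ≠ 0 ∧ x = r * r * s)
    (x y : F) (v : d.V) (hp : VecOK (d.tw0 τ) ((d.tw0 τ).sub i₀) (x, y, v)) :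
    ∃ (v' : d.V) (b : Bool) (o : Option S), VecOK d (d.sub i₀) v' ∧ XOK d v' b o ∧
      PIso (d.tw0 τ) (x, y, v) (d.tw0 τ) (xval d S v' o, yval F b, v') := by
  have hS : ∀ i, τ i = .non → ∀ x ∈ d.sub i, ∀ y ∈ d.sub i, d.B x y = 0 := fun i hi => by
    by_cases h : i = i₀
    · exact h ▸ hV
    · exact absurd hi (hτn i h)
  have move : ∀ a ∈ d.tws (τ i₀) (d.sub i₀), ∀ p, PIso (d.tw0 τ) p (d.tw0 τ) (d.eich a p) :=
    fun a ha p => eich_move d h2 τ hS (fun i => by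
      by_cases h : i = i₀
      · exact h ▸ ha
      · rw [hτ i h]; trivial) p
  have hvV : (∀ q ∈ (d.tw0 τ).sub i₀, d.hypForm (x, y, v) q = 0) → ∀ u ∈ d.sub i₀, d.B v u = 0 := by
    intro h u hu
    have := h (0, 0, u) ((mem_tw0 d).2 (by cases τ i₀ <;> simp [std, hu]))
    simpa using this
  by_cases hy : y = 0
  · subst hy
    have hvec : VecOK d (d.sub i₀) v := by
      rcases hp with hp | hp
      · exact Or.inl (by simpa using hp)
      · exact Or.inr (hvV hp)
    by_cases ha : ∃ a ∈ d.tws (τ i₀) (d.sub i₀), d.B a v ≠ 0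
    · obtain ⟨a, ha, hav⟩ := ha
      refine ⟨v, false, some ⟨0, h0S⟩, hvec, Or.inr (Or.inl ⟨rfl, by simp⟩), ?_⟩
      convert move _ (Submodule.smul_mem _ (-x / d.B a v) ha) (x, 0, v) using 1
      simp [xval, yval, hav]
    · by_cases hx : x = 0
      · subst hx
        exact ⟨v, false, some ⟨0, h0S⟩, hvec, Or.inr (Or.inl ⟨rfl, by simp⟩), PIso.refl _ _⟩
      · refine ⟨v, false, some ⟨1, h1S⟩, hvec, Or.inr (Or.inl ⟨rfl, by simp⟩), ?_⟩
        convert torus d τ (inv_ne_zero hx) x 0 v using 1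
        simp [xval, yval, hx]
  -- normalize the second coordinate
  obtain ⟨x', v', hp', hpi⟩ : ∃ x' v', VecOK (d.tw0 τ) ((d.tw0 τ).sub i₀) (x', 1, v') ∧
      PIso (d.tw0 τ) (x, y, v) (d.tw0 τ) (x', 1, v') := by
    have e : (y⁻¹ * x, 1, y⁻¹ • v) = y⁻¹ • ((x, y, v) : F × F × d.V) := by simp [hy]
    refine ⟨y⁻¹ * x, y⁻¹ • v, ?_, e ▸ PIso.smul _ _ (inv_ne_zero hy)⟩
    rw [e]
    rcases hp with hp | hp
    · exact Or.inl (by rw [map_smul, LinearMap.map_smul₂, hp, smul_zero, smul_zero])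
    · exact Or.inr fun q hq => by rw [LinearMap.map_smul₂, hp q hq, smul_zero]
  clear hp hvV
  suffices ∃ (w : d.V) (b : Bool) (o : Option S), VecOK d (d.sub i₀) w ∧ XOK d w b o ∧
      PIso (d.tw0 τ) (x', 1, v') (d.tw0 τ) (xval d S w o, yval F b, w) by
    obtain ⟨w, b, o, h3, h4, h5⟩ := this
    exact ⟨w, b, o, h3, h4, hpi.trans h5⟩
  clear hpi
  have hiso : d.hypForm (x', 1, v') (x', 1, v') = 0 → d.B v' v' = -(2 * x') := fun h => by
    simp at h
    linear_combination h
  have hvV : (∀ q ∈ (d.tw0 τ).sub i₀, d.hypForm (x', 1, v') q = 0) →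
      ∀ u ∈ d.sub i₀, d.B v' u = 0 := by
    intro h u hu
    have := h (0, 0, u) ((mem_tw0 d).2 (by cases τ i₀ <;> simp [std, hu]))
    simpa using this
  have vec0 : VecOK d (d.sub i₀) 0 := Or.inl (by simp)
  -- the marked vector is not orthogonal to the subspace
  have hno : ∀ u ∈ d.sub i₀, u ∈ d.tws (τ i₀) (d.sub i₀) → d.B v' u ≠ 0 →
      ∃ (w : d.V) (b : Bool) (o : Option S), VecOK d (d.sub i₀) w ∧ XOK d w b o ∧
      PIso (d.tw0 τ) (x', 1, v') (d.tw0 τ) (xval d S w o, yval F b, w) := by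
    intro u hu hu' hvu
    have hB : d.B v' v' = -(2 * x') := by
      rcases hp' with h | h
      · exact hiso h
      · exact absurd (hvV h u hu) hvu
    refine ⟨v' - (-x' / d.B v' u) • u, true, some ⟨0, h0S⟩, Or.inl ?_,
      Or.inr (Or.inr ⟨rfl, Or.inr ⟨_, rfl, rfl⟩⟩), ?_⟩
    · simp [hB, hV u hu u hu, d.symm u v']
      field_simp
      ring
    · convert move _ (Submodule.smul_mem _ (-x' / d.B v' u) hu') (x', 1, v') using 1
      simp [xval, yval, hV u hu u hu, d.symm u v', hvu]
  by_cases hperp : τ i₀ ≠ .inn ∧ ∃ u ∈ d.sub i₀, d.B v' u ≠ 0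
  · obtain ⟨hτi, u, hu, hvu⟩ := hperp
    refine hno u hu ?_ hvu
    cases h : τ i₀
    · exact absurd h hτi
    · exact fun s hs => hV u hu s hs
    · exact hu
  push Not at hperp
  cases h : τ i₀
  · have hB : d.B v' v' = -(2 * x') := by
      rcases hp' with h' | h'
      · exact hiso h'
      · have := h' (1, 0, 0) ((mem_tw0 d).2 (by simp [h, std]))
        simp at this
    refine ⟨0, true, some ⟨0, h0S⟩, vec0, Or.inl rfl, ?_⟩
    convert move v' (by rw [h]; trivial) (x', 1, v') using 1
    simp [xval, yval, hB]
    field_simp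
    ring
  · have hv' : v' ∈ d.tws (τ i₀) (d.sub i₀) := by
      rw [h]
      exact hperp (by simp [h])
    have e := move v' hv' (x', 1, v')
    set x₁ := x' + d.B v' v' / 2 with hx₁
    have e1 : d.eich v' (x', 1, v') = (x₁, 1, 0) := by
      simp [hx₁]
      field_simp
      ring
    rw [e1] at e
    by_cases hx0 : x₁ = 0
    · refine ⟨0, true, some ⟨0, h0S⟩, vec0, Or.inl rfl, ?_⟩
      simpa [xval, yval, hx0] using e
    · obtain ⟨s, hs, r, hr, hxs⟩ := hsq h x₁ hx0
      refine ⟨0, true, some ⟨s, hs⟩, vec0, Or.inl rfl, e.trans ?_⟩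
      refine (PIso.smul _ _ (inv_ne_zero hr)).trans ((torus d τ (inv_ne_zero hr) _ _ _).trans ?_)
      convert PIso.refl _ _ using 1
      simp [xval, yval, hr, hxs]
      field_simp
  · rcases hp' with h' | h'
    · refine ⟨v', true, none, Or.inr (hperp (by simp [h])), Or.inr (Or.inr ⟨rfl, Or.inl rfl⟩), ?_⟩
      have : xval d S v' none = x' := by
        simp [xval, hiso h']
        field_simp
      rw [this]
      exact PIso.refl _ _
    · refine ⟨v', true, some ⟨0, h0S⟩, Or.inr (hperp (by simp [h])),
        Or.inr (Or.inr ⟨rfl, Or.inr ⟨_, rfl, rfl⟩⟩), ?_⟩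
      have := h' (0, 1, 0) ((mem_tw0 d).2 (by simp [h, std]))
      simp at this
      rw [this]
      exact PIso.refl _ _

end Normal

end Cfg

namespace Cfg

variable {F : Type u} [Field F] {κ : Type} [LinearOrder κ]

/-- An isotropic subspace, a chain of isotropic subspaces with maximal top, and a marked vector. -/
structure PV (S : Set F) (c : Cfg F (Option κ)) (v : c.V) : Prop where
  nd : Nondeg c.B
  V : Isot c.B (c.sub none)
  mono : Monotone fun k => c.sub (some k)
  iso : ∀ k, Isot c.B (c.sub (some k))
  top : ∃ k, IsMax c.B (c.sub (some k))
  vec : VecOK c (c.sub none) v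
  sq : IsMax c.B (c.sub none) ∨ ∀ x : F, x ≠ 0 → ∃ s ∈ S, ∃ r : F, r ≠ 0 ∧ x = r * r * s

/-- The zero-dimensional reduction: a line of norm one. -/
def pointV (F : Type u) [Field F] (κ : Type) : Cfg F (Option κ) where
  V := F
  B := LinearMap.mul F F
  symm x y := mul_comm x y
  sub _ := ⊥

/-- The parameters of the model of a marked configuration. -/
abbrev VParam (κ : Type) (S : Set F) := (Option κ → Ty) × Bool × Option S

/-- The model of a marked configuration. -/
def vModel {S : Set F} (d : Σ c : Cfg F (Option κ), c.V) (p : VParam κ S) :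
    Σ c : Cfg F (Option κ), c.V :=
  ⟨d.1.tw0 p.1, (xval d.1 S d.2 p.2.2, yval F p.2.1, d.2)⟩

theorem PV.step (h2 : (2 : F) ≠ 0) {S : Set F} (h0S : (0 : F) ∈ S) (h1S : (1 : F) ∈ S)
    {c : Cfg F (Option κ)} {v : c.V} (hc : PV S c v) {k : κ} {t : c.V}
    (ht : t ∈ c.sub (some k)) (ht0 : t ≠ 0) (hlow : ∀ j, ¬ k ≤ j → c.sub (some j) = ⊥) :
    ∃ (t f : c.V) (_ : c.Hyp t f) (v' : (c.red t f).V), PV S (c.red t f) v' ∧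
      ∀ d w, PIso (c.red t f) v' d w → ∃ p : VParam κ S,
        PIso c v (vModel ⟨d, w⟩ p).1 (vModel ⟨d, w⟩ p).2 := by
  have htt := hc.iso k t ht t ht
  obtain ⟨f, τ₀, h, hτ₀, hfV⟩ : ∃ (f : c.V) (τ₀ : Ty), c.Hyp t f ∧
      HasTy c.B t f τ₀ (c.sub none) ∧ (IsMax c.B (c.sub none) →
        τ₀ ≠ .perp ∧ (t ∈ c.sub none ∨ ∃ v ∈ c.sub none, c.B t v = 1)) := by
    by_cases h1 : t ∈ c.sub none
    · obtain ⟨f, hf, -⟩ := exists_hyp hc.nd htt ⊥ (by simpa using ht0) (by simp) h2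
      exact ⟨f, .inn, hf, ⟨h1, hc.V t h1⟩, fun _ => ⟨by simp, Or.inl h1⟩⟩
    by_cases h3 : ∃ u ∈ c.sub none, c.B t u ≠ 0
    · obtain ⟨u, hu, htu⟩ := h3
      have e : c.B t ((c.B t u)⁻¹ • u) = 1 := by simp [htu]
      have hm := (c.sub none).smul_mem (c.B t u)⁻¹ hu
      exact ⟨_, .non, ⟨htt, hc.V _ hm _ hm, e⟩, ⟨hm, hc.V⟩, fun _ => ⟨by simp, Or.inr ⟨_, hm, e⟩⟩⟩
    · push Not at h3
      obtain ⟨f, hf, hfV⟩ := exists_hyp hc.nd htt _ h1 h3 h2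
      exact ⟨f, .perp, hf, fun x hx => ⟨h3 x hx, hfV x hx⟩, fun hM => absurd (hM.mem c.symm h3 htt)
          h1⟩
  let τ : Option κ → Ty := fun i => i.elim τ₀ fun j => if k ≤ j then .inn else .perp
  have hτ : ∀ i, HasTy c.B t f (τ i) (c.sub i) := by
    rintro (_ | j)
    · exact hτ₀
    · change HasTy c.B t f (if k ≤ j then .inn else .perp) _
      split_ifs with hj
      · exact ⟨hc.mono hj ht, fun x hx => hc.iso j t (hc.mono hj ht) x hx⟩
      · rw [hlow j hj]
        intro x hx
        have : x = 0 := hx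
        simp [this]
  have h00 : pr h f = 0 := rv_inj (by simp [rv_pr, h.tf, h.ff])
  have hmem := coordEquiv_mem h2 h τ _ (fun _ => h) hτ
  simp only [h00] at hmem
  have e1 : PIso c v ((c.red t f).tw0 τ) (coordEquiv h v) :=
    ⟨coordEquiv h, coordEquiv_B h, hmem, 1, one_ne_zero, by rw [one_smul]⟩
  have hvec : VecOK ((c.red t f).tw0 τ) (((c.red t f).tw0 τ).sub none) (coordEquiv h v) := by
    rcases hc.vec with hv | hv
    · exact Or.inl ((coordEquiv_B h v v).trans hv)
    · refine Or.inr fun q hq => ?_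
      obtain ⟨x, rfl⟩ := (coordEquiv h).surjective q
      exact (coordEquiv_B h v x).trans (hv x ((hmem none x).2 hq))
  have hsq : τ none = .perp → ∀ x : F, x ≠ 0 → ∃ s ∈ S, ∃ r : F, r ≠ 0 ∧ x = r * r * s := by
    intro hp
    rcases hc.sq with hM | hs
    · exact absurd hp (hfV hM).1
    · exact hs
  have htws : ∀ i, i ≠ none → (c.red t f).tws (τ i) ((c.red t f).sub i) = ⊤ := by
    rintro (_ | j) hj
    · exact absurd rfl hj
    · change (c.red t f).tws (if k ≤ j then .inn else .perp) _ = _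
      split_ifs with hkj
      · rfl
      · refine eq_top_iff.2 fun x _ s hs => ?_
        obtain ⟨a, ha⟩ := mem_red.1 hs
        rw [hlow j hkj, Submodule.mem_bot] at ha
        have : c.B f (rv s + a • t) = 0 := by rw [ha, map_zero]
        simp [h.ft] at this
        rw [this, zero_smul, add_zero] at ha
        rw [rv_inj (y := 0) (ha.trans (map_zero _).symm), map_zero]
  obtain ⟨v', b, o, h3, h4, h5⟩ := exists_normal (c.red t f) h2 h0S h1S τ none (isot_red h hc.V)
    htws (by
      rintro (_ | j) hj
      · exact absurd rfl hj
      · change (if k ≤ j then Ty.inn else .perp) ≠ _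
        split_ifs <;> simp) hsq _ _ _ hvec
  refine ⟨t, f, h, v', ⟨red_nondeg h hc.nd, isot_red h hc.V, fun i j hij => le_red (hc.mono hij),
    fun j => isot_red h (hc.iso j), ?_, h3, ?_⟩, fun d w hdw =>
    ⟨(τ, b, o), e1.trans (h5.trans (hdw.model τ h4))⟩⟩
  · obtain ⟨j, hj⟩ := hc.top
    refine ⟨j, isMax_red h hj (Or.inl (hj.mem c.symm (fun y hy => ?_) htt))⟩
    exact hc.iso (max k j) t (hc.mono (le_max_left k j) ht) y (hc.mono (le_max_right k j) hy)
  · rcases hc.sq with hM | hs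
    · exact Or.inl (isMax_red h hM (hfV hM).2)
    · exact Or.inr hs

theorem PV.point {S : Set F} {c : Cfg F (Option κ)} {v : c.V} (hc : PV S c v)
    (h0 : ∀ k, c.sub (some k) = ⊥) :
    ∃ a : Bool, PIso c v (pointV F κ) (yval F a) := by
  obtain ⟨k, hk⟩ := hc.top
  obtain ⟨z, hz1, -, hz⟩ := hk.ex
  have hspan : ∀ x, ∃ a : F, x = a • z := fun x => by
    obtain ⟨a, ha⟩ := hz x fun y hy => by
      rw [h0 k, Submodule.mem_bot] at hy
      rw [hy, map_zero]
    rw [h0 k, Submodule.mem_bot] at ha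
    exact ⟨a, sub_eq_zero.1 ha⟩
  have hz0 : ∀ a : F, a • z = 0 → a = 0 := fun a ha => by
    have := congrArg (c.B z) ha
    simpa [hz1] using this
  have hV : c.sub none = ⊥ := (Submodule.eq_bot_iff _).2 fun x hx => by
    obtain ⟨a, rfl⟩ := hspan x
    have := hc.V _ hx _ hx
    simp [hz1] at this
    simp [this]
  let g : F ≃ₗ[F] c.V := LinearEquiv.ofBijective (LinearMap.toSpanSingleton F c.V z)
    ⟨(injective_iff_map_eq_zero _).2 hz0, fun x => by
      obtain ⟨a, rfl⟩ := hspan x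
      exact ⟨a, rfl⟩⟩
  have hB : ∀ x y : c.V, g.symm x * g.symm y = c.B x y := fun x y => by
    obtain ⟨x, rfl⟩ := g.surjective x
    obtain ⟨y, rfl⟩ := g.surjective y
    rw [g.symm_apply_apply, g.symm_apply_apply]
    change x * y = c.B (x • z) (y • z)
    simp [hz1]
    ring
  have hm : ∀ x : c.V, x = 0 ↔ g.symm x = 0 := fun x => g.symm.map_eq_zero_iff.symm
  have hs : ∀ i x, x ∈ c.sub i ↔ g.symm x ∈ (pointV F κ).sub i := by
    intro i x
    have : c.sub i = ⊥ := by
      cases i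
      exacts [hV, h0 _]
    rw [this]
    exact hm x
  by_cases hv : v = 0
  · refine ⟨false, g.symm, hB, hs, 1, one_ne_zero, ?_⟩
    exact ((hm v).1 hv).trans (smul_zero _).symm
  · exact ⟨true, g.symm, hB, hs, g.symm v, fun h => hv ((hm v).2 h), (mul_one (g.symm v)).symm⟩

theorem finPt_PV [Finite κ] (h2 : (2 : F) ≠ 0) {S : Set F} (hS : S.Finite) (h0S : (0 : F) ∈ S)
    (h1S : (1 : F) ∈ S) (m : ℕ) :
    FinPt fun (c : Cfg F (Option κ)) v => PV S c v ∧ finrank F c.V < m := by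
  induction m with
  | zero => exact ⟨∅, Set.finite_empty, fun c v hc => absurd hc.2 (Nat.not_lt_zero _)⟩
  | succ m ih =>
    obtain ⟨s, hs, hs'⟩ := ih
    have := hS.to_subtype
    refine ⟨Set.image2 vModel s (Set.univ : Set (VParam κ S)) ∪
      Set.range fun a : Bool => ⟨pointV F κ, yval F a⟩,
      (hs.image2 _ Set.finite_univ).union (Set.finite_range _), ?_⟩
    rintro c v ⟨hc, hm⟩
    by_cases h0 : ∀ k, c.sub (some k) = ⊥
    · obtain ⟨a, ha⟩ := hc.point h0
      exact ⟨_, Or.inr ⟨a, rfl⟩, ha⟩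
    push Not at h0
    obtain ⟨k, hk, hkmin⟩ := (Set.toFinite {k | c.sub (some k) ≠ ⊥}).exists_minimal h0
    obtain ⟨t, ht, ht0⟩ := (Submodule.ne_bot_iff _).1 hk
    obtain ⟨t, f, h, v', h3, h4⟩ := hc.step h2 h0S h1S ht ht0 fun j hj => by
      by_contra h
      exact hj (hkmin h (le_of_not_ge hj))
    obtain ⟨d, hd, hd'⟩ := hs' _ v' ⟨h3, lt_of_lt_of_le (red_finrank h) (Nat.lt_succ_iff.1 hm)⟩
    obtain ⟨p, hp⟩ := h4 d.1 d.2 hd'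
    exact ⟨_, Or.inl ⟨d, hd, p, trivial, rfl⟩, hp⟩

/-- An isotropic subspace, an isotropic line, and a chain of isotropic subspaces with
maximal top. -/
structure PN (S : Set F) (c : Cfg F (LE κ)) : Prop where
  nd : Nondeg c.B
  L : Isot c.B (c.sub .L)
  E : ∃ v, c.B v v = 0 ∧ c.sub .E = Submodule.span F {v}
  mono : Monotone fun k => c.sub (.C k)
  iso : ∀ k, Isot c.B (c.sub (.C k))
  top : ∃ k, IsMax c.B (c.sub (.C k))
  sq : IsMax c.B (c.sub .L) ∨ ∀ x : F, x ≠ 0 → ∃ s ∈ S, ∃ r : F, r ≠ 0 ∧ x = r * r * s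

/-- The configuration whose marked line is one of the subspaces. -/
def lineCfg (d : Σ c : Cfg F (Option κ), c.V) : Cfg F (LE κ) where
  V := d.1.V
  B := d.1.B
  symm := d.1.symm
  sub := LE.fn (d.1.sub none) (Submodule.span F {d.2}) fun k => d.1.sub (some k)

theorem finIso_PN [Finite κ] (h2 : (2 : F) ≠ 0) {S : Set F} (hS : S.Finite) (m : ℕ) :
    FinIso fun c : Cfg F (LE κ) => PN S c ∧ finrank F c.V < m := by
  have hS' : (insert 0 (insert 1 S)).Finite := (hS.insert _).insert _
  obtain ⟨s, hs, hs'⟩ := finPt_PV (κ := κ) h2 hS' (by simp) (by simp) m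
  refine ⟨lineCfg '' s, hs.image _, ?_⟩
  rintro c ⟨hc, hm⟩
  obtain ⟨v, hv, hE⟩ := hc.E
  obtain ⟨d, hd, g, g1, g2, r, hr, h3⟩ := hs'
    (c.reindex fun i : Option κ => i.elim LE.L LE.C) v
    ⟨⟨hc.nd, hc.L, hc.mono, hc.iso, hc.top, Or.inl hv, by
      rcases hc.sq with h | h
      · exact Or.inl h
      · refine Or.inr fun x hx => ?_
        obtain ⟨s, hs, h⟩ := h x hx
        exact ⟨s, by simp [hs], h⟩⟩, hm⟩
  refine ⟨_, ⟨d, hd, rfl⟩, g, g1, ?_⟩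
  rintro (_ | _ | k) x
  · exact g2 none x
  · change x ∈ c.sub .E ↔ g x ∈ Submodule.span F {d.2}
    rw [hE, Submodule.mem_span_singleton, Submodule.mem_span_singleton]
    constructor
    · rintro ⟨a, rfl⟩
      exact ⟨a * r, by rw [map_smul, h3, smul_smul]⟩
    · rintro ⟨a, ha⟩
      refine ⟨a * r⁻¹, g.injective ?_⟩
      rw [map_smul, h3, smul_smul, mul_assoc, inv_mul_cancel₀ hr, mul_one, ha]
  · exact g2 (some k) x

end Cfg

namespace Cfg

variable {F : Type u} [Field F]

section Max

variable {V : Type u} [AddCommGroup V] [Module F V] [FiniteDimensional F V]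
  {B : V →ₗ[F] V →ₗ[F] F}

/-- Every isotropic subspace of an odd split space lies in a maximal one. -/
theorem exists_isMax_ge (hs : ∀ x y, B x y = B y x) (hB : Nondeg B) {L W : Submodule F V}
    (hL : IsMax B L) (hW : Isot B W) : ∃ L', W ≤ L' ∧ IsMax B L' := by
  obtain ⟨z, hz1, hzL, hzm⟩ := hL.ex
  obtain ⟨l, hl, hlW⟩ := exists_rep B L W (-B z) fun w hw h => by
    have hwL : w ∈ L := hL.mem hs (fun y hy => by rw [hs]; exact h y hy) (hW w hw w hw)
    simp [hzL w hwL]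
  have hzW : ∀ w ∈ W, B (z + l) w = 0 := fun w hw => by simp [hlW w hw]
  have hzL' : ∀ x ∈ L, B (z + l) x = 0 := fun x hx => by simp [hzL x hx, hL.iso l hl x hx]
  refine ⟨W ⊔ L ⊓ orth B W, le_sup_left, ?_, z + l, ?_, ?_, fun x hx => ?_⟩
  · intro x hx y hy
    obtain ⟨w, hw, a, ⟨ha, ha'⟩, rfl⟩ := Submodule.mem_sup.1 hx
    obtain ⟨w', hw', b, ⟨hb, hb'⟩, rfl⟩ := Submodule.mem_sup.1 hy
    simp [hW w hw w' hw', hs w b, hb' w hw, ha' w' hw', hL.iso a ha b hb]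
  · simp [hz1, hzL l hl, hs l z, hL.iso l hl l hl]
  · intro x hx
    obtain ⟨w, hw, a, ⟨ha, ha'⟩, rfl⟩ := Submodule.mem_sup.1 hx
    rw [map_add, hzW w hw, hzL' a ha, add_zero]
  · have h1 : x ∈ (L ⊔ Submodule.span F {z + l}) ⊔ W := by
      refine mem_of_dperp hs hB _ fun y hy => ?_
      have hyL : y ∈ L := by
        obtain ⟨a, ha⟩ := hL.of_norm hs hz1 hzL (x := y) fun u hu => by
          rw [hs]; exact hy u (Submodule.mem_sup_left (Submodule.mem_sup_left hu))
        have h2 := hy (z + l) (Submodule.mem_sup_left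
          (Submodule.mem_sup_right (Submodule.mem_span_singleton_self _)))
        have h3 := hzL' _ ha
        rw [map_sub, h2, map_smul, map_add, LinearMap.add_apply, hz1, hs l z, hzL l hl] at h3
        have ha0 : a = 0 := by simpa using h3
        simpa [ha0] using ha
      exact hx y (Submodule.mem_sup_right ⟨hyL, fun w hw => by
        rw [hs]; exact hy w (Submodule.mem_sup_right hw)⟩)
    obtain ⟨p, hp, w, hw, rfl⟩ := Submodule.mem_sup.1 h1
    obtain ⟨a, ha, q, hq, rfl⟩ := Submodule.mem_sup.1 hp
    obtain ⟨s, rfl⟩ := Submodule.mem_span_singleton.1 hq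
    refine ⟨s, ?_⟩
    have : a + s • (z + l) + w - s • (z + l) = w + a := by abel
    rw [this]
    refine Submodule.add_mem_sup hw ⟨ha, fun w' hw' => ?_⟩
    have := hx w' (Submodule.mem_sup_left hw')
    rw [map_add, map_add, LinearMap.add_apply, LinearMap.add_apply, map_smul, LinearMap.smul_apply,
      hzW w' hw', hW w hw w' hw', smul_zero, add_zero, add_zero] at this
    exact this

theorem IsMax.finrank (hs : ∀ x y, B x y = B y x) (hB : Nondeg B) {L : Submodule F V}
    (hL : IsMax B L) : 2 * finrank F L + 1 = finrank F V := by
  obtain ⟨z, hz1, hzL, hzm⟩ := hL.ex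
  have hnd : LinearMap.BilinForm.Nondegenerate (B : LinearMap.BilinForm F V) :=
    ⟨fun x hx => hB x hx, fun x hx => hB x fun y => by rw [hs]; exact hx y⟩
  have h1 := LinearMap.BilinForm.finrank_orthogonal hnd L
  have h2 : LinearMap.BilinForm.orthogonal (B : LinearMap.BilinForm F V) L =
      L ⊔ Submodule.span F {z} := by
    ext x
    rw [LinearMap.BilinForm.mem_orthogonal_iff]
    constructor
    · intro hx
      obtain ⟨a, ha⟩ := hzm x fun y hy => by rw [hs]; exact hx y hy
      have := Submodule.add_mem_sup ha (Submodule.mem_span_singleton.2 ⟨a, rfl⟩ : a • z ∈ _)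
      simpa using this
    · intro hx y hy
      obtain ⟨a, ha, q, hq, rfl⟩ := Submodule.mem_sup.1 hx
      obtain ⟨s, rfl⟩ := Submodule.mem_span_singleton.1 hq
      change B y (a + s • z) = 0
      simp [hL.iso y hy a ha, hs y z, hzL y hy]
  have hz0 : z ≠ 0 := by rintro rfl; simp at hz1
  have h3 : L ⊓ Submodule.span F {z} = ⊥ := by
    refine (Submodule.eq_bot_iff _).2 ?_
    rintro x ⟨hx, hx'⟩
    obtain ⟨s, rfl⟩ := Submodule.mem_span_singleton.1 hx'
    have := hzL _ hx
    have : s = 0 := by simpa [hz1] using this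
    simp [this]
  have h4 := Submodule.finrank_sup_add_finrank_inf_eq L (Submodule.span F {z})
  rw [h3, finrank_bot, finrank_span_singleton hz0] at h4
  rw [h2] at h1
  have := Submodule.finrank_le L
  omega

theorem isMax_of_finrank (hs : ∀ x y, B x y = B y x) (hB : Nondeg B) {L W : Submodule F V}
    (hL : IsMax B L) (hW : Isot B W) (h : 2 * Module.finrank F W + 1 = Module.finrank F V) :
    IsMax B W := by
  obtain ⟨L', h1, h2⟩ := exists_isMax_ge hs hB hL hW
  have h3 := h2.finrank hs hB
  rwa [Submodule.eq_of_le_of_finrank_eq h1 (by omega)]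

end Max

section Std

variable (F) (n : ℕ)

/-- The form `bform` as a bilinear map. -/
def bilin (N : ℕ) : (Fin N → F) →ₗ[F] (Fin N → F) →ₗ[F] F :=
  LinearMap.mk₂ F (bform F N)
    (fun x y z => by simp [bform, add_mul, Finset.sum_add_distrib])
    (fun a x y => by simp [bform, Finset.mul_sum, mul_assoc])
    (fun x y z => by simp [bform, mul_add, Finset.sum_add_distrib])
    (fun a x y => by simp [bform, Finset.mul_sum, mul_left_comm])

variable {F n}

theorem bilin_apply (N : ℕ) (x y : Fin N → F) : bilin F N x y = bform F N x y := rfl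

theorem bilin_symm (N : ℕ) (x y : Fin N → F) : bilin F N x y = bilin F N y x := by
  rw [bilin_apply, bilin_apply, bform, bform, ← Equiv.sum_comp Fin.revPerm]
  simp [mul_comm]

theorem bilin_single (N : ℕ) (x : Fin N → F) (i : Fin N) :
    bilin F N x (Pi.single i 1) = x i.rev := by
  rw [bilin_apply, bform, Finset.sum_eq_single i.rev]
  · simp
  · intro j _ hj
    have : j.rev ≠ i := fun h => hj (by rw [← h, Fin.rev_rev])
    simp [this]
  · simp

theorem bilin_nondeg (N : ℕ) : Nondeg (bilin F N) := fun x hx => by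
  funext i
  have := hx (Pi.single i.rev 1)
  rwa [bilin_single, Fin.rev_rev] at this

theorem exists_isMax : ∃ L, IsMax (bilin F (2 * n + 1)) L := by
  let L : Submodule F (Fin (2 * n + 1) → F) :=
    { carrier := {x | ∀ i : Fin (2 * n + 1), n ≤ i.1 → x i = 0}
      add_mem' := fun hx hy i hi => by simp [hx i hi, hy i hi]
      zero_mem' := fun i _ => rfl
      smul_mem' := fun a x hx i hi => by simp [hx i hi] }
  let m : Fin (2 * n + 1) := ⟨n, by omega⟩
  have hm : m.rev = m := by
    ext
    simp [m, Fin.rev]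
    omega
  have hL : ∀ x : Fin (2 * n + 1) → F, x ∈ L ↔ ∀ i : Fin (2 * n + 1), n ≤ i.1 → x i = 0 :=
    fun _ => Iff.rfl
  refine ⟨L, fun x hx y hy => ?_, Pi.single m 1, ?_, fun x hx => ?_, fun x hx => ⟨x m, ?_⟩⟩
  · rw [bilin_apply, bform]
    refine Finset.sum_eq_zero fun i _ => ?_
    by_cases hi : n ≤ i.1
    · rw [(hL x).1 hx i hi, zero_mul]
    · rw [(hL y).1 hy i.rev (by simp [Fin.rev]; omega), mul_zero]
  · rw [bilin_single, hm, Pi.single_eq_same]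
  · rw [bilin_symm, bilin_single, hm]
    exact (hL x).1 hx m le_rfl
  · refine (hL _).2 fun i hi => ?_
    by_cases him : i = m
    · subst him; simp
    · have h1 : x i = 0 := by
        have h2 := hx (Pi.single i.rev 1) ((hL _).2 fun j hj => by
          refine Pi.single_eq_of_ne ?_ _
          rintro rfl
          refine him (Fin.ext ?_)
          simp [Fin.rev] at hj
          simp only [m]
          omega)
        rwa [bilin_single, Fin.rev_rev] at h2
      simp [h1, him]

/-- A family of subspaces of the standard space. -/
abbrev stdCfg {ι : Type} (S : ι → Submodule F (Fin (2 * n + 1) → F)) : Cfg F ι where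
  V := Fin (2 * n + 1) → F
  B := bilin F (2 * n + 1)
  symm := bilin_symm _
  sub := S

theorem map_eq_of_iso {ι : Type} {V W : Type*} [AddCommGroup V] [Module F V] [AddCommGroup W]
    [Module F W] {g : V ≃ₗ[F] W} {S : ι → Submodule F V} {T : ι → Submodule F W}
    (h : ∀ i x, x ∈ S i ↔ g x ∈ T i) (i : ι) : Submodule.map g.toLinearMap (S i) = T i := by
  ext y
  obtain ⟨x, rfl⟩ := g.surjective y
  rw [← h i x]
  constructor
  · rintro ⟨x', hx', he⟩
    rwa [← g.injective he]
  · exact fun hx => ⟨x, hx, rfl⟩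

theorem finite_quot {ι : Type} {Q : Cfg F ι → Prop} (hQ : FinIso Q) {r : ℕ} {a b : Fin 1 → ℕ}
    {c : Fin r → ℕ} (ia ib : ι) (ic : Fin r → ι)
    (h : ∀ x : FlagVar F n 1 a × FlagVar F n 1 b × FlagVar F n r c,
      ∃ S : ι → Submodule F (Fin (2 * n + 1) → F), Q (stdCfg S) ∧ x.1.1 0 = S ia ∧
        x.2.1.1 0 = S ib ∧ ∀ i, x.2.2.1 i = S (ic i)) :
    Finite (Quot (TripleRel F n 1 1 r a b c)) := by
  obtain ⟨s, hs, hs'⟩ := hQ.rel (P := fun _ => True) (r := TripleRel F n 1 1 r a b c)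
    (fun x d => ∃ S : ι → Submodule F (Fin (2 * n + 1) → F), d = stdCfg S ∧ x.1.1 0 = S ia ∧
        x.2.1.1 0 = S ib ∧ ∀ i, x.2.2.1 i = S (ic i))
    (fun x _ => by
      obtain ⟨S, h1, h2⟩ := h x
      exact ⟨_, h1, S, rfl, h2⟩)
    (by
      rintro x y _ _ ⟨S, rfl, h1, h2, h3⟩ ⟨T, rfl, h4, h5, h6⟩ ⟨g, g1, g2⟩
      have hg := map_eq_of_iso g2
      refine ⟨g, g1, fun i => ?_, fun i => ?_, fun i => ?_⟩
      · rw [Subsingleton.elim i 0, h1, h4]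
        exact hg ia
      · rw [Subsingleton.elim i 0, h2, h5]
        exact hg ib
      · rw [h3, h6]
        exact hg (ic i))
  have := hs.to_subtype
  refine Finite.of_surjective (fun d : s => Quot.mk _ d.1) fun q => ?_
  obtain ⟨x, rfl⟩ := Quot.exists_rep q
  obtain ⟨d, hd, hr⟩ := hs' x trivial
  exact ⟨⟨d, hd⟩, (Quot.sound hr).symm⟩

variable {a : ℕ} {r : ℕ} {c : Fin r → ℕ}

theorem FlagVar.isot {p : ℕ} {a : Fin p → ℕ} (x : FlagVar F n p a) (i : Fin p) :
    Isot (bilin F (2 * n + 1)) (x.1 i) := x.2.2.2 i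

theorem FlagVar.finrank_one (x : FlagVar F n 1 ![a]) : finrank F (x.1 0) = a := by
  rw [x.2.2.1 0]
  simp

theorem isMax_of_finrank_eq {W : Submodule F (Fin (2 * n + 1) → F)}
    (hW : Isot (bilin F (2 * n + 1)) W) (h : finrank F W = n) :
    IsMax (bilin F (2 * n + 1)) W := by
  obtain ⟨L, hL⟩ := exists_isMax (F := F) (n := n)
  exact isMax_of_finrank (bilin_symm _) (bilin_nondeg _) hL hW (by simp [h])

theorem finrank_std_lt : finrank F (Fin (2 * n + 1) → F) < 2 * n + 2 := by simp

theorem finite_of_max_max (h2 : (2 : F) ≠ 0) (hr : 0 < r) :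
    Finite (Quot (TripleRel F n 1 1 r ![n] ![n] c)) := by
  have : Nonempty (Fin r) := ⟨⟨0, hr⟩⟩
  refine finite_quot (finIso_PI (κ := Fin r) h2 (2 * n + 2)) .L .E .C fun x => ?_
  refine ⟨LE.fn (x.1.1 0) (x.2.1.1 0) x.2.2.1, ⟨⟨bilin_nondeg _, ?_, ?_, x.2.2.2.1, ?_⟩,
    finrank_std_lt⟩, rfl, rfl, fun _ => rfl⟩
  · exact isMax_of_finrank_eq (FlagVar.isot _ _) (FlagVar.finrank_one _)
  · exact isMax_of_finrank_eq (FlagVar.isot _ _) (FlagVar.finrank_one _)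
  · exact fun k => FlagVar.isot _ _

theorem finite_of_one_max (h2 : (2 : F) ≠ 0) {a b : ℕ} {c : Fin 1 → ℕ} (hc : c 0 = n) :
    Finite (Quot (TripleRel F n 1 1 1 ![a] ![b] c)) := by
  have h : ∑ j ∈ Finset.Iic (0 : Fin 1), c j = c 0 := Finset.sum_singleton c 0
  refine finite_quot (finIso_PF h2 (2 * n + 2)) .E (.C true) (fun _ => .L) fun x => ?_
  refine ⟨LE.fn (x.2.2.1 0) (x.1.1 0) fun _ => x.2.1.1 0, ⟨⟨bilin_nondeg _, ?_, ?_, le_rfl, ?_⟩,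
    finrank_std_lt⟩, rfl, rfl, fun i => ?_⟩
  · exact isMax_of_finrank_eq (FlagVar.isot _ _) ((x.2.2.2.2.1 0).trans (h.trans hc))
  · exact FlagVar.isot _ _
  · exact FlagVar.isot _ _
  · rw [Subsingleton.elim i 0]; rfl

theorem finite_of_two_max (h2 : (2 : F) ≠ 0) {a : ℕ} {c : Fin 2 → ℕ} :
    Finite (Quot (TripleRel F n 1 1 2 ![a] ![n] c)) := by
  refine finite_quot (finIso_PF h2 (2 * n + 2)) .E .L (fun i => .C (i = 1)) fun x => ?_
  refine ⟨LE.fn (x.2.1.1 0) (x.1.1 0) fun b => x.2.2.1 (if b then 1 else 0),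
    ⟨⟨bilin_nondeg _, ?_, ?_, ?_, ?_⟩, finrank_std_lt⟩, rfl, rfl, fun i => ?_⟩
  · exact isMax_of_finrank_eq (FlagVar.isot _ _) (FlagVar.finrank_one _)
  · exact FlagVar.isot _ _
  · exact x.2.2.2.1 (by decide)
  · exact FlagVar.isot _ _
  · fin_cases i <;> rfl

theorem finite_of_line (h2 : (2 : F) ≠ 0) {b : ℕ}
    (hq : b = n ∨ Finite (Fˣ ⧸ (powMonoidHom 2 : Fˣ →* Fˣ).range)) :
    Finite (Quot (TripleRel F n 1 1 r ![1] ![b] c)) := by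
  obtain ⟨S, hS, hSq⟩ : ∃ S : Set F, S.Finite ∧
      (b = n ∨ ∀ x : F, x ≠ 0 → ∃ s ∈ S, ∃ r : F, r ≠ 0 ∧ x = r * r * s) := by
    rcases hq with hq | hq
    · exact ⟨∅, Set.finite_empty, Or.inl hq⟩
    · refine ⟨Set.range fun q : Fˣ ⧸ (powMonoidHom 2 : Fˣ →* Fˣ).range => (q.out : F),
        Set.finite_range _, Or.inr fun x hx => ⟨_, ⟨(Units.mk0 x hx : Fˣ), rfl⟩, ?_⟩⟩
      have h1 : ((Units.mk0 x hx : Fˣ) : Fˣ ⧸ (powMonoidHom 2 : Fˣ →* Fˣ).range).out =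
          ((Units.mk0 x hx : Fˣ) : Fˣ ⧸ (powMonoidHom 2 : Fˣ →* Fˣ).range) :=
        QuotientGroup.out_eq' _
      obtain ⟨y, hy⟩ := QuotientGroup.eq.1 h1
      refine ⟨y, y.ne_zero, ?_⟩
      have h3 := congrArg (Units.val) (eq_inv_mul_iff_mul_eq.1 hy)
      simp only [powMonoidHom_apply, Units.val_mul, Units.val_pow_eq_pow_val, Units.val_mk0] at h3
      exact h3.symm.trans (by ring)
  refine finite_quot (finIso_PN (κ := WithTop (Fin r)) h2 hS (2 * n + 2)) .E .L
    (fun i => .C (i : WithTop (Fin r))) fun x => ?_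
  obtain ⟨M, hM, hCM⟩ : ∃ M, IsMax (bilin F (2 * n + 1)) M ∧ ∀ i, x.2.2.1 i ≤ M := by
    obtain ⟨L, hL⟩ := exists_isMax (F := F) (n := n)
    rcases Nat.eq_zero_or_pos r with rfl | hr
    · exact ⟨L, hL, fun i => i.elim0⟩
    · obtain ⟨M, h3, h4⟩ := exists_isMax_ge (bilin_symm _) (bilin_nondeg _) hL
        (FlagVar.isot x.2.2 ⟨r - 1, by omega⟩)
      exact ⟨M, h4, fun i => (x.2.2.2.1 (by
        rw [Fin.le_def]; exact Nat.le_sub_one_of_lt i.2)).trans h3⟩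
  let C : WithTop (Fin r) → Submodule F (Fin (2 * n + 1) → F) := fun k => WithTop.recTopCoe M
      x.2.2.1 k
  refine ⟨LE.fn (x.2.1.1 0) (x.1.1 0) C,
    ⟨⟨bilin_nondeg _, FlagVar.isot _ _, ?_, ?_, ?_, ⟨⊤, hM⟩, ?_⟩, finrank_std_lt⟩, rfl, rfl,
    fun i => rfl⟩
  · obtain ⟨v, hv⟩ := finrank_eq_one_iff'.1 (FlagVar.finrank_one x.1)
    refine ⟨v, FlagVar.isot x.1 0 v v.2 v v.2, le_antisymm (fun y hy => ?_) ?_⟩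
    · obtain ⟨s, hs⟩ := hv.2 ⟨y, hy⟩
      exact Submodule.mem_span_singleton.2 ⟨s, congrArg Subtype.val hs⟩
    · exact (Submodule.span_singleton_le_iff_mem _ _).2 v.2
  · intro i j hij
    change C i ≤ C j
    induction j using WithTop.recTopCoe with
    | top =>
      induction i using WithTop.recTopCoe with
      | top => exact le_rfl
      | coe i => exact hCM i
    | coe j =>
      induction i using WithTop.recTopCoe with
      | top => exact absurd hij (by simp)
      | coe i => exact x.2.2.2.1 (WithTop.coe_le_coe.1 hij)
  · intro i
    change Isot _ (C i)
    induction i using WithTop.recTopCoe with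
    | top => exact hM.iso
    | coe i => exact FlagVar.isot _ _
  · rcases hSq with h | h
    · exact Or.inl (isMax_of_finrank_eq (FlagVar.isot _ _) ((FlagVar.finrank_one _).trans h))
    · exact Or.inr h

end Std

end Cfg

namespace Cfg

section Embed

variable {F : Type u} [Field F] {n : ℕ}

/-- The positions of the coordinates of `F^7` in `F^{2n+1}`. -/
def emb7 (hn : 3 ≤ n) (i : Fin 7) : Fin (2 * n + 1) :=
  if i.1 < 3 then ⟨i, by omega⟩ else if i.1 = 3 then ⟨n, by omega⟩ else ⟨i + (2 * n - 6), by omega⟩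

theorem emb7_val (hn : 3 ≤ n) (i : Fin 7) : (emb7 hn i).1 =
    if i.1 < 3 then i.1 else if i.1 = 3 then n else i.1 + (2 * n - 6) := by
  unfold emb7
  split_ifs <;> rfl

theorem emb7_injective (hn : 3 ≤ n) : Function.Injective (emb7 hn) := fun i j h => by
  have := congrArg Fin.val h
  rw [emb7_val, emb7_val] at this
  ext
  split_ifs at this <;> omega

theorem emb7_rev (hn : 3 ≤ n) (i : Fin 7) : (emb7 hn i).rev = emb7 hn i.rev := by
  ext
  rw [Fin.val_rev, emb7_val, emb7_val, Fin.val_rev]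
  split_ifs <;> omega

/-- The isometric embedding of `F^7` in `F^{2n+1}`. -/
noncomputable def phi7 (F : Type u) [Field F] (hn : 3 ≤ n) : (Fin 7 → F) →ₗ[F]
    (Fin (2 * n + 1) → F) :=
  Function.ExtendByZero.linearMap F (emb7 hn)

theorem phi7_emb (hn : 3 ≤ n) (h : Fin 7 → F) (i : Fin 7) : phi7 F hn h (emb7 hn i) = h i :=
  (emb7_injective hn).extend_apply _ _ _

theorem phi7_eq_zero (hn : 3 ≤ n) (h : Fin 7 → F) {k : Fin (2 * n + 1)}
    (hk : ∀ i, emb7 hn i ≠ k) : phi7 F hn h k = 0 :=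
  Function.extend_apply' _ _ _ fun ⟨i, hi⟩ => hk i hi

theorem bilin_phi7 (hn : 3 ≤ n) (h h' : Fin 7 → F) :
    bilin F (2 * n + 1) (phi7 F hn h) (phi7 F hn h') = bilin F 7 h h' := by
  rw [bilin_apply, bilin_apply, bform, bform]
  refine (Finset.sum_of_injOn (emb7 hn) (emb7_injective hn).injOn (fun _ _ => Finset.mem_univ _)
    (fun k _ hk => ?_) fun i _ => ?_).symm
  · rw [phi7_eq_zero hn h fun i hi => hk ⟨i, by simp, hi⟩, zero_mul]
  · rw [emb7_rev, phi7_emb, phi7_emb]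

/-- Isotropic vectors orthogonal to the image of `F^7`. -/
def pad (F : Type u) [Field F] (hn : 3 ≤ n) (k : Fin (n - 3)) : Fin (2 * n + 1) → F :=
  Pi.single ⟨k + 3, by omega⟩ 1

theorem emb7_ne (hn : 3 ≤ n) (k : Fin (n - 3)) (i : Fin 7) :
    emb7 hn i ≠ ⟨k + 3, by omega⟩ := fun h => by
  have := congrArg Fin.val h
  rw [emb7_val] at this
  simp only at this
  split_ifs at this <;> omega

theorem phi7_pad (hn : 3 ≤ n) (h : Fin 7 → F) {p : Fin (2 * n + 1) → F}
    (hp : p ∈ Submodule.span F (Set.range (pad F hn))) :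
    bilin F (2 * n + 1) (phi7 F hn h) p = 0 := by
  induction hp using Submodule.span_induction with
  | mem x hx =>
    obtain ⟨k, rfl⟩ := hx
    rw [pad, bilin_single]
    refine phi7_eq_zero hn h fun i hi => emb7_ne hn k i.rev ?_
    rw [← emb7_rev, hi, Fin.rev_rev]
  | zero => simp
  | add x y _ _ hx hy => rw [map_add, hx, hy, add_zero]
  | smul a x _ hx => rw [map_smul, hx, smul_zero]

theorem pad_pad (hn : 3 ≤ n) {p q : Fin (2 * n + 1) → F}
    (hp : p ∈ Submodule.span F (Set.range (pad F hn)))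
    (hq : q ∈ Submodule.span F (Set.range (pad F hn))) : bilin F (2 * n + 1) p q = 0 := by
  induction hq using Submodule.span_induction with
  | mem x hx =>
    obtain ⟨k, rfl⟩ := hx
    rw [pad, bilin_single]
    induction hp using Submodule.span_induction with
    | mem x hx =>
      obtain ⟨l, rfl⟩ := hx
      rw [pad, Pi.single_eq_of_ne]
      intro h
      have := congrArg Fin.val h
      rw [Fin.val_rev] at this
      simp only at this
      omega
    | zero => rfl
    | add x y _ _ hx hy => rw [Pi.add_apply, hx, hy, add_zero]
    | smul a x _ hx => rw [Pi.smul_apply, hx, smul_zero]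
  | zero => simp
  | add x y _ _ hx hy => rw [map_add, hx, hy, add_zero]
  | smul a x _ hx => rw [map_smul, hx, smul_zero]

theorem bilin_phi7_add (hn : 3 ≤ n) (h h' : Fin 7 → F) {p q : Fin (2 * n + 1) → F}
    (hp : p ∈ Submodule.span F (Set.range (pad F hn)))
    (hq : q ∈ Submodule.span F (Set.range (pad F hn))) :
    bilin F (2 * n + 1) (phi7 F hn h + p) (phi7 F hn h' + q) = bilin F 7 h h' := by
  rw [map_add, map_add, LinearMap.add_apply, LinearMap.add_apply, bilin_phi7, phi7_pad hn h hq,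
    pad_pad hn hp hq, bilin_symm _ p, phi7_pad hn h' hp, add_zero, add_zero, add_zero]

theorem exists_sum_equiv (f : Fin 3 → Fin n) (hf : Function.Injective f) :
    ∃ s : Fin 3 ⊕ Fin (n - 3) ≃ Fin n, ∀ i, s (.inl i) = f i := by
  classical
  have h1 : Fintype.card ↥(Set.range f)ᶜ = Fintype.card (Fin (n - 3)) := by
    rw [Fintype.card_compl_set, Set.card_range_of_injective hf]
    simp
  refine ⟨((Equiv.ofInjective f hf).sumCongr (Fintype.equivOfCardEq h1.symm)).trans
    (Equiv.Set.sumCompl _), fun i => ?_⟩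
  simp

theorem linearIndependent_pad (hn : 3 ≤ n) {g : Fin 3 → Fin 7 → F} (hg : LinearIndependent F g) :
    LinearIndependent F (Sum.elim (phi7 F hn ∘ g) (pad F hn)) := by
  have hinj : LinearMap.ker (phi7 F hn) = ⊥ := (LinearMap.ker_eq_bot').2 fun h h0 => by
    funext i
    rw [← phi7_emb hn h i, h0]
    rfl
  refine LinearIndependent.sum_type (hg.map' _ hinj) ?_ ?_
  · refine (Pi.linearIndependent_single_one (Fin (2 * n + 1)) F).comp
      (fun k : Fin (n - 3) => (⟨k + 3, by omega⟩ : Fin (2 * n + 1))) fun k l h => ?_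
    have := congrArg Fin.val h
    ext
    simpa using this
  · rw [Submodule.disjoint_def]
    intro x hx hx'
    rw [Set.range_comp, ← Submodule.map_span] at hx
    obtain ⟨h, -, rfl⟩ := hx
    have : ∀ i, ∀ p ∈ Submodule.span F (Set.range (pad F hn)), p (emb7 hn i) = 0 := fun i p hp => by
      induction hp using Submodule.span_induction with
      | mem x hx =>
        obtain ⟨k, rfl⟩ := hx
        exact Pi.single_eq_of_ne (emb7_ne hn k i) _
      | zero => rfl
      | add x y _ _ hx hy => rw [Pi.add_apply, hx, hy, add_zero]
      | smul a x _ hx => rw [Pi.smul_apply, hx, smul_zero]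
    have h0 : h = 0 := by
      funext i
      rw [← phi7_emb hn h i, this i _ hx']
      rfl
    rw [h0, map_zero]

/-- A flag spanned by the images of three vectors of `F^7`, which enter at prescribed dimensions,
and by padding vectors. -/
theorem exists_flag (hn : 3 ≤ n) {g : Fin 3 → Fin 7 → F} (hi : LinearIndependent F g)
    (hg : ∀ i j, bilin F 7 (g i) (g j) = 0) (f : Fin 3 → Fin n) (hf : Function.Injective f)
    {p : ℕ} (c : Fin p → ℕ) (hc : ∑ i, c i ≤ n) :
    ∃ X : FlagVar F n p c,
      (∀ i k, (f k).1 < ∑ j ∈ Finset.Iic i, c j → phi7 F hn (g k) ∈ X.1 i) ∧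
      ∀ i, ∀ u ∈ X.1 i, ∃ a : Fin 3 → F, ∃ q ∈ Submodule.span F (Set.range (pad F hn)),
        u = phi7 F hn (∑ k, a k • g k) + q ∧ ∀ k, ∑ j ∈ Finset.Iic i, c j ≤ (f k).1 → a k = 0 := by
  obtain ⟨s, hs⟩ := exists_sum_equiv f hf
  let w := Sum.elim (phi7 F hn ∘ g) (pad F hn)
  have hw : LinearIndependent F w := linearIndependent_pad hn hi
  let W : ℕ → Submodule F (Fin (2 * n + 1) → F) := fun d =>
    Submodule.span F (w '' {k | (s k).1 < d})
  have hmem : ∀ d, ∀ u ∈ W d, ∃ a : Fin 3 → F,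
      ∃ q ∈ Submodule.span F (Set.range (pad F hn)),
        u = phi7 F hn (∑ k, a k • g k) + q ∧ ∀ k, d ≤ (f k).1 → a k = 0 := fun d u hu => by
    induction hu using Submodule.span_induction with
    | mem x hx =>
      obtain ⟨k, hk, rfl⟩ := hx
      rcases k with k | k
      · refine ⟨Pi.single k 1, 0, zero_mem _, ?_, fun l hl => Pi.single_eq_of_ne ?_ _⟩
        · rw [Finset.sum_eq_single k]
          · simp [w]
          · intro b _ hb
            simp [hb]
          · simp
        · rintro rfl
          rw [Set.mem_ofPred_eq, hs] at hk
          omega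
      · exact ⟨0, _, Submodule.subset_span ⟨k, rfl⟩, by simp [w], fun _ _ => rfl⟩
    | zero => exact ⟨0, 0, zero_mem _, by simp, fun _ _ => rfl⟩
    | add x y _ _ hx hy =>
      obtain ⟨a, q, hq, rfl, ha⟩ := hx
      obtain ⟨b, q', hq', rfl, hb⟩ := hy
      refine ⟨a + b, q + q', add_mem hq hq', ?_, fun k hk => by simp [ha k hk, hb k hk]⟩
      simp only [Pi.add_apply, add_smul, Finset.sum_add_distrib, map_add]
      abel
    | smul t x _ hx =>
      obtain ⟨a, q, hq, rfl, ha⟩ := hx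
      refine ⟨t • a, t • q, Submodule.smul_mem _ _ hq, ?_, fun k hk => by simp [ha k hk]⟩
      simp only [Pi.smul_apply, smul_eq_mul, mul_smul, ← Finset.smul_sum, map_smul, smul_add]
  have hle : ∀ i : Fin p, ∑ j ∈ Finset.Iic i, c j ≤ n := fun i =>
    (Finset.sum_le_sum_of_subset (Finset.subset_univ _)).trans hc
  refine ⟨⟨fun i => W (∑ j ∈ Finset.Iic i, c j), fun i j hij => ?_, fun i => ?_, fun i => ?_⟩,
    fun i k hk => ?_, fun i u hu => hmem _ u hu⟩
  · refine Submodule.span_mono (Set.image_mono fun k (hk : (s k).1 < _) => show (s k).1 < _ from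
        lt_of_lt_of_le hk ?_)
    exact Finset.sum_le_sum_of_subset (Finset.Iic_subset_Iic.2 hij)
  · have h1 : LinearIndependent F (fun k : Fin (∑ j ∈ Finset.Iic i, c j) =>
        w (s.symm (Fin.castLE (hle i) k))) :=
      hw.comp _ (s.symm.injective.comp (Fin.castLE_injective _))
    have h3 : Set.range (fun k : Fin (∑ j ∈ Finset.Iic i, c j) =>
        w (s.symm (Fin.castLE (hle i) k))) = w '' {k | (s k).1 < ∑ j ∈ Finset.Iic i, c j} := by
      ext x
      constructor
      · rintro ⟨k, rfl⟩
        exact ⟨_, by simp, rfl⟩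
      · rintro ⟨k, hk, rfl⟩
        exact ⟨⟨(s k).1, hk⟩, by simp⟩
    have h4 := finrank_span_eq_card h1
    rw [h3, Fintype.card_fin] at h4
    exact h4
  · intro u hu v hv
    obtain ⟨a, q, hq, rfl, -⟩ := hmem _ u hu
    obtain ⟨b, q', hq', rfl, -⟩ := hmem _ v hv
    rw [← bilin_apply, bilin_phi7_add hn _ _ hq hq']
    simp only [map_sum, LinearMap.sum_apply, map_smul, LinearMap.smul_apply, hg, smul_zero,
      Finset.sum_const_zero]
  · exact Submodule.subset_span ⟨.inl k, by simpa [hs] using hk, rfl⟩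

end Embed

end Cfg

namespace Cfg

variable {F : Type u} [Field F] {n : ℕ}

section Invariant

theorem isOrthMap_symm {N : ℕ} {g : (Fin N → F) ≃ₗ[F] (Fin N → F)} (hg : IsOrthMap F N g) :
    IsOrthMap F N g.symm := fun u v => by
  have := hg (g.symm u) (g.symm v)
  rw [g.apply_symm_apply, g.apply_symm_apply] at this
  exact this.symm

theorem map_symm_eq {N : ℕ} {g : (Fin N → F) ≃ₗ[F] (Fin N → F)} {S T : Submodule F (Fin N → F)}
    (h : Submodule.map g.toLinearMap S = T) : Submodule.map g.symm.toLinearMap T = S := by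
  rw [← h, ← Submodule.map_comp]
  simp

theorem tripleRel_symm {p q r : ℕ} {a : Fin p → ℕ} {b : Fin q → ℕ} {c : Fin r → ℕ}
    {x y : FlagVar F n p a × FlagVar F n q b × FlagVar F n r c}
    (h : TripleRel F n p q r a b c x y) : TripleRel F n p q r a b c y x := by
  obtain ⟨g, hg, h1, h2, h3⟩ := h
  exact ⟨g.symm, isOrthMap_symm hg, fun i => map_symm_eq (h1 i), fun i => map_symm_eq (h2 i),
    fun i => map_symm_eq (h3 i)⟩

theorem map_mem_of_eq {N : ℕ} {g : (Fin N → F) ≃ₗ[F] (Fin N → F)} {S T : Submodule F (Fin N → F)}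
    (h : Submodule.map g.toLinearMap S = T) {u : Fin N → F} (hu : u ∈ S) : g u ∈ T := by
  rw [← h]
  exact ⟨u, hu, rfl⟩

theorem map_orth_of_eq {N : ℕ} {g : (Fin N → F) ≃ₗ[F] (Fin N → F)} (hg : IsOrthMap F N g)
    {S T : Submodule F (Fin N → F)} (h : Submodule.map g.toLinearMap S = T) {u : Fin N → F}
    (hu : ∀ t ∈ S, bilin F N u t = 0) : ∀ t ∈ T, bilin F N (g u) t = 0 := by
  rw [← h]
  rintro _ ⟨t, ht, rfl⟩
  exact (hg u t).trans (hu t ht)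

/-- An orbit invariant which takes infinitely many values forces infinitely many orbits. -/
theorem not_finite_quot [Infinite F] {p q r : ℕ} {a : Fin p → ℕ} {b : Fin q → ℕ} {c : Fin r → ℕ}
    (P : F → FlagVar F n p a × FlagVar F n q b × FlagVar F n r c → Prop)
    (hP : ∀ m x y, TripleRel F n p q r a b c x y → P m x → P m y)
    (h : ∀ l : F, l ≠ 0 → ∃ x, P l x ∧ ∀ m, P m x → m = l ∨ m * l = 1) :
    ¬ Finite (Quot (TripleRel F n p q r a b c)) := by
  intro hfin
  let Q : F → Quot (TripleRel F n p q r a b c) → Prop := fun m =>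
    Quot.lift (P m) fun x y hxy => propext ⟨hP m x y hxy, hP m y x (tripleRel_symm hxy)⟩
  choose x hx hx' using h
  have hinf : Infinite {l : F // l ≠ 0} :=
    (Set.infinite_coe_iff).2 (Set.Finite.infinite_compl (Set.finite_singleton (0 : F)))
  obtain ⟨y, hy⟩ := Finite.exists_infinite_fiber fun l : {l : F // l ≠ 0} =>
    (Quot.mk (TripleRel F n p q r a b c) (x l.1 l.2))
  obtain ⟨⟨l0, h0⟩, hl0⟩ := (Set.infinite_coe_iff.1 hy).nonempty
  refine Set.infinite_coe_iff.1 hy (Set.Finite.subset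
    (((Set.finite_singleton l0⁻¹).insert l0).preimage Subtype.val_injective.injOn) ?_)
  rintro ⟨l, hl⟩ hly
  have h1 : Q l y := by
    rw [← show _ = y from hly]
    exact hx l hl
  rw [← show _ = y from hl0] at h1
  rcases hx' l0 h0 l h1 with h2 | h2
  · exact Or.inl h2
  · exact Or.inr (eq_inv_of_mul_eq_one_left h2)

end Invariant

section Families

theorem bilin_seven (x y : Fin 7 → F) : bilin F 7 x y =
    x 0 * y 6 + x 1 * y 5 + x 2 * y 4 + x 3 * y 3 + x 4 * y 2 + x 5 * y 1 + x 6 * y 0 := by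
  rw [bilin_apply, bform]
  simp only [Fin.sum_univ_seven]
  rfl

/-- The vectors `v 0, v 1, v 2` of `F^7` are independent and span an isotropic subspace. -/
structure Iso3 (v : Fin 3 → Fin 7 → F) : Prop where
  indep : LinearIndependent F v
  isot : ∀ i j, bilin F 7 (v i) (v j) = 0

theorem Iso3.mk' {x y z : Fin 7 → F}
    (h : ∀ a b c : F, a • x + b • y + c • z = 0 → a = 0 ∧ b = 0 ∧ c = 0)
    (h00 : bilin F 7 x x = 0) (h01 : bilin F 7 x y = 0) (h02 : bilin F 7 x z = 0)
    (h11 : bilin F 7 y y = 0) (h12 : bilin F 7 y z = 0) (h22 : bilin F 7 z z = 0) :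
    Iso3 ![x, y, z] := by
  constructor
  · refine Fintype.linearIndependent_iff.2 fun g hg => ?_
    rw [Fin.sum_univ_three] at hg
    obtain ⟨h0, h1, h2⟩ := h _ _ _ hg
    intro i
    fin_cases i <;> assumption
  · have h10 := (bilin_symm 7 y x).trans h01
    have h20 := (bilin_symm 7 z x).trans h02
    have h21 := (bilin_symm 7 z y).trans h12
    intro i j
    fin_cases i <;> fin_cases j <;> assumption

/-- A flag one of whose members is spanned by two given vectors and padding. -/
theorem exists_flag_pair (hn : 3 ≤ n) {x y z : Fin 7 → F} (h : Iso3 ![x, y, z]) {p : ℕ}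
    (c : Fin p → ℕ) (hc : ∑ i, c i ≤ n)
    (i : Fin p) (h2 : 2 ≤ ∑ j ∈ Finset.Iic i, c j) (h3 : ∑ j ∈ Finset.Iic i, c j < n) :
    ∃ X : FlagVar F n p c, phi7 F hn x ∈ X.1 i ∧ phi7 F hn y ∈ X.1 i ∧
      ∀ u ∈ X.1 i, ∃ a b : F, ∃ q ∈ Submodule.span F (Set.range (pad F hn)),
        u = phi7 F hn (a • x + b • y) + q := by
  obtain ⟨X, h4, h5⟩ := exists_flag hn h.indep h.isot
      ![⟨0, by omega⟩, ⟨1, by omega⟩, ⟨n - 1, by omega⟩]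
    (fun i j hij => by
      have := congrArg Fin.val hij
      fin_cases i <;> fin_cases j <;> simp at this ⊢ <;> omega) c hc
  refine ⟨X, h4 i 0 ?_, h4 i 1 ?_, fun u hu => ?_⟩
  · change 0 < _
    omega
  · change 1 < _
    omega
  · obtain ⟨a, q, hq, rfl, ha⟩ := h5 i u hu
    have h6 : a 2 = 0 := ha 2 (by change _ ≤ n - 1; omega)
    refine ⟨a 0, a 1, q, hq, ?_⟩
    rw [Fin.sum_univ_three, h6, zero_smul, add_zero]
    rfl

theorem bilin_phi7_right (hn : 3 ≤ n) (g h : Fin 7 → F) {q : Fin (2 * n + 1) → F}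
    (hq : q ∈ Submodule.span F (Set.range (pad F hn))) :
    bilin F (2 * n + 1) (phi7 F hn g) (phi7 F hn h + q) = bilin F 7 g h := by
  rw [← bilin_phi7_add hn g h (zero_mem _) hq, add_zero]

theorem bilin_phi7_left (hn : 3 ≤ n) (g h : Fin 7 → F) {q : Fin (2 * n + 1) → F}
    (hq : q ∈ Submodule.span F (Set.range (pad F hn))) :
    bilin F (2 * n + 1) (phi7 F hn g + q) (phi7 F hn h) = bilin F 7 g h := by
  rw [bilin_symm, bilin_phi7_right hn h g hq, bilin_symm]

theorem bilin_phi7_sub (hn : 3 ≤ n) (g h k : Fin 7 → F) {p q : Fin (2 * n + 1) → F}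
    (hp : p ∈ Submodule.span F (Set.range (pad F hn)))
    (hq : q ∈ Submodule.span F (Set.range (pad F hn))) :
    bilin F (2 * n + 1) (phi7 F hn g + p - (phi7 F hn h + q)) (phi7 F hn k) =
      bilin F 7 (g - h) k := by
  rw [← bilin_phi7_left hn (g - h) k (sub_mem hp hq), map_sub (phi7 F hn), add_sub_add_comm]

theorem infinite_of_three [Infinite F] (hn : 3 ≤ n) {r : ℕ} {c : Fin r → ℕ} (hc : ∑ i, c i ≤ n)
    (i : Fin r) (hi : 2 ≤ ∑ j ∈ Finset.Iic i, c j) (hi' : ∑ j ∈ Finset.Iic i, c j < n) {a b : ℕ}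
    (ha : 2 ≤ a) (ha' : a < n) (hb : 2 ≤ b) (hb' : b < n) :
    ¬ Finite (Quot (TripleRel F n 1 1 r ![a] ![b] c)) := by
  have hs : ∀ a : ℕ, ∑ j ∈ Finset.Iic (0 : Fin 1), (![a] : Fin 1 → ℕ) j = a := fun a =>
    Finset.sum_singleton _ _
  refine not_finite_quot (fun m x => ∃ u ∈ x.1.1 0, ∃ v ∈ x.2.1.1 0, ∃ w ∈ x.2.2.1 i,
    (∀ t ∈ x.2.2.1 i, bilin F (2 * n + 1) (u - v) t = 0) ∧
    (∀ t ∈ x.1.1 0, bilin F (2 * n + 1) (v - w) t = 0) ∧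
    (∀ t ∈ x.2.1.1 0, bilin F (2 * n + 1) (w - m • u) t = 0) ∧
    ∃ t ∈ x.2.2.1 i, bilin F (2 * n + 1) u t ≠ 0) ?_ fun l hl => ?_
  · rintro m x y ⟨g, hg, h1, h2, h3⟩ ⟨u, hu, v, hv, w, hw, h4, h5, h6, t, ht, h7⟩
    refine ⟨g u, map_mem_of_eq (h1 0) hu, g v, map_mem_of_eq (h2 0) hv, g w,
      map_mem_of_eq (h3 i) hw, ?_, ?_, ?_, g t, map_mem_of_eq (h3 i) ht, ?_⟩
    · rw [← map_sub]
      exact map_orth_of_eq hg (h3 i) h4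
    · rw [← map_sub]
      exact map_orth_of_eq hg (h1 0) h5
    · rw [← map_smul, ← map_sub]
      exact map_orth_of_eq hg (h2 0) h6
    · exact (hg u t).trans_ne h7
  · obtain ⟨X, hX0, hX1, hX⟩ := exists_flag_pair (F := F) hn (x := ![1, 0, 0, 0, 0, 0, 0])
        (y := ![0, 0, 0, 0, 1, l, 0])
      (z := ![0, 1, -l, 0, 0, 0, 0]) (Iso3.mk' (fun a b c h => by
        have e0 := congrFun h 0
        have e1 := congrFun h 1
        have e4 := congrFun h 4
        simp at e0 e1 e4
        exact ⟨e0, e4, e1⟩)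
        (by simp [bilin_seven]) (by simp [bilin_seven]) (by simp [bilin_seven])
        (by simp [bilin_seven]) (by simp [bilin_seven]) (by simp [bilin_seven])) ![a]
            (by simpa using ha'.le) 0
      (by rw [hs]; exact ha) (by rw [hs]; exact ha')
    obtain ⟨Y, hY0, hY1, hY⟩ := exists_flag_pair (F := F) hn (x := ![0, 0, 0, 0, 0, 1, 1])
        (y := ![0, 0, 1, 0, 0, 0, 0])
      (z := ![1, -1, 0, 0, 0, 0, 0]) (Iso3.mk' (fun a b c h => by
        have e0 := congrFun h 0
        have e1 := congrFun h 6
        have e4 := congrFun h 2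
        simp at e0 e1 e4
        exact ⟨e1, e4, e0⟩)
        (by simp [bilin_seven]) (by simp [bilin_seven]) (by simp [bilin_seven])
        (by simp [bilin_seven]) (by simp [bilin_seven]) (by simp [bilin_seven])) ![b]
            (by simpa using hb'.le) 0
      (by rw [hs]; exact hb) (by rw [hs]; exact hb')
    obtain ⟨Z, hZ0, hZ1, hZ⟩ := exists_flag_pair (F := F) hn (x := ![0, 1, 0, 0, 0, 0, 0])
        (y := ![0, 0, 0, 0, 1, 0, 1])
      (z := ![1, 0, -1, 0, 0, 0, 0]) (Iso3.mk' (fun a b c h => by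
        have e0 := congrFun h 0
        have e1 := congrFun h 1
        have e4 := congrFun h 4
        simp at e0 e1 e4
        exact ⟨e1, e4, e0⟩)
        (by simp [bilin_seven]) (by simp [bilin_seven]) (by simp [bilin_seven])
        (by simp [bilin_seven]) (by simp [bilin_seven]) (by simp [bilin_seven])) c hc i hi hi'
    refine ⟨(X, Y, Z), ⟨_, hX1, _, Submodule.smul_mem _ l hY0, _, Submodule.smul_mem _ l hZ1,
      fun t ht => ?_, fun t ht => ?_, fun t ht => ?_, _, hZ0, ?_⟩, ?_⟩
    · obtain ⟨x, y, q, hq, rfl⟩ := hZ t ht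
      rw [← map_smul, ← map_sub, bilin_phi7_right hn _ _ hq, bilin_seven]
      simp
    · obtain ⟨x, y, q, hq, rfl⟩ := hX t ht
      rw [← map_smul, ← map_smul, ← map_sub, bilin_phi7_right hn _ _ hq, bilin_seven]
      simp
    · obtain ⟨x, y, q, hq, rfl⟩ := hY t ht
      rw [← map_smul, ← map_smul, ← map_sub, bilin_phi7_right hn _ _ hq, bilin_seven]
      simp
    · rw [bilin_phi7, bilin_seven]
      simpa using hl
    · rintro m ⟨u, hu, v, hv, w, hw, h1, h2, h3, t, ht, h4⟩
      obtain ⟨u0, u1, p, hp, rfl⟩ := hX u hu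
      obtain ⟨v0, v1, q, hq, rfl⟩ := hY v hv
      obtain ⟨w0, w1, s, hs, rfl⟩ := hZ w hw
      obtain ⟨t0, t1, s', hs', rfl⟩ := hZ t ht
      have a1 := h1 _ hZ0
      have a2 := h1 _ hZ1
      have b1 := h2 _ hX0
      have b2 := h2 _ hX1
      have c1 := h3 _ hY0
      have c2 := h3 _ hY1
      rw [smul_add, ← map_smul] at c1 c2
      rw [bilin_phi7_sub hn _ _ _ hp hq, bilin_seven] at a1 a2
      rw [bilin_phi7_sub hn _ _ _ hq hs, bilin_seven] at b1 b2
      rw [bilin_phi7_sub hn _ _ _ hs (Submodule.smul_mem _ m hp), bilin_seven] at c1 c2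
      rw [bilin_phi7_add hn _ _ hp hs', bilin_seven] at h4
      simp at a1 a2 b1 b2 c1 c2 h4
      rcases eq_or_ne u1 0 with h5 | h5
      · subst h5
        have h6 : u0 ≠ 0 := by
          rintro rfl
          simp at h4
        exact Or.inr (mul_left_cancel₀ h6 (by linear_combination -l * c1 - b2 - a2))
      · exact Or.inl (mul_left_cancel₀ h5 (by linear_combination -a1 - b1 - c2))

end Families

end Cfg

namespace Cfg

variable {F : Type u} [Field F] {n : ℕ}

section Families

theorem sum_Iic_one (a : ℕ) : ∑ j ∈ Finset.Iic (0 : Fin 1), (![a] : Fin 1 → ℕ) j = a :=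
  Finset.sum_singleton _ _

theorem sum_Iic_fin_zero {k : ℕ} (c : Fin (k + 1) → ℕ) :
    ∑ j ∈ Finset.Iic (0 : Fin (k + 1)), c j = c 0 := by
  have h : Finset.Iic (0 : Fin (k + 1)) = {0} := by
    ext i
    simp
  rw [h, Finset.sum_singleton]

theorem sum_Iic_fin_one {k : ℕ} (c : Fin (k + 2) → ℕ) :
    ∑ j ∈ Finset.Iic (1 : Fin (k + 2)), c j = c 0 + c 1 := by
  have h : Finset.Iic (1 : Fin (k + 2)) = {0, 1} := by
    ext i
    rw [Finset.mem_Iic, Finset.mem_insert, Finset.mem_singleton, Fin.ext_iff, Fin.ext_iff,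
      Fin.le_def]
    change i.1 ≤ 1 ↔ i.1 = 0 ∨ i.1 = 1
    omega
  rw [h, Finset.sum_pair (Fin.ne_of_val_ne (by change 0 ≠ 1; omega))]

theorem sum_Iic_fin_two {k : ℕ} (c : Fin (k + 3) → ℕ) :
    ∑ j ∈ Finset.Iic (2 : Fin (k + 3)), c j = c 0 + (c 1 + c 2) := by
  have e : ((2 : Fin (k + 3)) : ℕ) = 2 :=
    Nat.mod_eq_of_lt (Nat.lt_add_left k (by decide : 2 < 3))
  have e' : ((1 : Fin (k + 3)) : ℕ) = 1 :=
    Nat.mod_eq_of_lt (Nat.lt_add_left k (by decide : 1 < 3))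
  have h : Finset.Iic (2 : Fin (k + 3)) = {0, 1, 2} := by
    ext i
    simp only [Finset.mem_Iic, Finset.mem_insert, Finset.mem_singleton, Fin.ext_iff, Fin.le_def, e,
      e', Fin.val_zero]
    omega
  rw [h, Finset.sum_insert, Finset.sum_pair]
  · exact Fin.ne_of_val_ne (by rw [e, e']; decide)
  · simp only [Finset.mem_insert, Finset.mem_singleton, Fin.ext_iff, e, e', Fin.val_zero]
    omega

theorem infinite_of_one_top [Infinite F] (h2 : (2 : F) ≠ 0) (hn : 3 ≤ n) {c : Fin 2 → ℕ}
    (hc : c 0 = 1) (hc' : c 0 + c 1 = n) {a b : ℕ}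
    (ha : 2 ≤ a) (ha' : a < n) (hb : 2 ≤ b) (hb' : b < n) :
    ¬ Finite (Quot (TripleRel F n 1 1 2 ![a] ![b] c)) := by
  have h20 : (2 : F) * 2⁻¹ = 1 := mul_inv_cancel₀ h2
  refine not_finite_quot (fun m x => ∃ s ∈ x.1.1 0, ∃ t ∈ x.2.1.1 0, ∃ u ∈ x.1.1 0, ∃ v ∈ x.2.1.1 0,
    (∀ w ∈ x.2.2.1 0, bilin F (2 * n + 1) s w = 0) ∧
    (∀ w ∈ x.2.2.1 0, bilin F (2 * n + 1) t w = 0) ∧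
    (∀ w ∈ x.2.2.1 1, bilin F (2 * n + 1) (u - v) w = 0) ∧
    bilin F (2 * n + 1) u v * bilin F (2 * n + 1) s t =
      m * (bilin F (2 * n + 1) u t * bilin F (2 * n + 1) v s) ∧
    bilin F (2 * n + 1) u t * bilin F (2 * n + 1) v s ≠ 0) ?_ fun l hl => ?_
  · rintro m x y ⟨g, hg, h1, h2, h3⟩ ⟨s, hs, t, ht, u, hu, v, hv, h4, h5, h6, h7⟩
    have hg' : ∀ u v, bilin F (2 * n + 1) (g u) (g v) = bilin F (2 * n + 1) u v := hg
    refine ⟨g s, map_mem_of_eq (h1 0) hs, g t, map_mem_of_eq (h2 0) ht, g u,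
      map_mem_of_eq (h1 0) hu, g v, map_mem_of_eq (h2 0) hv, map_orth_of_eq hg (h3 0) h4,
      map_orth_of_eq hg (h3 0) h5, ?_, ?_⟩
    · rw [← map_sub]
      exact map_orth_of_eq hg (h3 1) h6
    · simpa only [hg'] using h7
  · obtain ⟨X, hX0, hX1, hX⟩ := exists_flag_pair (F := F) hn (x := ![0, 0, 0, 0, 0, 0, 1])
      (y := ![0, 0, 0, 0, 0, 1, 0]) (z := ![0, 0, 0, 0, 1, 0, 0]) (Iso3.mk' (fun a b c h => by
        have e0 := congrFun h 6
        have e1 := congrFun h 5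
        have e4 := congrFun h 4
        simp at e0 e1 e4
        exact ⟨e0, e1, e4⟩)
        (by simp [bilin_seven]) (by simp [bilin_seven]) (by simp [bilin_seven])
        (by simp [bilin_seven]) (by simp [bilin_seven]) (by simp [bilin_seven])) ![a]
      (by simpa using ha'.le) 0 (by rw [sum_Iic_one]; exact ha) (by rw [sum_Iic_one]; exact ha')
    obtain ⟨Y, hY0, hY1, hY⟩ := exists_flag_pair (F := F) hn
      (x := ![-2⁻¹, 1, 1, 1, 0, 0, 1])
      (y := ![-1, 2 * l, 0, 0, 1, 0, 0]) (z := ![-1, 0, -(2 * l), 0, 0, 1, 0])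
      (Iso3.mk' (fun a b c h => by
        have e0 := congrFun h 6
        have e1 := congrFun h 4
        have e4 := congrFun h 5
        simp at e0 e1 e4
        exact ⟨e0, e1, e4⟩)
        (by simp [bilin_seven]; linear_combination -h20) (by simp [bilin_seven])
        (by simp [bilin_seven])
        (by simp [bilin_seven]) (by simp [bilin_seven]) (by simp [bilin_seven])) ![b]
      (by simpa using hb'.le) 0 (by rw [sum_Iic_one]; exact hb) (by rw [sum_Iic_one]; exact hb')
    have hZi : Iso3 (F := F) ![![1, 0, 0, 0, 0, 0, 0], ![0, 1, 0, 0, 0, 0, 0],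
        ![0, 0, 1, 0, 0, 0, 0]] := Iso3.mk' (fun a b c h => by
        have e0 := congrFun h 0
        have e1 := congrFun h 1
        have e4 := congrFun h 2
        simp at e0 e1 e4
        exact ⟨e0, e1, e4⟩)
        (by simp [bilin_seven]) (by simp [bilin_seven]) (by simp [bilin_seven])
        (by simp [bilin_seven]) (by simp [bilin_seven]) (by simp [bilin_seven])
    have s0 : ∑ j ∈ Finset.Iic (0 : Fin 2), c j = 1 := (Finset.sum_singleton _ _).trans hc
    have s1 : ∑ j ∈ Finset.Iic (1 : Fin 2), c j = n :=
      (Fin.sum_univ_two c).trans hc'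
    obtain ⟨Z, hZ, hZ'⟩ := exists_flag hn hZi.indep hZi.isot
      ![⟨0, by omega⟩, ⟨1, by omega⟩, ⟨2, by omega⟩] (fun i j hij => by
        have := congrArg Fin.val hij
        fin_cases i <;> fin_cases j <;> simp at this ⊢) c (by rw [Fin.sum_univ_two, hc'])
    have hd : phi7 F hn ![1, 0, 0, 0, 0, 0, 0] ∈ Z.1 0 := hZ 0 0 (by rw [s0]; exact zero_lt_one)
    have hd1 : phi7 F hn ![1, 0, 0, 0, 0, 0, 0] ∈ Z.1 1 :=
      hZ 1 0 (by rw [s1]; change 0 < n; omega)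
    have hs1 : phi7 F hn ![0, 1, 0, 0, 0, 0, 0] ∈ Z.1 1 :=
      hZ 1 1 (by rw [s1]; change 1 < n; omega)
    have ht1 : phi7 F hn ![0, 0, 1, 0, 0, 0, 0] ∈ Z.1 1 :=
      hZ 1 2 (by rw [s1]; change 2 < n; omega)
    have hZ0 : ∀ w ∈ Z.1 0, ∃ x : F, ∃ q ∈ Submodule.span F (Set.range (pad F hn)),
        w = phi7 F hn (x • ![1, 0, 0, 0, 0, 0, 0]) + q := fun w hw => by
      obtain ⟨a, q, hq, rfl, ha⟩ := hZ' 0 w hw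
      refine ⟨a 0, q, hq, ?_⟩
      rw [Fin.sum_univ_three, ha 1 s0.le, ha 2 (s0.le.trans one_le_two), zero_smul, zero_smul,
        add_zero, add_zero]
      rfl
    have hZ1 : ∀ w ∈ Z.1 1, ∃ x y z : F, ∃ q ∈ Submodule.span F (Set.range (pad F hn)),
        w = phi7 F hn (x • ![1, 0, 0, 0, 0, 0, 0] + y • ![0, 1, 0, 0, 0, 0, 0] +
          z • ![0, 0, 1, 0, 0, 0, 0]) + q := fun w hw => by
      obtain ⟨a, q, hq, rfl, -⟩ := hZ' 1 w hw
      refine ⟨a 0, a 1, a 2, q, hq, ?_⟩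
      rw [Fin.sum_univ_three]
      rfl
    refine ⟨(X, Y, Z), ⟨_, hX1, _, hY1, _, hX0, _, hY0, fun t ht => ?_, fun t ht => ?_,
      fun t ht => ?_, ?_, ?_⟩, ?_⟩
    · obtain ⟨x, q, hq, rfl⟩ := hZ0 t ht
      rw [bilin_phi7_right hn _ _ hq, bilin_seven]
      simp
    · obtain ⟨x, q, hq, rfl⟩ := hZ0 t ht
      rw [bilin_phi7_right hn _ _ hq, bilin_seven]
      simp
    · obtain ⟨x, y, z, q, hq, rfl⟩ := hZ1 t ht
      rw [← map_sub, bilin_phi7_right hn _ _ hq, bilin_seven]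
      simp
    · simp only [bilin_phi7]
      simp [bilin_seven]
      linear_combination l * h20
    · simp only [bilin_phi7]
      simp [bilin_seven]
    · rintro m ⟨s, hs, t, ht, u, hu, v, hv, h3, h4, h5, h6, h7⟩
      obtain ⟨s0, s1, p, hp, rfl⟩ := hX s hs
      obtain ⟨t0, t1, p', hp', rfl⟩ := hY t ht
      obtain ⟨u0, u1, q, hq, rfl⟩ := hX u hu
      obtain ⟨v0, v1, q', hq', rfl⟩ := hY v hv
      have a1 := h3 _ hd
      have a2 := h4 _ hd
      have b1 := h5 _ hd1
      have b2 := h5 _ hs1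
      have b3 := h5 _ ht1
      rw [bilin_phi7_left hn _ _ hp, bilin_seven] at a1
      rw [bilin_phi7_left hn _ _ hp', bilin_seven] at a2
      rw [bilin_phi7_sub hn _ _ _ hq hq', bilin_seven] at b1 b2 b3
      simp at a1 a2 b1 b2 b3
      subst a1 a2 b3
      simp only [bilin_phi7_add hn _ _ hq hq', bilin_phi7_add hn _ _ hp hp',
        bilin_phi7_add hn _ _ hq hp', bilin_phi7_add hn _ _ hq' hp] at h6 h7
      simp [bilin_seven] at h6 h7
      obtain rfl := sub_eq_zero.1 b1
      subst b2
      have ht1 : t1 ≠ 0 := by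
        rintro rfl
        simp at h7
      have hu0 : u0 ≠ 0 := h7.2.1
      have hs1 : s1 ≠ 0 := h7.2.2
      refine Or.inl (mul_left_cancel₀ (mul_ne_zero (mul_ne_zero hu0 hu0) (mul_ne_zero hs1 ht1)) ?_)
      linear_combination h6 + l * (u0 * u0 * (s1 * t1)) * h20

theorem infinite_of_three_steps [Infinite F] (h2 : (2 : F) ≠ 0) (hn : 3 ≤ n) {r : ℕ}
    {c : Fin (r + 3) → ℕ} (hpos : ∀ i, 0 < c i) (hc : ∑ i, c i ≤ n) {a : ℕ}
    (ha : 2 ≤ a) (ha' : a < n) :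
    ¬ Finite (Quot (TripleRel F n 1 1 (r + 3) ![a] ![n] c)) := by
  have h20 : (2 : F) * 2⁻¹ = 1 := mul_inv_cancel₀ h2
  refine not_finite_quot (fun m x => ∃ u ∈ x.1.1 0, ∃ v ∈ x.2.2.1 1, ∃ u' ∈ x.1.1 0,
    ∃ v' ∈ x.2.2.1 2, ∃ w ∈ x.2.2.1 0,
    (∀ t ∈ x.2.1.1 0, bilin F (2 * n + 1) (u - v) t = 0) ∧ u' - v' ∈ x.2.1.1 0 ∧
    bilin F (2 * n + 1) u' w * bilin F (2 * n + 1) u v =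
      m * (bilin F (2 * n + 1) u w * bilin F (2 * n + 1) u v') ∧
    bilin F (2 * n + 1) u w * bilin F (2 * n + 1) u v' ≠ 0) ?_ fun l hl => ?_
  · rintro m x y ⟨g, hg, h1, h2, h3⟩ ⟨u, hu, v, hv, u', hu', v', hv', w, hw, h4, h5, h6⟩
    have hg' : ∀ u v, bilin F (2 * n + 1) (g u) (g v) = bilin F (2 * n + 1) u v := hg
    refine ⟨g u, map_mem_of_eq (h1 0) hu, g v, map_mem_of_eq (h3 1) hv, g u',
      map_mem_of_eq (h1 0) hu', g v', map_mem_of_eq (h3 2) hv', g w, map_mem_of_eq (h3 0) hw,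
      ?_, ?_, ?_⟩
    · rw [← map_sub]
      exact map_orth_of_eq hg (h2 0) h4
    · rw [← map_sub]
      exact map_mem_of_eq (h2 0) h5
    · simpa only [hg'] using h6
  · obtain ⟨X, hX0, hX1, hX⟩ := exists_flag_pair (F := F) hn (x := ![0, 0, 0, 0, 0, 1, 0])
      (y := ![0, 0, 0, 0, 1, 0, 0]) (z := ![0, 0, 0, 0, 0, 0, 1]) (Iso3.mk' (fun a b c h => by
        have e0 := congrFun h 5
        have e1 := congrFun h 4
        have e4 := congrFun h 6
        simp at e0 e1 e4
        exact ⟨e0, e1, e4⟩)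
        (by simp [bilin_seven]) (by simp [bilin_seven]) (by simp [bilin_seven])
        (by simp [bilin_seven]) (by simp [bilin_seven]) (by simp [bilin_seven])) ![a]
      (by simpa using ha'.le) 0 (by rw [sum_Iic_one]; exact ha) (by rw [sum_Iic_one]; exact ha')
    have hYi : Iso3 (F := F) ![![1, 0, 0, 0, 0, 0, 0], ![0, 1, 0, 0, 0, 0, 0],
        ![0, 0, 1, 0, 0, 0, 0]] := Iso3.mk' (fun a b c h => by
        have e0 := congrFun h 0
        have e1 := congrFun h 1
        have e4 := congrFun h 2
        simp at e0 e1 e4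
        exact ⟨e0, e1, e4⟩)
        (by simp [bilin_seven]) (by simp [bilin_seven]) (by simp [bilin_seven])
        (by simp [bilin_seven]) (by simp [bilin_seven]) (by simp [bilin_seven])
    have hZi : Iso3 (F := F) ![![0, 1, 2 * l, 0, 0, 0, 1], ![-1, -2⁻¹, 1, 1, 0, 1, 0],
        ![-(2 * l), -1, 0, 0, 1, 0, 0]] := Iso3.mk' (fun a b c h => by
        have e0 := congrFun h 6
        have e1 := congrFun h 5
        have e4 := congrFun h 4
        simp at e0 e1 e4
        exact ⟨e0, e1, e4⟩)
        (by simp [bilin_seven]) (by simp [bilin_seven]) (by simp [bilin_seven])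
        (by simp [bilin_seven]; linear_combination -h20) (by simp [bilin_seven])
        (by simp [bilin_seven])
    obtain ⟨Y, hY, hY'⟩ := exists_flag hn hYi.indep hYi.isot
      ![⟨0, by omega⟩, ⟨1, by omega⟩, ⟨2, by omega⟩] (fun i j hij => by
        have := congrArg Fin.val hij
        fin_cases i <;> fin_cases j <;> simp at this ⊢) ![n] (by simp)
    have hx : phi7 F hn ![1, 0, 0, 0, 0, 0, 0] ∈ Y.1 0 :=
      hY 0 0 (by rw [sum_Iic_one]; change 0 < n; omega)
    have hy : phi7 F hn ![0, 1, 0, 0, 0, 0, 0] ∈ Y.1 0 :=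
      hY 0 1 (by rw [sum_Iic_one]; change 1 < n; omega)
    have hw : phi7 F hn ![0, 0, 1, 0, 0, 0, 0] ∈ Y.1 0 :=
      hY 0 2 (by rw [sum_Iic_one]; change 2 < n; omega)
    have hY0 : ∀ w ∈ Y.1 0, ∃ x y z : F, ∃ q ∈ Submodule.span F (Set.range (pad F hn)),
        w = phi7 F hn (x • ![1, 0, 0, 0, 0, 0, 0] + y • ![0, 1, 0, 0, 0, 0, 0] +
          z • ![0, 0, 1, 0, 0, 0, 0]) + q := fun w hw => by
      obtain ⟨a, q, hq, rfl, -⟩ := hY' 0 w hw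
      refine ⟨a 0, a 1, a 2, q, hq, ?_⟩
      rw [Fin.sum_univ_three]
      rfl
    have s0 : ∑ j ∈ Finset.Iic (0 : Fin (r + 3)), c j = c 0 := sum_Iic_fin_zero c
    have s1 : ∑ j ∈ Finset.Iic (1 : Fin (r + 3)), c j = c 0 + c 1 := sum_Iic_fin_one c
    have s2 : ∑ j ∈ Finset.Iic (2 : Fin (r + 3)), c j = c 0 + (c 1 + c 2) := sum_Iic_fin_two c
    have hle : c 0 + (c 1 + c 2) ≤ n := by
      rw [← s2]
      exact (Finset.sum_le_sum_of_subset (Finset.subset_univ _)).trans hc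
    have p0 := hpos 0
    have p1 := hpos 1
    have p2 := hpos 2
    obtain ⟨Z, hZ, hZ'⟩ := exists_flag hn hZi.indep hZi.isot
      ![⟨0, by omega⟩, ⟨c 0, by omega⟩, ⟨c 0 + c 1, by omega⟩] (fun i j hij => by
        have := congrArg Fin.val hij
        fin_cases i <;> fin_cases j <;> simp at this ⊢ <;> omega) c hc
    have hcx : phi7 F hn ![0, 1, 2 * l, 0, 0, 0, 1] ∈ Z.1 0 := hZ 0 0 (by rw [s0]; exact p0)
    have hcy : phi7 F hn ![-1, -2⁻¹, 1, 1, 0, 1, 0] ∈ Z.1 1 :=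
      hZ 1 1 (by rw [s1]; change c 0 < _; omega)
    have hcw : phi7 F hn ![-(2 * l), -1, 0, 0, 1, 0, 0] ∈ Z.1 2 :=
      hZ 2 2 (by rw [s2]; change c 0 + c 1 < _; omega)
    have hZ0 : ∀ w ∈ Z.1 0, ∃ x : F, ∃ q ∈ Submodule.span F (Set.range (pad F hn)),
        w = phi7 F hn (x • ![0, 1, 2 * l, 0, 0, 0, 1]) + q := fun w hw => by
      obtain ⟨a, q, hq, rfl, ha⟩ := hZ' 0 w hw
      refine ⟨a 0, q, hq, ?_⟩
      rw [Fin.sum_univ_three, ha 1 s0.le, ha 2 (s0.le.trans (Nat.le_add_right _ _)), zero_smul,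
        zero_smul, add_zero, add_zero]
      rfl
    have hZ1 : ∀ w ∈ Z.1 1, ∃ x y : F, ∃ q ∈ Submodule.span F (Set.range (pad F hn)),
        w = phi7 F hn (x • ![0, 1, 2 * l, 0, 0, 0, 1] + y • ![-1, -2⁻¹, 1, 1, 0, 1, 0]) + q :=
        fun w hw => by
      obtain ⟨a, q, hq, rfl, ha⟩ := hZ' 1 w hw
      refine ⟨a 0, a 1, q, hq, ?_⟩
      rw [Fin.sum_univ_three, ha 2 s1.le, zero_smul, add_zero]
      rfl
    have hZ2 : ∀ w ∈ Z.1 2, ∃ x y z : F, ∃ q ∈ Submodule.span F (Set.range (pad F hn)),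
        w = phi7 F hn (x • ![0, 1, 2 * l, 0, 0, 0, 1] + y • ![-1, -2⁻¹, 1, 1, 0, 1, 0] +
          z • ![-(2 * l), -1, 0, 0, 1, 0, 0]) + q := fun w hw => by
      obtain ⟨a, q, hq, rfl, -⟩ := hZ' 2 w hw
      refine ⟨a 0, a 1, a 2, q, hq, ?_⟩
      rw [Fin.sum_univ_three]
      rfl
    refine ⟨(X, Y, Z), ⟨_, hX0, _, hcy, _, hX1, _, hcw, _, hcx, fun t ht => ?_, ?_, ?_, ?_⟩, ?_⟩
    · obtain ⟨x, y, z, q, hq, rfl⟩ := hY0 t ht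
      rw [← map_sub, bilin_phi7_right hn _ _ hq, bilin_seven]
      simp
    · rw [← map_sub]
      have e : (![0, 0, 0, 0, 1, 0, 0] - ![-(2 * l), -1, 0, 0, 1, 0, 0] : Fin 7 → F) =
          (2 * l) • ![1, 0, 0, 0, 0, 0, 0] + ![0, 1, 0, 0, 0, 0, 0] := by
        ext i
        fin_cases i <;> simp
      rw [e, map_add, map_smul]
      exact add_mem (Submodule.smul_mem _ (2 * l) hx) hy
    · simp only [bilin_phi7]
      simp [bilin_seven]
      linear_combination l * h20
    · simp only [bilin_phi7]
      simp [bilin_seven]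
    · rintro m ⟨u, hu, v, hv, u', hu', v', hv', t, ht, h3, h4, h5, h6⟩
      obtain ⟨u0, u1, p, hp, rfl⟩ := hX u hu
      obtain ⟨v0, v1, p', hp', rfl⟩ := hZ1 v hv
      obtain ⟨a0, a1, q, hq, rfl⟩ := hX u' hu'
      obtain ⟨b0, b1, b2, q', hq', rfl⟩ := hZ2 v' hv'
      obtain ⟨t0, s, hs, rfl⟩ := hZ0 t ht
      have e1 := h3 _ hx
      have e2 := h3 _ hy
      have e3 := h3 _ hw
      rw [bilin_phi7_sub hn _ _ _ hp hp', bilin_seven] at e1 e2 e3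
      obtain ⟨x, y, z, s', hs', he⟩ := hY0 _ h4
      have key : ∀ k : Fin 7 → F, bilin F 7 (a0 • ![0, 0, 0, 0, 0, 1, 0] +
          a1 • ![0, 0, 0, 0, 1, 0, 0] - (b0 • ![0, 1, 2 * l, 0, 0, 0, 1] +
          b1 • ![-1, -2⁻¹, 1, 1, 0, 1, 0] + b2 • ![-(2 * l), -1, 0, 0, 1, 0, 0])) k =
          bilin F 7 (x • ![1, 0, 0, 0, 0, 0, 0] + y • ![0, 1, 0, 0, 0, 0, 0] +
          z • ![0, 0, 1, 0, 0, 0, 0]) k := fun k => by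
        rw [← bilin_phi7_sub hn _ _ _ hq hq', he, bilin_phi7_left hn _ _ hs']
      have e4 := key ![1, 0, 0, 0, 0, 0, 0]
      have e5 := key ![0, 1, 0, 0, 0, 0, 0]
      have e6 := key ![0, 0, 1, 0, 0, 0, 0]
      have e7 := key ![0, 0, 0, 1, 0, 0, 0]
      rw [bilin_seven, bilin_seven] at e4 e5 e6 e7
      simp at e1 e2 e3 e4 e5 e6 e7
      simp only [bilin_phi7_add hn _ _ hq hs, bilin_phi7_add hn _ _ hp hp',
        bilin_phi7_add hn _ _ hp hs, bilin_phi7_add hn _ _ hp hq'] at h5 h6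
      simp [bilin_seven] at h5 h6
      obtain rfl := sub_eq_zero.1 e2
      obtain rfl := sub_eq_zero.1 e5
      obtain rfl := sub_eq_zero.1 e6
      subst e1 e3 e4 e7
      refine Or.inl (mul_left_cancel₀ (b := m) (c := l) (a := (u0 * t0) * (u0 * -a1)) ?_ ?_)
      · simpa using h6
      · linear_combination -h5 + l * ((u0 * t0) * (u0 * -a1)) * h20

end Families

end Cfg

/-- Theorem 1.3: with `a = (α)`, `b = (β)`, `c = (γ_1, …, γ_r)`,
`α ≤ β` (and `β ≤ γ_1` when `r = 1`), and assuming condition (C), the triple flag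
variety `M_a × M_b × M_c` has finitely many `O_{2n+1}(F)`-orbits iff
(I) `α = β = n`, (II) `α = 1`, (III) `r = 1 ∧ γ_1 = n`, or (IV) `r = 2 ∧ β = n`. -/
theorem statement3 (F : Type*) [Field F] [Infinite F] (hchar : (2 : F) ≠ 0)
    (n : ℕ) (hn : 1 ≤ n) (α β : ℕ) (r : ℕ) (hr : 0 < r) (c : Fin r → ℕ)
    (hα : 0 < α) (hβ : 0 < β) (hcpos : ∀ i, 0 < c i)
    (hαn : α ≤ n) (hβn : β ≤ n) (hcsum : (∑ i, c i) ≤ n)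
    (hab : α ≤ β) (hbc : r = 1 → β ≤ c ⟨0, hr⟩)
    (hC : max α (max β (c ⟨0, hr⟩)) < n →
      Finite (Fˣ ⧸ (powMonoidHom 2 : Fˣ →* Fˣ).range)) :
    Finite (Quot (TripleRel F n 1 1 r ![α] ![β] c)) ↔
      ((α = n ∧ β = n) ∨ α = 1 ∨ (r = 1 ∧ c ⟨0, hr⟩ = n) ∨ (r = 2 ∧ β = n)) := by
  constructor
  · intro hfin
    by_contra! h
    obtain ⟨h1, hα1, h3, h4⟩ := h
    have hα2 : 2 ≤ α := by omega
    have hαlt : α < n := lt_of_le_of_ne hαn fun e => h1 e (by omega)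
    have hn3 : 3 ≤ n := by omega
    match r, hr, c, hcpos, hcsum, hbc, h3, h4, hfin with
    | 1, _, c, _, hcsum, hbc, h3, _, hfin =>
      have hc0 : β ≤ c 0 := hbc rfl
      have hc1 : c 0 ≠ n := h3 rfl
      have hc2 : c 0 ≤ n := (Fin.sum_univ_one c).symm.trans_le hcsum
      have s0 := Cfg.sum_Iic_fin_zero c
      exact Cfg.infinite_of_three hn3 hcsum 0
          ((by omega : 2 ≤ c 0).trans_eq s0.symm) (s0.trans_lt (by omega)) hα2 hαlt (by omega)
              (by omega)
        hfin
    | 2, _, c, hcpos, hcsum, _, _, h4, hfin =>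
      have hβ1 : β ≠ n := h4 rfl
      have hc2 : c 0 + c 1 ≤ n := (Fin.sum_univ_two c).symm.trans_le hcsum
      have p0 := hcpos 0
      have p1 := hcpos 1
      have s0 := Cfg.sum_Iic_fin_zero c
      have s1 := Cfg.sum_Iic_fin_one c
      by_cases hlt : c 0 + c 1 < n
      · exact Cfg.infinite_of_three hn3 hcsum 1
          ((by omega : 2 ≤ c 0 + c 1).trans_eq s1.symm) (s1.trans_lt (by omega)) hα2 hαlt (by omega)
          (by omega) hfin
      by_cases hc0 : c 0 = 1
      · exact Cfg.infinite_of_one_top hchar hn3 hc0 (by omega) hα2 hαlt (by omega) (by omega) hfin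
      · exact Cfg.infinite_of_three hn3 hcsum 0
          ((by omega : 2 ≤ c 0).trans_eq s0.symm) (s0.trans_lt (by omega)) hα2 hαlt (by omega)
          (by omega) hfin
    | r + 3, _, c, hcpos, hcsum, _, _, _, hfin =>
      have p0 := hcpos 0
      have p1 := hcpos 1
      have p2 := hcpos 2
      have s1 := Cfg.sum_Iic_fin_one c
      have s2 := Cfg.sum_Iic_fin_two c
      have hle : ∑ j ∈ Finset.Iic (2 : Fin (r + 3)), c j ≤ n :=
        (Finset.sum_le_sum_of_subset (Finset.subset_univ _)).trans hcsum
      rcases hβn.eq_or_lt with rfl | hβlt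
      · exact Cfg.infinite_of_three_steps hchar hn3 hcpos hcsum hα2 hαlt hfin
      · exact Cfg.infinite_of_three hn3 hcsum 1
          ((by omega : 2 ≤ c 0 + c 1).trans_eq s1.symm) (s1.trans_lt (by omega)) hα2 hαlt
              (by omega) hβlt hfin
  · rintro (⟨rfl, rfl⟩ | rfl | ⟨rfl, hc⟩ | ⟨rfl, rfl⟩)
    · exact Cfg.finite_of_max_max hchar hr
    · by_cases hβ' : β = n
      · exact Cfg.finite_of_line hchar (.inl hβ')
      by_cases hc : c ⟨0, hr⟩ = n
      · obtain rfl : r = 1 := by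
          by_contra hr1
          have hlt : c ⟨0, hr⟩ + c ⟨1, by omega⟩ ≤ ∑ i, c i := by
            rw [← Finset.sum_pair (Fin.ne_of_val_ne zero_ne_one)]
            exact Finset.sum_le_sum_of_subset (Finset.subset_univ _)
          have := hcpos ⟨1, by omega⟩
          omega
        exact Cfg.finite_of_one_max hchar hc
      · have hle : c ⟨0, hr⟩ ≤ n := (Finset.single_le_sum (fun i _ => Nat.zero_le _)
          (Finset.mem_univ _)).trans hcsum
        exact Cfg.finite_of_line hchar (.inr (hC (by omega)))
    · exact Cfg.finite_of_one_max hchar hc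
    · exact Cfg.finite_of_two_max hchar
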